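/- arXiv:1108.3539 — 7 statements merged into one kernel-verified Lean document; each statement's English description precedes it below -/
import Mathlib

section
/- For every ε > 0 there is a constant C(ε) such that for all odd integers N ≥ 3 and all U, V > 0: |K_0(N) − ∑_{f ≤ V, f odd} (1/f) ∑_{n ≤ U} (1/(n·φ(4nf²))) ∑_{a mod 4n, a ≡ 1 (4)} (a/n)·#C_N(a,n,f)| ≤ C(ε)·(N^ε/√U + (log log N)/V). -/
open scoped Classical BigOperators

noncomputable section

/-- #C_N(a,n,f): the number of z ∈ (ℤ/4nf²ℤ)^* with D_N(z) ≡ af² (mod 4nf²) -/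
def CNcard (N a n f : ℕ) : ℕ :=
  Nat.card {z : (ZMod (4 * n * f ^ 2))ˣ //
    ((z : ZMod (4 * n * f ^ 2))) ^ 2
        - 2 * ((N : ZMod (4 * n * f ^ 2)) + 1) * ((z : ZMod (4 * n * f ^ 2)))
        + ((N : ZMod (4 * n * f ^ 2)) - 1) ^ 2
      = (a : ZMod (4 * n * f ^ 2)) * (f : ZMod (4 * n * f ^ 2)) ^ 2}

/-- the constant K₀(N) = ∑_{f odd} (1/f) ∑_{n ≥ 1} 1/(nφ(4nf²)) ∑_{a (4n), a ≡ 1 (4)}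
(a/n)·#C_N(a,n,f) -/
def K0 (N : ℕ) : ℝ :=
  ∑' f : ℕ, ∑' n : ℕ,
    if Odd f ∧ 0 < n then
      (1 / (f : ℝ)) * (1 / ((n : ℝ) * (Nat.totient (4 * n * f ^ 2) : ℝ))) *
        ∑ a ∈ (Finset.range (4 * n)).filter (fun a => a % 4 = 1),
          (jacobiSym (a : ℤ) n : ℝ) * (CNcard N a n f : ℝ)
    else 0

/-- The sum of `F` over representatives of the units modulo `q`. -/
def unitSum (q : ℕ) [NeZero q] (F : ℤ → ℤ) : ℤ :=
  ∑ u : (ZMod q)ˣ, F (u : ZMod q).val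

theorem val_modEq_of_cast_eq {q : ℕ} [NeZero q] {a : ZMod q} {x : ℤ} (h : (x : ZMod q) = a) :
    (a.val : ℤ) ≡ x [ZMOD q] := by
  rw [← ZMod.intCast_eq_intCast_iff]
  simp [h]

theorem unitSum_mul {q₁ q₂ : ℕ} [NeZero q₁] [NeZero q₂] (h : q₁.Coprime q₂) {F G : ℤ → ℤ}
    (hF : ∀ x y : ℤ, x ≡ y [ZMOD q₁] → F x = F y) (hG : ∀ x y : ℤ, x ≡ y [ZMOD q₂] → G x = G y) :
    unitSum (q₁ * q₂) (fun x => F x * G x) = unitSum q₁ F * unitSum q₂ G := by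
  unfold unitSum
  rw [Finset.sum_mul_sum, ← Fintype.sum_prod_type']
  refine Fintype.sum_equiv
    ((Units.mapEquiv (ZMod.chineseRemainder h).toMulEquiv).trans MulEquiv.prodUnits).toEquiv _ _ ?_
  intro u
  have key : ZMod.chineseRemainder h (u : ZMod (q₁ * q₂)) =
      ((((u : ZMod (q₁ * q₂)).val : ℤ) : ZMod q₁), (((u : ZMod (q₁ * q₂)).val : ℤ) : ZMod q₂)) := by
    have h1 : (((u : ZMod (q₁ * q₂)).val : ℕ) : ZMod (q₁ * q₂)) = u := by simp
    conv_lhs => rw [← h1, map_natCast]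
    ext <;> simp
  refine congrArg₂ (· * ·) ?_ ?_
  · exact (hF _ _ (val_modEq_of_cast_eq (congrArg Prod.fst key).symm)).symm
  · exact (hG _ _ (val_modEq_of_cast_eq (congrArg Prod.snd key).symm)).symm

theorem card_mul_sum_comp {G H : Type*} [Group G] [Group H] [Fintype G] [Fintype H] (π : G →* H)
    (hπ : Function.Surjective π) (F : H → ℤ) :
    (Fintype.card H : ℤ) * ∑ g, F (π g) = (Fintype.card G : ℤ) * ∑ h, F h := by
  have h1 : ∀ h : H, ∑ g, F (π g) = ∑ g, F (π g * h) := by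
    intro h
    obtain ⟨g₀, rfl⟩ := hπ h
    simp_rw [← map_mul]
    exact (Equiv.sum_comp (Equiv.mulRight g₀) (fun g => F (π g))).symm
  calc (Fintype.card H : ℤ) * ∑ g, F (π g) = ∑ h : H, ∑ g, F (π g * h) := by
        rw [← Finset.sum_congr rfl (fun h _ => h1 h)]; simp
    _ = ∑ g : G, ∑ h, F h := by
        rw [Finset.sum_comm]
        exact Finset.sum_congr rfl fun g _ => Equiv.sum_comp (Equiv.mulLeft (π g)) F
    _ = _ := by simp

theorem unitSum_of_dvd {q Q : ℕ} [NeZero q] [NeZero Q] (h : q ∣ Q) {F : ℤ → ℤ}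
    (hF : ∀ x y : ℤ, x ≡ y [ZMOD q] → F x = F y) :
    (q.totient : ℤ) * unitSum Q F = Q.totient * unitSum q F := by
  have := card_mul_sum_comp (ZMod.unitsMap h) (ZMod.unitsMap_surjective h)
    (fun u => F (u : ZMod q).val)
  rw [ZMod.card_units_eq_totient, ZMod.card_units_eq_totient] at this
  unfold unitSum
  rw [← this]
  congr 1
  refine Finset.sum_congr rfl fun u _ => (hF _ _ (val_modEq_of_cast_eq ?_)).symm
  rw [ZMod.unitsMap_def, Units.coe_map]
  simp

theorem abs_unitSum_le {q : ℕ} [NeZero q] {F G : ℤ → ℤ} (h : ∀ x, |F x| ≤ G x) :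
    |unitSum q F| ≤ unitSum q G :=
  (Finset.abs_sum_le_sum_abs _ _).trans (Finset.sum_le_sum fun _ _ => h _)

theorem unitSum_nonneg {q : ℕ} [NeZero q] {F : ℤ → ℤ} (h : ∀ x, 0 ≤ F x) : 0 ≤ unitSum q F :=
  Finset.sum_nonneg fun _ _ => h _

/-- The discriminant polynomial `z² - 2(N+1)z + (N-1)²`. -/
def discPoly (N : ℕ) (z : ℤ) : ℤ := z ^ 2 - 2 * (N + 1) * z + (N - 1) ^ 2

theorem discPoly_eq (N : ℕ) (z : ℤ) : discPoly N z = (z - (N + 1)) ^ 2 - 4 * N := by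
  unfold discPoly; ring

theorem discPoly_modEq (N : ℕ) {q x y : ℤ} (h : x ≡ y [ZMOD q]) :
    discPoly N x ≡ discPoly N y [ZMOD q] := by
  unfold discPoly
  gcongr

theorem sum_quadraticChar_sq_sub {F : Type*} [Field F] [Fintype F] [DecidableEq F]
    (hF : ringChar F ≠ 2) {c : F} (hc : c ≠ 0) :
    ∑ w : F, quadraticChar F (w ^ 2 - c) = -1 := by
  have h2 : (2 : F) ≠ 0 := Ring.two_ne_zero hF
  have hcard : ∑ w : F, (quadraticChar F (w ^ 2 - c) + 1) = (Fintype.card F : ℤ) - 1 := by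
    have h1 : ∀ w : F, quadraticChar F (w ^ 2 - c) + 1
        = ∑ y : F, if y ^ 2 = w ^ 2 - c then (1 : ℤ) else 0 := by
      intro w
      rw [← quadraticChar_card_sqrts hF (w ^ 2 - c), Finset.sum_boole]
      norm_cast
      congr 1
      ext y
      simp
    simp_rw [h1]
    rw [← Fintype.sum_prod_type', Finset.sum_boole]
    have h3 : (Finset.univ.filter fun x : F × F => x.2 ^ 2 = x.1 ^ 2 - c).card
        = Fintype.card Fˣ := by
      rw [← Finset.card_univ]
      symm
      refine Finset.card_bij' (fun u _ => ((u + c * (u⁻¹ : Fˣ)) / 2, (u - c * (u⁻¹ : Fˣ)) / 2))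
        (fun x hx => Units.mk0 (x.1 + x.2) ?_) ?_ ?_ ?_ ?_
      · rintro h0
        simp only [Finset.mem_filter] at hx
        apply hc
        linear_combination (x.1 - x.2) * h0 + hx.2
      · intro u _
        simp only [Finset.mem_filter, Finset.mem_univ, true_and]
        have : (u : F) ≠ 0 := u.ne_zero
        simp only [Units.val_inv_eq_inv_val]
        field_simp
        ring
      · simp
      · intro u _
        ext
        simp only [Units.val_mk0]
        field_simp
        ring
      · intro x hx
        simp only [Finset.mem_filter, Finset.mem_univ, true_and] at hx
        have h0 : x.1 + x.2 ≠ 0 := fun h0 => hc (by linear_combination (x.1 - x.2) * h0 + hx)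
        have hcx : c = (x.1 + x.2) * (x.1 - x.2) := by linear_combination hx
        have h5 : c * ((Units.mk0 _ h0)⁻¹ : Fˣ) = x.1 - x.2 := by
          rw [hcx]; simp only [Units.val_inv_eq_inv_val, Units.val_mk0]; field_simp
        ext
        · simp only [h5, Units.val_mk0]; field_simp; ring
        · simp only [h5, Units.val_mk0]; field_simp; ring
    rw [h3, Fintype.card_units, Nat.cast_sub Fintype.card_pos]
    simp
  rw [Finset.sum_add_distrib] at hcard
  simp only [Finset.sum_const, Finset.card_univ, nsmul_eq_mul, mul_one] at hcard
  linarith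

theorem abs_unitSum_jacobiSym_prime {N p : ℕ} [Fact p.Prime] (hp2 : p ≠ 2) (hpN : ¬ p ∣ N) :
    |unitSum p (fun x => jacobiSym (discPoly N x) p)| ≤ 2 := by
  have hc : ((4 * N : ℕ) : ZMod p) ≠ 0 := by
    rw [Ne, ZMod.natCast_eq_zero_iff]
    intro h
    rcases (Fact.out : p.Prime).dvd_mul.1 h with h | h
    · exact hp2 ((Nat.prime_dvd_prime_iff_eq Fact.out Nat.prime_two).1
        ((Fact.out : p.Prime).dvd_of_dvd_pow (show p ∣ 2 ^ 2 from h)))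
    · exact hpN h
  have hsum := sum_quadraticChar_sq_sub (F := ZMod p) ((ZMod.ringChar_zmod_n p).substr hp2) hc
  have hshift : ∑ z : ZMod p, quadraticChar (ZMod p) ((z - (N + 1)) ^ 2 - (4 * N : ℕ)) = -1 := by
    rw [← hsum]
    exact Equiv.sum_comp (Equiv.subRight ((N : ZMod p) + 1))
      (fun w => quadraticChar (ZMod p) (w ^ 2 - (4 * N : ℕ)))
  have hterm : ∀ z : ZMod p, jacobiSym (discPoly N z.val) p =
      quadraticChar (ZMod p) ((z - (N + 1)) ^ 2 - (4 * N : ℕ)) := by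
    intro z
    rw [← jacobiSym.legendreSym.to_jacobiSym, legendreSym, discPoly_eq]
    congr 1
    simp
  have hunits : unitSum p (fun x => jacobiSym (discPoly N x) p) =
      ∑ z ∈ Finset.univ.erase (0 : ZMod p), jacobiSym (discPoly N z.val) p := by
    unfold unitSum
    refine Finset.sum_bij (fun u _ => (u : ZMod p)) ?_ ?_ ?_ ?_
    · intro u _; simp
    · intro u _ v _ h; exact Units.ext h
    · intro z hz
      exact ⟨Units.mk0 z (Finset.ne_of_mem_erase hz), by simp, rfl⟩
    · intro u _; rfl
  have h0 := jacobiSym.trichotomy (discPoly N (0 : ZMod p).val) p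
  rw [Finset.sum_congr rfl (fun z _ => (hterm z).symm),
    ← Finset.add_sum_erase _ _ (Finset.mem_univ (0 : ZMod p)), ← hunits] at hshift
  rw [abs_le]
  constructor <;> rcases h0 with h | h | h <;> rw [h] at hshift <;> linarith

theorem jacobiSym_discPoly_periodic (N q : ℕ) (x y : ℤ) (h : x ≡ y [ZMOD q]) :
    jacobiSym (discPoly N x) q = jacobiSym (discPoly N y) q :=
  jacobiSym.mod_left' (discPoly_modEq N h)

theorem unitSum_one (F : ℤ → ℤ) : unitSum 1 F = F 0 := by
  rw [unitSum, Fintype.sum_unique, Subsingleton.elim (((default : (ZMod 1)ˣ) : ZMod 1)) 0,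
    ZMod.val_zero, Nat.cast_zero]

theorem abs_unitSum_jacobiSym_le {N : ℕ} (P : ℕ) [NeZero P] (hP : Squarefree P)
    (hcop : P.Coprime (2 * N)) :
    |unitSum P (fun x => jacobiSym (discPoly N x) P)| ≤ 2 ^ P.primeFactors.card := by
  have key : ∀ P : ℕ, ∀ _ : NeZero P, Squarefree P → P.Coprime (2 * N) →
      |unitSum P (fun x => jacobiSym (discPoly N x) P)| ≤ 2 ^ P.primeFactors.card := by
    intro P
    induction P using Nat.recOnMul with
    | zero => intro h; exact absurd rfl h.out
    | one => intro _ _ _; rw [unitSum_one]; simp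
    | prime p hp =>
      intro h0 _ hc
      have : Fact p.Prime := ⟨hp⟩
      rw [hp.primeFactors, Finset.card_singleton, pow_one]
      rw [hp.coprime_iff_not_dvd] at hc
      convert abs_unitSum_jacobiSym_prime (N := N) (p := p) ?_ ?_
      · rintro rfl; exact hc (dvd_mul_right _ _)
      · exact fun h => hc (h.mul_left _)
    | mul a b iha ihb =>
      intro h0 hs hc
      have hab : a * b ≠ 0 := h0.out
      have : NeZero a := ⟨left_ne_zero_of_mul hab⟩
      have : NeZero b := ⟨right_ne_zero_of_mul hab⟩
      have hco := Nat.coprime_of_squarefree_mul hs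
      simp_rw [jacobiSym.mul_right]
      rw [show unitSum (a * b) (fun x => jacobiSym (discPoly N x) a * jacobiSym (discPoly N x) b) =
        _ from unitSum_mul hco (jacobiSym_discPoly_periodic N a) (jacobiSym_discPoly_periodic N b),
        abs_mul, hco.primeFactors_mul, Finset.card_union_of_disjoint hco.disjoint_primeFactors,
        pow_add]
      exact mul_le_mul (iha _ hs.of_mul_left (hc.coprime_dvd_left (dvd_mul_right _ _)))
        (ihb _ hs.of_mul_right (hc.coprime_dvd_left (dvd_mul_left _ _))) (abs_nonneg _)
        (by positivity)
  exact key P _ hP hcop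

theorem pow_dvd_or_pow_dvd_of_pow_dvd_mul {p : ℤ} (hp : Prime p) {a b : ℕ} {A B : ℤ}
    (h : p ^ (a + b + 1) ∣ A * B) : p ^ (a + 1) ∣ A ∨ p ^ (b + 1) ∣ B := by
  by_cases hA : p ∣ A
  · induction a generalizing A with
    | zero => left; simpa using hA
    | succ a ih =>
      obtain ⟨A', rfl⟩ := hA
      rw [show a + 1 + b + 1 = (a + b + 1) + 1 by ring, pow_succ', mul_assoc,
        mul_dvd_mul_iff_left hp.ne_zero] at h
      by_cases hA' : p ∣ A'
      · rcases ih h hA' with h1 | h1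
        · left; rw [pow_succ']; exact mul_dvd_mul_left _ h1
        · exact Or.inr h1
      · right
        exact (pow_dvd_pow p (by omega)).trans (hp.pow_dvd_of_dvd_mul_left _ hA' h)
  · right
    exact (pow_dvd_pow p (by omega)).trans (hp.pow_dvd_of_dvd_mul_left _ hA h)

theorem card_Ico_filter_dvd {q k : ℕ} (hq : 0 < q) (b : ℤ) :
    ((Finset.Ico (0 : ℤ) ((q * k : ℕ) : ℤ)).filter fun x => (q : ℤ) ∣ x - b).card = k := by
  have h := Int.Ico_filter_modEq_card 0 ((q * k : ℕ) : ℤ) (r := (q : ℤ)) (by exact_mod_cast hq) b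
  have h1 : ((Finset.Ico (0 : ℤ) ((q * k : ℕ) : ℤ)).filter fun x => (q : ℤ) ∣ x - b) =
      (Finset.Ico (0 : ℤ) ((q * k : ℕ) : ℤ)).filter fun x => x ≡ b [ZMOD q] := by
    ext x
    simp only [Finset.mem_filter, and_congr_right_iff]
    exact fun _ => ⟨fun h => (Int.modEq_iff_dvd.2 h).symm, fun h => Int.modEq_iff_dvd.1 h.symm⟩
  have hq' : (q : ℚ) ≠ 0 := by positivity
  have h2 : (((q * k : ℕ) : ℤ) - b : ℚ) / ((q : ℤ) : ℚ) =
      ((0 : ℤ) - b : ℚ) / ((q : ℤ) : ℚ) + k := by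
    push_cast
    field_simp
    ring
  rw [h1]
  rw [h2, Int.ceil_add_natCast, add_sub_cancel_left] at h
  omega

theorem card_sq_sub_dvd_le {p e : ℕ} (hp : p.Prime) (hp2 : p ≠ 2) (he : 0 < e) (b c : ℤ) :
    ((Finset.Ico (0 : ℤ) (((p ^ e) ^ 2 : ℕ) : ℤ)).filter
      fun x => (((p ^ e) ^ 2 : ℕ) : ℤ) ∣ (x - b) ^ 2 - c).card ≤ p ^ e := by
  set S := (Finset.Ico (0 : ℤ) (((p ^ e) ^ 2 : ℕ) : ℤ)).filter
      fun x => (((p ^ e) ^ 2 : ℕ) : ℤ) ∣ (x - b) ^ 2 - c with hS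
  have hp' : Prime (p : ℤ) := Nat.prime_iff_prime_int.1 hp
  have hmem : ∀ x, x ∈ S ↔ x ∈ Finset.Ico (0 : ℤ) (((p ^ e) ^ 2 : ℕ) : ℤ) ∧
      (((p ^ e) ^ 2 : ℕ) : ℤ) ∣ (x - b) ^ 2 - c := fun x => by rw [hS, Finset.mem_filter]
  rcases S.eq_empty_or_nonempty with h | ⟨x₀, hx₀⟩
  · simp [h]
  · obtain ⟨-, hd₀⟩ := (hmem _).1 hx₀
    have hdiff : ∀ x ∈ S, (((p ^ e) ^ 2 : ℕ) : ℤ) ∣ (x - b) ^ 2 - (x₀ - b) ^ 2 := fun x hx => by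
      simpa using dvd_sub ((hmem _).1 hx).2 hd₀
    by_cases h0 : ((p ^ e : ℕ) : ℤ) ∣ x₀ - b
    · calc S.card ≤ ((Finset.Ico (0 : ℤ) ((p ^ e * p ^ e : ℕ) : ℤ)).filter
            fun x => ((p ^ e : ℕ) : ℤ) ∣ x - b).card := by
            apply Finset.card_le_card
            intro x hx
            rw [Finset.mem_filter, ← sq]
            refine ⟨((hmem _).1 hx).1, ?_⟩
            have h1 : (((p ^ e) ^ 2 : ℕ) : ℤ) ∣ (x₀ - b) ^ 2 := by
              rw [Nat.cast_pow]; exact pow_dvd_pow_of_dvd h0 2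
            have h2 := (dvd_sub_left h1).1 (hdiff x hx)
            rw [Nat.cast_pow] at h2
            exact (Int.pow_dvd_pow_iff two_ne_zero).1 h2
        _ = p ^ e := card_Ico_filter_dvd (pow_pos hp.pos _) b
    · obtain ⟨k, rfl⟩ : ∃ k, e = k + 1 := ⟨e - 1, by omega⟩
      have h2w : ¬ (p : ℤ) ^ (k + 1) ∣ 2 * (x₀ - b) := by
        intro h
        apply h0
        rw [Nat.cast_pow]
        refine hp'.pow_dvd_of_dvd_mul_left _ ?_ h
        intro h3
        exact hp2 ((Nat.prime_dvd_prime_iff_eq hp Nat.prime_two).1 (by exact_mod_cast h3))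
      have hsub : S ⊆ ((Finset.Ico (0 : ℤ) ((p ^ (k + 2) * p ^ k : ℕ) : ℤ)).filter
            fun x => ((p ^ (k + 2) : ℕ) : ℤ) ∣ x - x₀) ∪
          ((Finset.Ico (0 : ℤ) ((p ^ (k + 2) * p ^ k : ℕ) : ℤ)).filter
            fun x => ((p ^ (k + 2) : ℕ) : ℤ) ∣ x - (2 * b - x₀)) := by
        intro x hx
        rw [Finset.mem_union, Finset.mem_filter, Finset.mem_filter,
          show p ^ (k + 2) * p ^ k = (p ^ (k + 1)) ^ 2 by ring]
        have h1 := hdiff x hx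
        rw [show (((p ^ (k + 1)) ^ 2 : ℕ) : ℤ) = (p : ℤ) ^ (k + (k + 1) + 1) by push_cast; ring,
          show (x - b) ^ 2 - (x₀ - b) ^ 2 = (x - x₀) * (x - (2 * b - x₀)) by ring] at h1
        have h2 := h1
        rw [mul_comm] at h2
        push_cast
        by_cases h3 : (p : ℤ) ^ (k + 1) ∣ x - x₀
        · rcases pow_dvd_or_pow_dvd_of_pow_dvd_mul hp' h2 with h4 | h4
          · exfalso
            apply h2w
            have := dvd_sub h4 h3
            rwa [show x - (2 * b - x₀) - (x - x₀) = 2 * (x₀ - b) by ring] at this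
          · exact Or.inl ⟨by exact_mod_cast ((hmem _).1 hx).1, h4⟩
        · rcases pow_dvd_or_pow_dvd_of_pow_dvd_mul hp' h1 with h4 | h4
          · exact absurd h4 h3
          · exact Or.inr ⟨by exact_mod_cast ((hmem _).1 hx).1, h4⟩
      calc S.card ≤ _ := Finset.card_le_card hsub
        _ ≤ _ := Finset.card_union_le _ _
        _ = p ^ k + p ^ k := by
          rw [card_Ico_filter_dvd (pow_pos hp.pos _), card_Ico_filter_dvd (pow_pos hp.pos _)]
        _ ≤ p ^ (k + 1) := by
          rw [pow_succ]
          nlinarith [hp.two_le, pow_pos hp.pos k]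

theorem unitSum_le_sum_Ico {q : ℕ} [NeZero q] {F : ℤ → ℤ} (hF : ∀ x, 0 ≤ F x) :
    unitSum q F ≤ ∑ x ∈ Finset.Ico (0 : ℤ) q, F x := by
  unfold unitSum
  rw [← Finset.sum_image (s := Finset.univ) (g := fun u : (ZMod q)ˣ => ((u : ZMod q).val : ℤ))
    (f := F)]
  · refine Finset.sum_le_sum_of_subset_of_nonneg ?_ fun _ _ _ => hF _
    intro x hx
    obtain ⟨u, -, rfl⟩ := Finset.mem_image.1 hx
    rw [Finset.mem_Ico]
    exact ⟨by positivity, by exact_mod_cast ZMod.val_lt _⟩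
  · intro u _ v _ h
    exact Units.ext (ZMod.val_injective q (Nat.cast_injective h))

theorem unitSum_sq_dvd_le (N : ℕ) (f : ℕ) [NeZero f] (hf : Odd f) :
    unitSum (f ^ 2) (fun x => if ((f ^ 2 : ℕ) : ℤ) ∣ discPoly N x then 1 else 0) ≤ f := by
  have key : ∀ f : ℕ, ∀ _ : NeZero f, Odd f →
      unitSum (f ^ 2) (fun x => if ((f ^ 2 : ℕ) : ℤ) ∣ discPoly N x then 1 else 0) ≤ f := by
    intro f
    induction f using Nat.recOnPosPrimePosCoprime with
    | zero => intro h; exact absurd rfl h.out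
    | one =>
      intro _ _
      refine (unitSum_le_sum_Ico fun x => by split_ifs <;> simp).trans ?_
      simp
    | prime_pow p e hp he =>
      intro h0 hodd
      refine (unitSum_le_sum_Ico fun x => by split_ifs <;> simp).trans ?_
      rw [Finset.sum_boole]
      simp_rw [discPoly_eq]
      have hp2 : p ≠ 2 := by
        rintro rfl
        rw [Nat.odd_pow_iff he.ne'] at hodd
        exact absurd hodd (by decide)
      exact_mod_cast card_sq_sub_dvd_le hp hp2 he _ _
    | coprime a b ha hb hco iha ihb =>
      intro h0 hodd
      have : NeZero a := ⟨by omega⟩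
      have : NeZero b := ⟨by omega⟩
      have hco2 : (a ^ 2).Coprime (b ^ 2) := hco.pow 2 2
      have h1 : unitSum ((a * b) ^ 2)
          (fun x => if (((a * b) ^ 2 : ℕ) : ℤ) ∣ discPoly N x then 1 else 0) =
          unitSum (a ^ 2 * b ^ 2) (fun x => (if ((a ^ 2 : ℕ) : ℤ) ∣ discPoly N x then 1 else 0) *
            (if ((b ^ 2 : ℕ) : ℤ) ∣ discPoly N x then 1 else 0)) := by
        have h2 : ∀ x, ((((a * b) ^ 2 : ℕ) : ℤ) ∣ discPoly N x) ↔
            (((a ^ 2 : ℕ) : ℤ) ∣ discPoly N x) ∧ (((b ^ 2 : ℕ) : ℤ) ∣ discPoly N x) := by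
          intro x
          rw [mul_pow, Nat.cast_mul]
          have h3 := Nat.isCoprime_iff_coprime.2 hco2
          exact ⟨fun h => ⟨dvd_of_mul_right_dvd h, dvd_of_mul_left_dvd h⟩,
            fun h => h3.mul_dvd h.1 h.2⟩
        simp_rw [h2, ite_and, ite_mul, one_mul, zero_mul]
        congr 1
        exact mul_pow a b 2
      have hper : ∀ q : ℕ, ∀ x y : ℤ, x ≡ y [ZMOD q] →
          (if (q : ℤ) ∣ discPoly N x then (1 : ℤ) else 0) =
            if (q : ℤ) ∣ discPoly N y then 1 else 0 := fun q x y h => by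
        simp only [(discPoly_modEq N h).dvd_iff]
      rw [h1, unitSum_mul hco2 (hper _) (hper _), Nat.cast_mul]
      exact mul_le_mul (iha inferInstance (Nat.odd_mul.1 hodd).1)
        (ihb inferInstance (Nat.odd_mul.1 hodd).2)
        (unitSum_nonneg fun x => by split_ifs <;> simp) (by positivity)
  exact key f inferInstance hf

/-- The value of the symbol `(D/f² | n)` at an integer `x` with `f² ∣ D = D_N(x)`, and zero at the
other integers. -/
def quotSymbol (N n f : ℕ) (x : ℤ) : ℤ :=
  if ((f ^ 2 : ℕ) : ℤ) ∣ discPoly N x then jacobiSym (discPoly N x / ((f ^ 2 : ℕ) : ℤ)) n else 0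

theorem quotSymbol_periodic {N n f q : ℕ} (hf : 0 < f) (h : n * f ^ 2 ∣ q) (x y : ℤ)
    (hxy : x ≡ y [ZMOD q]) : quotSymbol N n f x = quotSymbol N n f y := by
  have h1 : discPoly N x ≡ discPoly N y [ZMOD ((n * f ^ 2 : ℕ) : ℤ)] :=
    (discPoly_modEq N hxy).of_dvd (by exact_mod_cast h)
  have hf2 : ((f ^ 2 : ℕ) : ℤ) ≠ 0 := by positivity
  have h2 : ((f ^ 2 : ℕ) : ℤ) ∣ discPoly N x ↔ ((f ^ 2 : ℕ) : ℤ) ∣ discPoly N y :=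
    (h1.of_dvd (by push_cast; exact dvd_mul_left _ _)).dvd_iff
  unfold quotSymbol
  by_cases h3 : ((f ^ 2 : ℕ) : ℤ) ∣ discPoly N x
  · rw [if_pos h3, if_pos (h2.1 h3)]
    obtain ⟨u, hu⟩ := h3
    obtain ⟨v, hv⟩ := h2.1 ⟨u, hu⟩
    apply jacobiSym.mod_left'
    rw [hu, hv, Int.mul_ediv_cancel_left _ hf2, Int.mul_ediv_cancel_left _ hf2]
    rw [hu, hv, Nat.cast_mul, mul_comm (n : ℤ)] at h1
    exact Int.ModEq.mul_left_cancel' hf2 h1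
  · rw [if_neg h3, if_neg (fun h => h3 (h2.2 h))]

theorem abs_jacobiSym_le_one (a : ℤ) (b : ℕ) : |jacobiSym a b| ≤ 1 := by
  rcases jacobiSym.trichotomy a b with h | h | h <;> simp [h]

theorem abs_quotSymbol_le (N n f : ℕ) (x : ℤ) :
    |quotSymbol N n f x| ≤ if ((f ^ 2 : ℕ) : ℤ) ∣ discPoly N x then 1 else 0 := by
  unfold quotSymbol
  split_ifs
  · exact abs_jacobiSym_le_one _ _
  · simp

theorem jacobiSym_mul_sq_mul {P r n k : ℕ} (hP : P ≠ 0) (hr : r ≠ 0) (hn : n ≠ 0)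
    (hrP : r ∣ P ^ k) (y : ℤ) :
    jacobiSym y (P * r ^ 2 * n) = jacobiSym y P * jacobiSym y n := by
  rw [jacobiSym.mul_right' y (mul_ne_zero hP (pow_ne_zero _ hr)) hn,
    jacobiSym.mul_right' y hP (pow_ne_zero _ hr), jacobiSym.pow_right]
  congr 1
  by_cases h : y.gcd P = 1
  · have : y.gcd r = 1 := by
      rw [← Int.isCoprime_iff_gcd_eq_one] at h ⊢
      exact (h.pow_right (n := k)).of_isCoprime_of_dvd_right (by exact_mod_cast hrP)
    rw [jacobiSym.sq_one this, mul_one]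
  · rw [jacobiSym.eq_zero_iff.2 ⟨hP, h⟩, zero_mul]

theorem quotSymbol_mul_sq_mul {N P r n k f : ℕ} (hP : P ≠ 0) (hr : r ≠ 0) (hn : n ≠ 0)
    (hrP : r ∣ P ^ k) (hf : f ≠ 0) (hfP : f.Coprime P) (x : ℤ) :
    quotSymbol N (P * r ^ 2 * n) f x = jacobiSym (discPoly N x) P * quotSymbol N n f x := by
  unfold quotSymbol
  split_ifs with h
  · obtain ⟨u, hu⟩ := h
    rw [hu, Int.mul_ediv_cancel_left _ (by positivity), jacobiSym_mul_sq_mul hP hr hn hrP,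
      jacobiSym.mul_left, Nat.cast_pow, jacobiSym.pow_left, jacobiSym.sq_one, one_mul]
    simpa using hfP
  · simp

theorem unitSum_congr_modulus {q q' : ℕ} [NeZero q] [NeZero q'] (h : q = q') (F : ℤ → ℤ) :
    unitSum q F = unitSum q' F := by
  subst h
  rfl

theorem unitSum_quotSymbol_le (N n f : ℕ) {q : ℕ} [NeZero q] [NeZero f] (hf : Odd f)
    (h : f ^ 2 ∣ q) :
    ((f ^ 2).totient : ℤ) * |unitSum q (quotSymbol N n f)| ≤ q.totient * f := by
  have h1 := unitSum_of_dvd h (F := fun x => if ((f ^ 2 : ℕ) : ℤ) ∣ discPoly N x then 1 else 0)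
    (fun x y hxy => by simp only [(discPoly_modEq N hxy).dvd_iff])
  calc ((f ^ 2).totient : ℤ) * |unitSum q (quotSymbol N n f)|
      ≤ (f ^ 2).totient *
        unitSum q (fun x => if ((f ^ 2 : ℕ) : ℤ) ∣ discPoly N x then 1 else 0) := by
        gcongr
        exact abs_unitSum_le (abs_quotSymbol_le N n f)
    _ ≤ q.totient * f := by
        rw [h1]
        gcongr
        exact unitSum_sq_dvd_le N f hf

theorem abs_unitSum_quotSymbol_mul_le {N P r n k f : ℕ} (hP : Squarefree P) (hr : r ≠ 0)
    (hn : n ≠ 0) (hrP : r ∣ P ^ k) (hf : Odd f) (hPN : P.Coprime (2 * N)) (hPf : P.Coprime f)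
    (hPn : P.Coprime n) [NeZero (4 * (P * r ^ 2 * n) * f ^ 2)] :
    (P.totient : ℤ) * (f ^ 2).totient *
        |unitSum (4 * (P * r ^ 2 * n) * f ^ 2) (quotSymbol N (P * r ^ 2 * n) f)| ≤
      (4 * (P * r ^ 2 * n) * f ^ 2).totient * 2 ^ P.primeFactors.card * f := by
  have hf0 : f ≠ 0 := by rintro rfl; simp at hf
  have hP0 : P ≠ 0 := hP.ne_zero
  have : NeZero f := ⟨hf0⟩
  have : NeZero P := ⟨hP0⟩
  have : NeZero (P * r ^ 2) := ⟨by positivity⟩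
  have : NeZero (4 * n * f ^ 2) := ⟨by positivity⟩
  have hP4 : P.Coprime (4 * n * f ^ 2) := by
    refine Nat.Coprime.mul_right (Nat.Coprime.mul_right ?_ hPn) (hPf.pow_right 2)
    exact (hPN.coprime_dvd_right (dvd_mul_right _ _)).pow_right 2
  have hco : (P * r ^ 2).Coprime (4 * n * f ^ 2) := by
    refine Nat.Coprime.mul_left hP4 (Nat.Coprime.pow_left 2 ?_)
    exact (hP4.pow_left k).coprime_dvd_left hrP
  have hmod : 4 * (P * r ^ 2 * n) * f ^ 2 = P * r ^ 2 * (4 * n * f ^ 2) := by ring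
  have hsplit : unitSum (4 * (P * r ^ 2 * n) * f ^ 2) (quotSymbol N (P * r ^ 2 * n) f) =
      unitSum (P * r ^ 2) (fun x => jacobiSym (discPoly N x) P) *
        unitSum (4 * n * f ^ 2) (quotSymbol N n f) := by
    rw [unitSum_congr_modulus hmod,
      funext (quotSymbol_mul_sq_mul hP0 hr hn hrP hf0 hPf.symm)]
    refine unitSum_mul hco (fun x y h => jacobiSym_discPoly_periodic N P x y ?_)
      (quotSymbol_periodic (Nat.pos_of_ne_zero hf0) ⟨4, by ring⟩)
    exact h.of_dvd (by push_cast; exact dvd_mul_right _ _)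
  have h1 := unitSum_of_dvd (dvd_mul_right P (r ^ 2)) (jacobiSym_discPoly_periodic N P)
  have h1' : (P.totient : ℤ) * |unitSum (P * r ^ 2) (fun x => jacobiSym (discPoly N x) P)| ≤
      (P * r ^ 2).totient * 2 ^ P.primeFactors.card := by
    rw [← Nat.abs_cast P.totient, ← abs_mul, h1, abs_mul, Nat.abs_cast]
    gcongr
    exact abs_unitSum_jacobiSym_le P hP hPN
  have h2 := unitSum_quotSymbol_le N n f (q := 4 * n * f ^ 2) hf (dvd_mul_left _ _)
  rw [hsplit, abs_mul, hmod, Nat.totient_mul hco, Nat.cast_mul]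
  calc _ = ((P.totient : ℤ) * |unitSum (P * r ^ 2) (fun x => jacobiSym (discPoly N x) P)|) *
        ((f ^ 2).totient * |unitSum (4 * n * f ^ 2) (quotSymbol N n f)|) := by ring
    _ ≤ ((P * r ^ 2).totient * 2 ^ P.primeFactors.card) * ((4 * n * f ^ 2).totient * f) :=
        mul_le_mul h1' h2 (by positivity) (by positivity)
    _ = _ := by ring

theorem exists_mul_coprime_of_pos (P : ℕ) {m : ℕ} (hm : 0 < m) :
    ∃ r t k : ℕ, m = r * t ∧ P.Coprime t ∧ r ∣ P ^ k := by
  induction m using Nat.strong_induction_on with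
  | _ m ih =>
    by_cases h : P.Coprime m
    · exact ⟨1, m, 0, by simp, h, by simp⟩
    · have hg : 1 < P.gcd m := lt_of_le_of_ne (Nat.gcd_pos_of_pos_right _ hm) (Ne.symm h)
      obtain ⟨m', hm'⟩ := P.gcd_dvd_right m
      have hm0 : 0 < m' := Nat.pos_of_ne_zero (by rintro rfl; simp at hm'; omega)
      obtain ⟨r, t, k, h1, h2, h3⟩ := ih m' (by rw [hm']; exact lt_mul_of_one_lt_left hm0 hg) hm0
      refine ⟨P.gcd m * r, t, k + 1, ?_, h2, ?_⟩
      · conv_lhs => rw [hm', h1]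
        ring
      · rw [pow_succ']
        exact mul_dvd_mul (P.gcd_dvd_left m) h3

/-- The local weight at `p` of the squarefree part of `n`: there is a saving `2/(p-1)` at the primes
that do not divide `M`. -/
def savingWeight (M p : ℕ) : ℝ := if p ∣ M then 1 else 2 / ((p : ℝ) - 1)

theorem abs_unitSum_quotSymbol_le {N n s m f : ℕ} (hs : Squarefree s) (hm : 0 < m)
    (hn : n = s * m ^ 2) (hf : Odd f) [NeZero (4 * n * f ^ 2)] :
    |(unitSum (4 * n * f ^ 2) (quotSymbol N n f) : ℝ)| ≤
      (4 * n * f ^ 2).totient / f.totient * ∏ p ∈ s.primeFactors, savingWeight (2 * N * f) p := by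
  have hf0 : f ≠ 0 := by rintro rfl; simp at hf
  obtain ⟨T, hT⟩ : ∃ T, T = s.primeFactors.filter fun p => ¬ p ∣ 2 * N * f := ⟨_, rfl⟩
  have hTs : T ⊆ s.primeFactors := hT ▸ Finset.filter_subset _ _
  have hTp : ∀ p ∈ T, p.Prime := fun p hp => Nat.prime_of_mem_primeFactors (hTs hp)
  obtain ⟨P, hPdef⟩ : ∃ P, P = ∏ p ∈ T, p := ⟨_, rfl⟩
  have hPT : P.primeFactors = T := hPdef ▸ Nat.primeFactors_prod hTp
  have hPs : P ∣ s := by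
    rw [hPdef, ← Nat.prod_primeFactors_of_squarefree hs]
    exact Finset.prod_dvd_prod_of_subset _ _ _ hTs
  have hP : Squarefree P := hs.squarefree_of_dvd hPs
  have hPM : P.Coprime (2 * N * f) := by
    rw [hPdef]
    refine Nat.Coprime.prod_left fun p hp => ?_
    have hp' := hp
    rw [hT, Finset.mem_filter] at hp'
    exact ((hTp p hp).coprime_iff_not_dvd).2 hp'.2
  obtain ⟨s', rfl⟩ := hPs
  obtain ⟨r, t, k, rfl, ht, hr⟩ := exists_mul_coprime_of_pos P hm
  have hn' : n = P * r ^ 2 * (s' * t ^ 2) := by rw [hn]; ring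
  subst hn'
  have hr0 : r ≠ 0 := by rintro rfl; simp at hm
  have ht0 : t ≠ 0 := by rintro rfl; simp at hm
  have hs0 : s' ≠ 0 := by rintro rfl; simp at hs
  have hmain := abs_unitSum_quotSymbol_mul_le (N := N) (k := k) hP hr0
    (mul_ne_zero hs0 (pow_ne_zero 2 ht0)) hr hf
    (hPM.coprime_dvd_right (dvd_mul_right _ _)) (hPM.coprime_dvd_right (dvd_mul_left _ _))
    ((Nat.coprime_of_squarefree_mul hs).mul_right (ht.pow_right 2))
  have hprod : ∏ p ∈ (P * s').primeFactors, savingWeight (2 * N * f) p =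
      2 ^ P.primeFactors.card / P.totient := by
    have h1 : (P.totient : ℝ) = ∏ p ∈ T, ((p : ℝ) - 1) := by
      rw [Nat.totient_eq_prod_factorization hP.ne_zero, Nat.prod_factorization_eq_prod_primeFactors,
        hPT, Nat.cast_prod]
      refine Finset.prod_congr rfl fun p hp => ?_
      have h2 := hP.natFactorization_le_one p
      rw [Nat.sub_eq_zero_of_le h2, pow_zero, one_mul, Nat.cast_pred (hTp p hp).pos]
    rw [h1, hPT, ← Finset.prod_const, ← Finset.prod_div_distrib, hT, Finset.prod_filter]
    refine Finset.prod_congr rfl fun p _ => ?_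
    by_cases h : p ∣ 2 * N * f <;> simp only [savingWeight, h, if_true, if_false, not_true_eq_false,
      not_false_eq_true]
  rw [hprod]
  have hφP : (0 : ℝ) < P.totient := by
    exact_mod_cast Nat.totient_pos.2 (Nat.pos_of_ne_zero hP.ne_zero)
  have hφf : (0 : ℝ) < f.totient := by exact_mod_cast Nat.totient_pos.2 (Nat.pos_of_ne_zero hf0)
  have hff : (0 : ℝ) < f := by positivity
  have hsq : ((f ^ 2).totient : ℝ) = f * f.totient := by
    have h1 := Nat.totient_gcd_mul_totient_mul f f
    rw [Nat.gcd_self, ← sq, mul_assoc] at h1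
    rw [Nat.eq_of_mul_eq_mul_left (Nat.totient_pos.2 (Nat.pos_of_ne_zero hf0)) h1]
    push_cast
    ring
  have hmain' := (Int.cast_le (R := ℝ)).2 hmain
  push_cast at hmain'
  rw [hsq] at hmain'
  rw [div_mul_div_comm, le_div_iff₀ (by positivity)]
  nlinarith

theorem CNcard_eq_sum (N a n f : ℕ) [NeZero (4 * n * f ^ 2)] :
    (CNcard N a n f : ℤ) = ∑ u : (ZMod (4 * n * f ^ 2))ˣ,
      if ((4 * n * f ^ 2 : ℕ) : ℤ) ∣
        discPoly N (u : ZMod (4 * n * f ^ 2)).val - a * ((f ^ 2 : ℕ) : ℤ) then 1 else 0 := by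
  rw [CNcard, Nat.card_eq_fintype_card, Fintype.card_subtype, Finset.sum_boole]
  congr 2
  refine Finset.filter_congr fun u _ => ?_
  rw [← ZMod.intCast_zmod_eq_zero_iff_dvd, Int.cast_sub, sub_eq_zero, discPoly]
  simp

theorem sum_jacobiSym_mul_CNcard {N n f : ℕ} (hN : Odd N) (hf : Odd f) (hn : 0 < n)
    [NeZero (4 * n * f ^ 2)] :
    ∑ a ∈ (Finset.range (4 * n)).filter (fun a => a % 4 = 1),
        jacobiSym (a : ℤ) n * (CNcard N a n f : ℤ) =
      unitSum (4 * n * f ^ 2) (quotSymbol N n f) := by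
  have hf0 : f ≠ 0 := by rintro rfl; simp at hf
  have hf2 : ((f ^ 2 : ℕ) : ℤ) ≠ 0 := by positivity
  simp_rw [CNcard_eq_sum, Finset.mul_sum]
  rw [Finset.sum_comm]
  refine Finset.sum_congr rfl fun u _ => ?_
  have hx : Odd (((u : ZMod (4 * n * f ^ 2)).val : ℕ) : ℤ) := by
    rw [Int.odd_coe_nat, ← Nat.coprime_two_left]
    exact (ZMod.val_coe_unit_coprime u).symm.coprime_dvd_left ⟨2 * n * f ^ 2, by ring⟩
  generalize (((u : ZMod (4 * n * f ^ 2)).val : ℕ) : ℤ) = x at hx ⊢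
  have hmod : ((4 * n * f ^ 2 : ℕ) : ℤ) = ((f ^ 2 : ℕ) : ℤ) * ((4 * n : ℕ) : ℤ) := by
    push_cast; ring
  rw [quotSymbol]
  split_ifs with h
  · obtain ⟨y, hy⟩ := h
    rw [hy, Int.mul_ediv_cancel_left _ hf2]
    have hy4 : y % 4 = 1 := by
      obtain ⟨b, hb⟩ := hx
      obtain ⟨c, hc⟩ := hN
      obtain ⟨d, hd⟩ := hf
      rw [discPoly, hb, hc, hd] at hy
      push_cast at hy
      have h1 : y = 1 + 4 * (b ^ 2 + b - (c + 1) * (2 * b + 1) + c ^ 2 - (d ^ 2 + d) * y) := by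
        linear_combination -hy
      omega
    have hcond : ∀ a : ℕ, ((4 * n * f ^ 2 : ℕ) : ℤ) ∣
        ((f ^ 2 : ℕ) : ℤ) * y - a * ((f ^ 2 : ℕ) : ℤ) ↔ ((4 * n : ℕ) : ℤ) ∣ y - a := by
      intro a
      rw [hmod, mul_comm (a : ℤ), ← mul_sub, mul_dvd_mul_iff_left hf2]
    simp_rw [hcond]
    have hpos : (0 : ℤ) < ((4 * n : ℕ) : ℤ) := by positivity
    have h0 : ((y % ((4 * n : ℕ) : ℤ)).toNat : ℤ) = y % ((4 * n : ℕ) : ℤ) :=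
      Int.toNat_of_nonneg (Int.emod_nonneg _ hpos.ne')
    have hlt : y % ((4 * n : ℕ) : ℤ) < ((4 * n : ℕ) : ℤ) := Int.emod_lt_of_pos _ hpos
    rw [Finset.sum_eq_single (y % ((4 * n : ℕ) : ℤ)).toNat]
    · rw [if_pos, mul_one, h0]
      · apply jacobiSym.mod_left'
        exact Int.emod_emod_of_dvd _ (by push_cast; exact dvd_mul_left _ _)
      · rw [h0]
        exact Int.dvd_self_sub_emod
    · intro a ha hne
      rw [Finset.mem_filter, Finset.mem_range] at ha
      rw [if_neg, mul_zero]
      intro hd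
      apply hne
      have h1 : (a : ℤ) % ((4 * n : ℕ) : ℤ) = y % ((4 * n : ℕ) : ℤ) := Int.modEq_iff_dvd.2 hd
      rw [Int.emod_eq_of_lt (by positivity) (by exact_mod_cast ha.1)] at h1
      rw [← h1, Int.toNat_natCast]
    · intro hnot
      exfalso
      apply hnot
      rw [Finset.mem_filter, Finset.mem_range]
      refine ⟨by omega, ?_⟩
      have h1 : y % ((4 * n : ℕ) : ℤ) % 4 = y % 4 :=
        Int.emod_emod_of_dvd _ (by push_cast; exact dvd_mul_right _ _)
      omega
  · refine Finset.sum_eq_zero fun a _ => ?_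
    rw [if_neg, mul_zero]
    intro hd
    apply h
    have h1 : ((f ^ 2 : ℕ) : ℤ) ∣ discPoly N x - a * ((f ^ 2 : ℕ) : ℤ) :=
      (hmod ▸ dvd_mul_right _ _ : ((f ^ 2 : ℕ) : ℤ) ∣ ((4 * n * f ^ 2 : ℕ) : ℤ)).trans hd
    exact (dvd_sub_left (dvd_mul_left _ _)).1 h1

/-- The term of the double series `K0 N` at `(f, n)`. -/
def K0term (N f n : ℕ) : ℝ :=
  if Odd f ∧ 0 < n then
    (1 / (f : ℝ)) * (1 / ((n : ℝ) * (Nat.totient (4 * n * f ^ 2) : ℝ))) *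
      ∑ a ∈ (Finset.range (4 * n)).filter (fun a => a % 4 = 1),
        (jacobiSym (a : ℤ) n : ℝ) * (CNcard N a n f : ℝ)
  else 0

theorem abs_K0term_le {N f n s m : ℕ} (hN : Odd N) (hf : Odd f) (hs : Squarefree s) (hm : 0 < m)
    (hn : n = s * m ^ 2) :
    |K0term N f n| ≤ 1 / ((f : ℝ) * f.totient) *
      (1 / ((s : ℝ) * (m : ℝ) ^ 2) * ∏ p ∈ s.primeFactors, savingWeight (2 * N * f) p) := by
  have hf0 : 0 < f := hf.pos
  have hn0 : 0 < n := by
    rw [hn]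
    exact mul_pos (Nat.pos_of_ne_zero hs.ne_zero) (pow_pos hm 2)
  have : NeZero (4 * n * f ^ 2) := ⟨by positivity⟩
  have hφ : (0 : ℝ) < (4 * n * f ^ 2).totient := by
    exact_mod_cast Nat.totient_pos.2 (by positivity)
  have h1 := abs_unitSum_quotSymbol_le (N := N) hs hm hn hf
  rw [← sum_jacobiSym_mul_CNcard hN hf hn0] at h1
  push_cast at h1
  rw [K0term, if_pos ⟨hf, hn0⟩, abs_mul, abs_of_nonneg (by positivity)]
  calc _ ≤ (1 / (f : ℝ)) * (1 / ((n : ℝ) * (Nat.totient (4 * n * f ^ 2) : ℝ))) *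
      ((4 * n * f ^ 2).totient / f.totient * ∏ p ∈ s.primeFactors, savingWeight (2 * N * f) p) := by
        gcongr
    _ = _ := by
        have : (n : ℝ) = s * (m : ℝ) ^ 2 := by rw [hn]; push_cast; ring
        rw [← this]
        field_simp

theorem sum_Ico_inv_sq_le {a b : ℕ} (ha : 1 ≤ a) (hab : a ≤ b) :
    ∑ m ∈ Finset.Ico a b, 1 / (m : ℝ) ^ 2 ≤ 1 / ((a : ℝ) - 1 / 2) - 1 / ((b : ℝ) - 1 / 2) := by
  induction b, hab using Nat.le_induction with
  | base => simp
  | succ b hb ih =>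
    rw [Finset.sum_Ico_succ_top hb]
    have hb1 : (1 : ℝ) ≤ b := by exact_mod_cast ha.trans hb
    have h1 : 1 / (b : ℝ) ^ 2 ≤ 1 / ((b : ℝ) - 1 / 2) - 1 / (((b + 1 : ℕ) : ℝ) - 1 / 2) := by
      have h2 : 1 / ((b : ℝ) - 1 / 2) - 1 / (((b + 1 : ℕ) : ℝ) - 1 / 2) =
          1 / ((b : ℝ) ^ 2 - 1 / 4) := by
        have h3 : (b : ℝ) - 1 / 2 ≠ 0 := by linarith
        have h4 : (((b + 1 : ℕ) : ℝ) - 1 / 2) ≠ 0 := by push_cast; linarith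
        have h5 : (b : ℝ) ^ 2 - 1 / 4 ≠ 0 := by nlinarith
        rw [div_sub_div _ _ h3 h4, div_eq_div_iff (mul_ne_zero h3 h4) h5]
        push_cast
        ring
      rw [h2]
      apply one_div_le_one_div_of_le <;> nlinarith
    linarith

theorem sum_inv_sq_le {x : ℝ} (hx : 0 < x) (F : Finset ℕ) (hF : ∀ m ∈ F, x < m) :
    ∑ m ∈ F, 1 / (m : ℝ) ^ 2 ≤ 2 / x := by
  obtain ⟨b, hb⟩ := F.exists_nat_subset_range
  set a := ⌊x⌋₊ + 1 with ha
  have hxa : x < a := by rw [ha]; push_cast; exact Nat.lt_floor_add_one x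
  have ha1 : (1 : ℝ) ≤ a := by rw [ha]; push_cast; linarith [Nat.cast_nonneg (α := ℝ) ⌊x⌋₊]
  have hsub : F ⊆ Finset.Ico a (max a b) := by
    intro m hm
    rw [Finset.mem_Ico]
    refine ⟨?_, lt_of_lt_of_le (Finset.mem_range.1 (hb hm)) (le_max_right _ _)⟩
    exact Nat.succ_le_of_lt ((Nat.floor_lt hx.le).2 (hF m hm))
  have hmax : (1 : ℝ) ≤ (max a b : ℕ) := by
    rw [Nat.cast_max]; exact ha1.trans (le_max_left _ _)
  calc ∑ m ∈ F, 1 / (m : ℝ) ^ 2 ≤ ∑ m ∈ Finset.Ico a (max a b), 1 / (m : ℝ) ^ 2 :=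
        Finset.sum_le_sum_of_subset_of_nonneg hsub fun _ _ _ => by positivity
    _ ≤ _ := sum_Ico_inv_sq_le (by omega) (le_max_left _ _)
    _ ≤ 1 / ((a : ℝ) - 1 / 2) := by
        have : 0 ≤ 1 / (((max a b : ℕ) : ℝ) - 1 / 2) := one_div_nonneg.2 (by linarith)
        linarith
    _ ≤ 2 / x := by
        rw [div_le_div_iff₀ (by linarith) hx]
        linarith

theorem prod_primeFactors_mul_le {a b : ℕ} (ha : a ≠ 0) (hb : b ≠ 0) {g : ℕ → ℝ}
    (hg : ∀ p, 1 ≤ g p) :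
    ∏ p ∈ (a * b).primeFactors, g p ≤ (∏ p ∈ a.primeFactors, g p) * ∏ p ∈ b.primeFactors, g p := by
  rw [Nat.primeFactors_mul ha hb, ← Finset.prod_union_inter]
  exact le_mul_of_one_le_right (Finset.prod_nonneg fun p _ => zero_le_one.trans (hg p))
    (Finset.one_le_prod fun p _ => hg p)

theorem sum_squarefree_le_prod (S : Finset ℕ) (hS : ∀ s ∈ S, Squarefree s) {a : ℕ → ℝ}
    (ha : ∀ p, p.Prime → 0 ≤ a p) :
    ∑ s ∈ S, ∏ p ∈ s.primeFactors, a p ≤ ∏ p ∈ S.biUnion Nat.primeFactors, (1 + a p) := by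
  rw [Finset.prod_one_add, ← Finset.sum_image (g := Nat.primeFactors)
    (f := fun T : Finset ℕ => ∏ p ∈ T, a p)]
  · refine Finset.sum_le_sum_of_subset_of_nonneg (fun T hT => ?_) fun T hT _ =>
      Finset.prod_nonneg fun p hp => ?_
    · obtain ⟨s, hs, rfl⟩ := Finset.mem_image.1 hT
      exact Finset.mem_powerset.2 (Finset.subset_biUnion_of_mem Nat.primeFactors hs)
    · obtain ⟨s, _, hps⟩ := Finset.mem_biUnion.1 (Finset.mem_powerset.1 hT hp)
      exact ha p (Nat.prime_of_mem_primeFactors hps)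
  · intro s hs t ht h
    rw [← Nat.prod_primeFactors_of_squarefree (hS s hs),
      ← Nat.prod_primeFactors_of_squarefree (hS t ht)]
    exact congrArg (fun T : Finset ℕ => ∏ p ∈ T, p) h

theorem sum_inv_sq_mul_prod_le {V : ℝ} (hV : 0 < V) (F : Finset ℕ) (hF : ∀ f ∈ F, V < f)
    {a : ℕ → ℝ} (ha : ∀ p, 0 ≤ a p) :
    ∑ f ∈ F, 1 / (f : ℝ) ^ 2 * ∏ p ∈ f.primeFactors, (1 + a p) ≤
      2 / V * ∏ p ∈ F.biUnion Nat.primeFactors, (1 + a p / p) := by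
  set W := F.biUnion Nat.primeFactors
  have hWp : ∀ p ∈ W, p.Prime := fun p hp => by
    obtain ⟨f, _, hpf⟩ := Finset.mem_biUnion.1 hp
    exact Nat.prime_of_mem_primeFactors hpf
  have hpos : ∀ f ∈ F, 0 < f := fun f hf => by exact_mod_cast hV.trans (hF f hf)
  have h1 : ∀ f ∈ F, 1 / (f : ℝ) ^ 2 * ∏ p ∈ f.primeFactors, (1 + a p) =
      ∑ T ∈ W.powerset, if T ⊆ f.primeFactors then 1 / (f : ℝ) ^ 2 * ∏ p ∈ T, a p else 0 := by
    intro f hf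
    rw [Finset.prod_one_add, Finset.mul_sum, ← Finset.sum_filter]
    refine Finset.sum_congr ?_ fun _ _ => rfl
    ext T
    rw [Finset.mem_powerset, Finset.mem_filter, Finset.mem_powerset]
    exact ⟨fun h => ⟨h.trans (Finset.subset_biUnion_of_mem Nat.primeFactors hf), h⟩, fun h => h.2⟩
  rw [Finset.sum_congr rfl h1, Finset.sum_comm, Finset.prod_one_add, Finset.mul_sum]
  refine Finset.sum_le_sum fun T hT => ?_
  have hTW := Finset.mem_powerset.1 hT
  have hTp : ∀ p ∈ T, p.Prime := fun p hp => hWp p (hTW hp)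
  have hd : (0 : ℝ) < ((∏ p ∈ T, p : ℕ) : ℝ) := by
    exact_mod_cast Finset.prod_pos fun p hp => (hTp p hp).pos
  have hdvd : ∀ f ∈ F, T ⊆ f.primeFactors → (∏ p ∈ T, p) * (f / ∏ p ∈ T, p) = f := by
    intro f hf hTf
    exact Nat.mul_div_cancel'
      ((Finset.prod_dvd_prod_of_subset _ _ _ hTf).trans (Nat.prod_primeFactors_dvd f))
  rw [← Finset.sum_filter, ← Finset.sum_mul, Finset.prod_div_distrib, ← Nat.cast_prod]
  generalize (∏ p ∈ T, p) = d at hd hdvd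
  have h2 : ∑ f ∈ F.filter (fun f => T ⊆ f.primeFactors), 1 / (f : ℝ) ^ 2 ≤ 2 / (V * d) := by
    have h3 : ∀ f ∈ F.filter (fun f => T ⊆ f.primeFactors),
        1 / (f : ℝ) ^ 2 = 1 / (d : ℝ) ^ 2 * (1 / ((f / d : ℕ) : ℝ) ^ 2) := by
      intro f hf
      rw [Finset.mem_filter] at hf
      conv_lhs => rw [← hdvd f hf.1 hf.2]
      push_cast
      rw [mul_pow, one_div_mul_one_div]
    rw [Finset.sum_congr rfl h3, ← Finset.mul_sum, ← Finset.sum_image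
      (g := fun f => f / d) (f := fun m : ℕ => 1 / (m : ℝ) ^ 2)]
    · calc _ ≤ 1 / (d : ℝ) ^ 2 * (2 / (V / d)) := by
            gcongr
            refine sum_inv_sq_le (by positivity) _ fun m hm => ?_
            obtain ⟨f, hf, rfl⟩ := Finset.mem_image.1 hm
            rw [Finset.mem_filter] at hf
            have := hF f hf.1
            rw [← hdvd f hf.1 hf.2] at this
            push_cast at this
            rw [div_lt_iff₀ hd, mul_comm]
            exact this
        _ = _ := by field_simp
    · intro f hf g hg h
      rw [Finset.mem_coe, Finset.mem_filter] at hf hg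
      rw [← hdvd f hf.1 hf.2, ← hdvd g hg.1 hg.2]
      exact congrArg (d * ·) h
  calc _ ≤ 2 / (V * d) * ∏ p ∈ T, a p := by
        gcongr
        exact Finset.prod_nonneg fun p _ => ha p
    _ = _ := by field_simp

theorem exists_sum_inv_mul_sqrt_le :
    ∃ B : ℝ, 0 ≤ B ∧ ∀ F : Finset ℕ, ∑ p ∈ F, 1 / ((p : ℝ) * √p) ≤ B := by
  have hs : Summable fun n : ℕ => 1 / ((n : ℝ) * √n) := by
    refine (Real.summable_one_div_nat_rpow (p := 3 / 2)).2 (by norm_num) |>.congr fun n => ?_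
    rcases n.eq_zero_or_pos with rfl | hn
    · simp
    · rw [Real.sqrt_eq_rpow]
      nth_rewrite 2 [← Real.rpow_one (n : ℝ)]
      rw [← Real.rpow_add (by positivity)]
      norm_num
  exact ⟨_, tsum_nonneg fun n => by positivity, fun F => hs.sum_le_tsum F fun n _ => by positivity⟩

theorem prod_one_add_le_exp (F : Finset ℕ) {a : ℕ → ℝ} (ha : ∀ p, 0 ≤ a p) :
    ∏ p ∈ F, (1 + a p) ≤ Real.exp (∑ p ∈ F, a p) := by
  rw [Real.exp_sum]
  refine Finset.prod_le_prod (fun p _ => by linarith [ha p]) fun p _ => ?_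
  linarith [Real.add_one_le_exp (a p)]

theorem exists_prod_savingWeight_le : ∃ C : ℝ, 0 < C ∧ ∀ (y : ℕ → ℝ), (∀ p, 0 ≤ y p) →
    (∀ p, y p ≤ 1 / √p) → ∀ (W : Finset ℕ), (∀ p ∈ W, p.Prime) → ∀ M : ℕ, M ≠ 0 →
    ∏ p ∈ W, (1 + y p * savingWeight M p) ≤ C * ∏ p ∈ M.primeFactors, (1 + y p) := by
  obtain ⟨B, hB0, hB⟩ := exists_sum_inv_mul_sqrt_le
  refine ⟨Real.exp (4 * B), Real.exp_pos _, fun y hy0 hy W hW M hM => ?_⟩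
  have h1 : ∀ p ∈ W, 1 + y p * savingWeight M p ≤
      Real.exp (4 * (1 / ((p : ℝ) * √p))) * (if p ∣ M then 1 + y p else 1) := by
    intro p hp
    have hp2 : (2 : ℝ) ≤ p := by exact_mod_cast (hW p hp).two_le
    have hs : 0 < √(p : ℝ) := Real.sqrt_pos.2 (by linarith)
    unfold savingWeight
    split_ifs
    · rw [mul_one]
      exact le_mul_of_one_le_left (by linarith [hy0 p]) (Real.one_le_exp (by positivity))
    · rw [mul_one]
      have h2 : y p * (2 / ((p : ℝ) - 1)) ≤ 4 * (1 / ((p : ℝ) * √p)) := by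
        calc y p * (2 / ((p : ℝ) - 1)) ≤ (1 / √p) * (4 / p) := by
              refine mul_le_mul (hy p) ?_ (div_nonneg (by norm_num) (by linarith)) (by positivity)
              rw [div_le_div_iff₀ (by linarith) (by linarith)]
              linarith
          _ = _ := by field_simp
      linarith [Real.add_one_le_exp (4 * (1 / ((p : ℝ) * √p)))]
  have hw0 : ∀ p ∈ W, 0 ≤ savingWeight M p := by
    intro p hp
    have hp2 : (2 : ℝ) ≤ p := by exact_mod_cast (hW p hp).two_le
    unfold savingWeight
    split_ifs
    · exact zero_le_one
    · exact div_nonneg (by norm_num) (by linarith)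
  calc _ ≤ ∏ p ∈ W, (Real.exp (4 * (1 / ((p : ℝ) * √p))) * (if p ∣ M then 1 + y p else 1)) :=
        Finset.prod_le_prod (fun p hp => by
          have := mul_nonneg (hy0 p) (hw0 p hp)
          linarith) h1
    _ = Real.exp (4 * ∑ p ∈ W, 1 / ((p : ℝ) * √p)) *
          ∏ p ∈ W.filter (fun p => p ∣ M), (1 + y p) := by
        rw [Finset.prod_mul_distrib, ← Real.exp_sum, Finset.mul_sum, Finset.prod_filter]
    _ ≤ _ := by
        gcongr
        · exact Finset.prod_nonneg fun p _ => by linarith [hy0 p]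
        · exact hB W
        · exact fun p _ => by linarith [hy0 p]
        · exact fun p _ _ => by linarith [hy0 p]
        · intro p hp
          rw [Finset.mem_filter] at hp
          exact Nat.mem_primeFactors.2 ⟨hW p hp.1, hp.2, hM⟩

theorem exists_sum_le_sum_squarefree {T B x : ℕ → ℝ} (hB : ∀ s, Squarefree s → 0 ≤ B s)
    (hT : ∀ s m, Squarefree s → 0 < m → T (s * m ^ 2) ≤ 1 / ((s : ℝ) * (m : ℝ) ^ 2) * B s)
    (hx : ∀ s, 0 < s → 0 < x s) (F : Finset ℕ) (hF : ∀ n ∈ F, 0 < n)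
    (hxF : ∀ s m : ℕ, Squarefree s → 0 < m → s * m ^ 2 ∈ F → x s < m) :
    ∃ S : Finset ℕ, (∀ s ∈ S, Squarefree s) ∧
      ∑ n ∈ F, T n ≤ ∑ s ∈ S, 1 / (s : ℝ) * (2 / x s) * B s := by
  have hdec : ∀ n : ℕ, ∃ s m : ℕ, 0 < n → 0 < m ∧ s * m ^ 2 = n ∧ Squarefree s := by
    intro n
    rcases n.eq_zero_or_pos with rfl | hn
    · exact ⟨0, 0, fun h => absurd h (lt_irrefl 0)⟩
    · obtain ⟨s, m, _, hm, h, hs⟩ := Nat.sq_mul_squarefree_of_pos hn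
      exact ⟨s, m, fun _ => ⟨hm, by rw [mul_comm, h], hs⟩⟩
  choose s m hsm using hdec
  refine ⟨F.image s, fun t ht => ?_, ?_⟩
  · obtain ⟨n, hn, rfl⟩ := Finset.mem_image.1 ht
    exact (hsm n (hF n hn)).2.2
  rw [← Finset.sum_fiberwise_of_maps_to (g := s) fun n hn => Finset.mem_image_of_mem s hn]
  refine Finset.sum_le_sum fun t ht => ?_
  have htsq : Squarefree t := by
    obtain ⟨n, hn, rfl⟩ := Finset.mem_image.1 ht
    exact (hsm n (hF n hn)).2.2
  have hB0 := hB t htsq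
  calc ∑ n ∈ F.filter (fun n => s n = t), T n
      ≤ ∑ n ∈ F.filter (fun n => s n = t), 1 / (t : ℝ) * B t * (1 / (m n : ℝ) ^ 2) := by
        refine Finset.sum_le_sum fun n hn => ?_
        rw [Finset.mem_filter] at hn
        obtain ⟨hm, hn', hs⟩ := hsm n (hF n hn.1)
        rw [hn.2] at hn'
        have := hT t (m n) htsq hm
        rw [hn'] at this
        refine this.trans_eq ?_
        field_simp
    _ = 1 / (t : ℝ) * B t *
          ∑ k ∈ (F.filter (fun n => s n = t)).image m, 1 / (k : ℝ) ^ 2 := by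
        rw [← Finset.mul_sum, Finset.sum_image]
        intro n hn k hk h
        rw [Finset.mem_coe, Finset.mem_filter] at hn hk
        rw [← (hsm n (hF n hn.1)).2.1, ← (hsm k (hF k hk.1)).2.1, hn.2, hk.2]
        exact congrArg (fun j => t * j ^ 2) h
    _ ≤ 1 / (t : ℝ) * B t * (2 / x t) := by
        gcongr
        refine sum_inv_sq_le (hx t (Nat.pos_of_ne_zero htsq.ne_zero)) _ fun k hk => ?_
        obtain ⟨n, hn, rfl⟩ := Finset.mem_image.1 hk
        rw [Finset.mem_filter] at hn
        obtain ⟨hm, hn', hs⟩ := hsm n (hF n hn.1)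
        rw [hn.2] at hn'
        exact hxF t (m n) htsq hm (by rw [hn']; exact hn.1)
    _ = _ := by ring

theorem savingWeight_nonneg (M : ℕ) {p : ℕ} (hp : p.Prime) : 0 ≤ savingWeight M p := by
  have hp2 : (2 : ℝ) ≤ p := by exact_mod_cast hp.two_le
  unfold savingWeight
  split_ifs
  · exact zero_le_one
  · exact div_nonneg (by norm_num) (by linarith)

theorem exists_sum_abs_K0term_le : ∃ C : ℝ, 0 < C ∧ ∀ (y x : ℕ → ℝ) (c : ℝ), 0 < c →
    (∀ p, 0 ≤ y p) → (∀ p, y p ≤ 1 / √p) → (∀ s, 0 < s → 0 < x s) →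
    (∀ s : ℕ, Squarefree s → 1 / (s : ℝ) * (2 / x s) = c * ∏ p ∈ s.primeFactors, y p) →
    ∀ (N f : ℕ) (F : Finset ℕ), Odd N → Odd f → (∀ n ∈ F, 0 < n) →
    (∀ s m : ℕ, Squarefree s → 0 < m → s * m ^ 2 ∈ F → x s < m) →
    ∑ n ∈ F, |K0term N f n| ≤ C * (c * ∏ p ∈ N.primeFactors, (1 + y p)) *
      (1 / ((f : ℝ) * f.totient) * ∏ p ∈ f.primeFactors, (1 + y p)) := by
  obtain ⟨C, hC, h⟩ := exists_prod_savingWeight_le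
  refine ⟨2 * C, by positivity, fun y x c hc hy0 hy hx hxy N f F hN hf hF hxF => ?_⟩
  have hN0 := hN.pos
  have hf0 := hf.pos
  have hg : ∀ p, 1 ≤ 1 + y p := fun p => by linarith [hy0 p]
  have hy2 : 1 + y 2 ≤ 2 := by
    have h1 := hy 2
    have h2 : 1 / √((2 : ℕ) : ℝ) ≤ 1 := by
      rw [div_le_one (by positivity), Real.one_le_sqrt]
      norm_num
    linarith
  have hM : ∏ p ∈ (2 * N * f).primeFactors, (1 + y p) ≤
      2 * (∏ p ∈ N.primeFactors, (1 + y p)) * ∏ p ∈ f.primeFactors, (1 + y p) := by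
    have hfp : 0 ≤ ∏ p ∈ f.primeFactors, (1 + y p) :=
      Finset.prod_nonneg fun p _ => by linarith [hy0 p]
    have hNp : 0 ≤ ∏ p ∈ N.primeFactors, (1 + y p) :=
      Finset.prod_nonneg fun p _ => by linarith [hy0 p]
    calc _ ≤ (∏ p ∈ (2 * N).primeFactors, (1 + y p)) * ∏ p ∈ f.primeFactors, (1 + y p) :=
          prod_primeFactors_mul_le (by omega) (by omega) hg
      _ ≤ ((∏ p ∈ Nat.primeFactors 2, (1 + y p)) * ∏ p ∈ N.primeFactors, (1 + y p)) *
            ∏ p ∈ f.primeFactors, (1 + y p) := by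
          gcongr
          exact prod_primeFactors_mul_le (by omega) (by omega) hg
      _ ≤ _ := by
          rw [Nat.prime_two.primeFactors, Finset.prod_singleton]
          gcongr
  obtain ⟨S, hS, hle⟩ := exists_sum_le_sum_squarefree
    (T := fun n => |K0term N f n|)
    (B := fun s => 1 / ((f : ℝ) * f.totient) * ∏ p ∈ s.primeFactors, savingWeight (2 * N * f) p)
    (x := x)
    (fun s _ => mul_nonneg (by positivity) (Finset.prod_nonneg fun p hp =>
      savingWeight_nonneg _ (Nat.prime_of_mem_primeFactors hp)))
    (fun s m hs hm => (abs_K0term_le hN hf hs hm rfl).trans_eq (by ring)) hx F hF hxF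
  have hW : ∀ p ∈ S.biUnion Nat.primeFactors, p.Prime := fun p hp => by
    obtain ⟨s, _, hps⟩ := Finset.mem_biUnion.1 hp
    exact Nat.prime_of_mem_primeFactors hps
  calc _ ≤ _ := hle
    _ = c * (1 / ((f : ℝ) * f.totient)) *
        ∑ s ∈ S, ∏ p ∈ s.primeFactors, (y p * savingWeight (2 * N * f) p) := by
        rw [Finset.mul_sum]
        refine Finset.sum_congr rfl fun s hs => ?_
        rw [hxy s (hS s hs), Finset.prod_mul_distrib]
        ring
    _ ≤ c * (1 / ((f : ℝ) * f.totient)) *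
        (C * (2 * (∏ p ∈ N.primeFactors, (1 + y p)) * ∏ p ∈ f.primeFactors, (1 + y p))) := by
        gcongr
        refine (sum_squarefree_le_prod S hS fun p hp =>
          mul_nonneg (hy0 p) (savingWeight_nonneg _ hp)).trans ?_
        exact (h y hy0 hy _ hW (2 * N * f) (by positivity)).trans (by gcongr)
    _ = _ := by ring

theorem inv_mul_totient_mul_prod_le {f : ℕ} (hf : f ≠ 0) {y : ℕ → ℝ} (hy0 : ∀ p, 0 ≤ y p)
    (hy : ∀ p, y p ≤ 1 / √p) :
    1 / ((f : ℝ) * f.totient) * ∏ p ∈ f.primeFactors, (1 + y p) ≤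
      1 / (f : ℝ) ^ 2 * ∏ p ∈ f.primeFactors, (1 + 5 / √p) := by
  have hφ : (f.totient : ℝ) = f * ∏ p ∈ f.primeFactors, (1 - (p : ℝ)⁻¹) := by
    have := congrArg (fun q : ℚ => (q : ℝ)) (Nat.totient_eq_mul_prod_factors f)
    push_cast at this
    exact this
  have hf' : (f : ℝ) ≠ 0 := by exact_mod_cast hf
  have h1 : 1 / ((f : ℝ) * f.totient) * ∏ p ∈ f.primeFactors, (1 + y p) =
      1 / (f : ℝ) ^ 2 * ∏ p ∈ f.primeFactors, ((1 + y p) / (1 - (p : ℝ)⁻¹)) := by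
    rw [hφ, Finset.prod_div_distrib]
    field_simp
  rw [h1]
  gcongr with p hp
  · intro p hp
    have hp2 : (2 : ℝ) ≤ p := by exact_mod_cast (Nat.prime_of_mem_primeFactors hp).two_le
    have : (p : ℝ)⁻¹ ≤ 1 := inv_le_one_of_one_le₀ (by linarith)
    exact div_nonneg (by linarith [hy0 p]) (by linarith)
  · have hp2 : (2 : ℝ) ≤ p := by exact_mod_cast (Nat.prime_of_mem_primeFactors hp).two_le
    have hs := hy p
    rw [div_eq_mul_one_div (5 : ℝ)]
    have hsq : (p : ℝ)⁻¹ = (1 / √(p : ℝ)) ^ 2 := by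
      rw [div_pow, one_pow, Real.sq_sqrt (by linarith), one_div]
    have hp' : (p : ℝ)⁻¹ ≤ 1 / 2 := by
      rw [← one_div]; exact one_div_le_one_div_of_le (by norm_num) hp2
    have hq0 : 0 ≤ 1 / √(p : ℝ) := by positivity
    rw [hsq] at hp' ⊢
    generalize 1 / √(p : ℝ) = q at hs hp' hq0 ⊢
    rw [div_le_iff₀ (by linarith)]
    have hq1 : q ≤ 3 / 4 := by nlinarith
    nlinarith [mul_nonneg hq0 (sub_nonneg.2 hp')]

theorem exists_sum_sum_abs_K0term_le : ∃ C : ℝ, 0 < C ∧ ∀ (y x : ℕ → ℝ) (c : ℝ), 0 < c →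
    (∀ p, 0 ≤ y p) → (∀ p, y p ≤ 1 / √p) → (∀ s, 0 < s → 0 < x s) →
    (∀ s : ℕ, Squarefree s → 1 / (s : ℝ) * (2 / x s) = c * ∏ p ∈ s.primeFactors, y p) →
    ∀ (N : ℕ) (V : ℝ) (G F : Finset ℕ), Odd N → 0 < V → (∀ f ∈ G, Odd f ∧ V < f) →
    (∀ n ∈ F, 0 < n) → (∀ s m : ℕ, Squarefree s → 0 < m → s * m ^ 2 ∈ F → x s < m) →
    ∑ f ∈ G, ∑ n ∈ F, |K0term N f n| ≤ C * (c * ∏ p ∈ N.primeFactors, (1 + y p)) / V := by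
  obtain ⟨C, hC, h⟩ := exists_sum_abs_K0term_le
  obtain ⟨B, hB0, hB⟩ := exists_sum_inv_mul_sqrt_le
  refine ⟨C * (2 * Real.exp (5 * B)), by positivity,
    fun y x c hc hy0 hy hx hxy N V G F hN hV hG hF hxF => ?_⟩
  have hP : 0 ≤ ∏ p ∈ N.primeFactors, (1 + y p) :=
    Finset.prod_nonneg fun p _ => by linarith [hy0 p]
  calc _ ≤ ∑ f ∈ G, C * (c * ∏ p ∈ N.primeFactors, (1 + y p)) *
        (1 / (f : ℝ) ^ 2 * ∏ p ∈ f.primeFactors, (1 + 5 / √p)) := by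
        refine Finset.sum_le_sum fun f hf => ?_
        refine (h y x c hc hy0 hy hx hxy N f F hN (hG f hf).1 hF hxF).trans ?_
        exact mul_le_mul_of_nonneg_left (inv_mul_totient_mul_prod_le (hG f hf).1.pos.ne' hy0 hy)
          (by positivity)
    _ ≤ C * (c * ∏ p ∈ N.primeFactors, (1 + y p)) * (2 / V * Real.exp (5 * B)) := by
        rw [← Finset.mul_sum]
        gcongr
        refine (sum_inv_sq_mul_prod_le hV G (fun f hf => (hG f hf).2)
          fun p => by positivity).trans ?_
        gcongr
        refine (prod_one_add_le_exp _ fun p => by positivity).trans (Real.exp_le_exp.2 ?_)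
        calc _ = 5 * ∑ p ∈ G.biUnion Nat.primeFactors, 1 / ((p : ℝ) * √p) := by
              rw [Finset.mul_sum]
              refine Finset.sum_congr rfl fun p _ => ?_
              rw [div_div, mul_one_div, mul_comm (p : ℝ)]
          _ ≤ _ := by gcongr; exact hB _
    _ = _ := by ring

theorem exists_sum_abs_K0term_le_of_lt_left : ∃ C : ℝ, 0 < C ∧ ∀ (N : ℕ) (V : ℝ)
    (G F : Finset ℕ), Odd N → 0 < V → (∀ f ∈ G, Odd f ∧ V < f) → (∀ n ∈ F, 0 < n) →
    ∑ f ∈ G, ∑ n ∈ F, |K0term N f n| ≤ C * (∏ p ∈ N.primeFactors, (1 + 1 / (p : ℝ))) / V := by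
  obtain ⟨C, hC, h⟩ := exists_sum_sum_abs_K0term_le
  refine ⟨C * 4, by positivity, fun N V G F hN hV hG hF => ?_⟩
  rw [mul_assoc]
  refine h (fun p => 1 / (p : ℝ)) (fun _ => 1 / 2) 4 (by norm_num) (fun p => by positivity)
    (fun p => ?_) (fun _ _ => by norm_num) (fun s hs => ?_) N V G F hN hV hG hF
    fun s m _ hm _ => ?_
  · rcases p.eq_zero_or_pos with rfl | hp
    · simp
    · have hp1 : (1 : ℝ) ≤ p := by exact_mod_cast hp
      exact one_div_le_one_div_of_le (by positivity) (Real.sqrt_le_self_iff.2 (Or.inr hp1))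
  · conv_lhs => rw [← Nat.prod_primeFactors_of_squarefree hs]
    rw [Finset.prod_div_distrib, Finset.prod_const_one]
    push_cast
    ring
  · have hm1 : (1 : ℝ) ≤ m := by exact_mod_cast hm
    linarith

theorem exists_sum_abs_K0term_le_of_lt_right : ∃ C : ℝ, 0 < C ∧ ∀ (N : ℕ) (U : ℝ)
    (G F : Finset ℕ), Odd N → 0 < U → (∀ f ∈ G, Odd f) → (∀ n ∈ F, U < n) →
    ∑ f ∈ G, ∑ n ∈ F, |K0term N f n| ≤
      C * (∏ p ∈ N.primeFactors, (1 + 1 / √(p : ℝ))) / √U := by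
  obtain ⟨C, hC, h⟩ := exists_sum_sum_abs_K0term_le
  refine ⟨C * 4, by positivity, fun N U G F hN hU hG hF => ?_⟩
  have hU' : 0 < √U := Real.sqrt_pos.2 hU
  refine (h (fun p => 1 / √(p : ℝ)) (fun s => √(U / s)) (2 / √U) (by positivity)
    (fun p => by positivity) (fun p => le_rfl) (fun s hs => Real.sqrt_pos.2 (by positivity))
    (fun s hs => ?_) N (1 / 2) G F hN (by norm_num) (fun f hf => ⟨hG f hf, ?_⟩)
    (fun n hn => by exact_mod_cast hU.trans (hF n hn)) fun s m hs hm hsm => ?_).trans_eq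
    (by field_simp; norm_num)
  · have hs0 : (0 : ℝ) < s := by exact_mod_cast Nat.pos_of_ne_zero hs.ne_zero
    have hprod : ∏ p ∈ s.primeFactors, √(p : ℝ) = √(s : ℝ) := by
      conv_rhs => rw [← Nat.prod_primeFactors_of_squarefree hs]
      rw [Nat.cast_prod, Real.sqrt_prod _ fun p _ => by positivity]
    rw [Finset.prod_div_distrib, Finset.prod_const_one, hprod, Real.sqrt_div hU.le]
    have : 0 < √(s : ℝ) := Real.sqrt_pos.2 hs0
    nth_rewrite 1 [← Real.mul_self_sqrt hs0.le]
    field_simp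
  · have : (1 : ℝ) ≤ f := by exact_mod_cast (hG f hf).pos
    linarith
  · have hs0 : (0 : ℝ) < s := by exact_mod_cast Nat.pos_of_ne_zero hs.ne_zero
    rw [Real.sqrt_lt' (by positivity), div_lt_iff₀ hs0, mul_comm]
    exact_mod_cast hF _ hsm

theorem sum_primesLE_log_div_le {n : ℕ} (hn : 0 < n) :
    ∑ p ∈ n.primesLE, Real.log p / p ≤ Real.log n + Real.log 4 := by
  have hn' : (0 : ℝ) < n := by exact_mod_cast hn
  have hdvd : ∏ p ∈ n.primesLE, p ^ (n / p) ∣ n.factorial := by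
    refine Finset.prod_dvd_of_isRelPrime (fun p hp q hq hpq => ?_) fun p hp => ?_
    · rw [Function.onFun, ← Nat.coprime_iff_isRelPrime]
      exact Nat.Coprime.pow _ _ ((Nat.coprime_primes (Nat.mem_primesLE.1 hp).2
        (Nat.mem_primesLE.1 hq).2).2 hpq)
    · obtain ⟨hpn, hp⟩ := Nat.mem_primesLE.1 hp
      rw [Nat.Prime.pow_dvd_factorial_iff hp (Nat.lt_succ_self _)]
      have h1 : 1 ≤ Nat.log p n := Nat.log_pos hp.one_lt hpn
      have h2 := Finset.single_le_sum (f := fun i => n / p ^ i) (fun _ _ => Nat.zero_le _)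
        (Finset.mem_Ico.2 ⟨le_rfl, Nat.lt_succ_of_le h1⟩ : 1 ∈ Finset.Ico 1 (Nat.log p n).succ)
      simpa using h2
  have h1 : ∑ p ∈ n.primesLE, ((n / p : ℕ) : ℝ) * Real.log p ≤ n * Real.log n := by
    have h2 : (∏ p ∈ n.primesLE, p ^ (n / p)) ≤ n ^ n :=
      (Nat.le_of_dvd n.factorial_pos hdvd).trans n.factorial_le_pow
    have hpos : ∀ p ∈ n.primesLE, (p : ℝ) ^ (n / p) ≠ 0 := fun p hp => by
      have := (Nat.mem_primesLE.1 hp).2.pos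
      positivity
    have h3 : ∏ p ∈ n.primesLE, (p : ℝ) ^ (n / p) ≤ (n : ℝ) ^ n := by exact_mod_cast h2
    have h4 := Real.log_le_log (lt_of_le_of_ne (by positivity)
      (Finset.prod_ne_zero_iff.2 hpos).symm) h3
    rw [Real.log_prod hpos, Real.log_pow] at h4
    simpa only [Real.log_pow] using h4
  have hθ := Chebyshev.theta_le_log4_mul_x hn'.le
  rw [Chebyshev.theta_eq_sum_primesLE_log] at hθ
  refine le_of_mul_le_mul_left ?_ hn'
  calc n * ∑ p ∈ n.primesLE, Real.log p / p
      ≤ ∑ p ∈ n.primesLE, (((n / p : ℕ) : ℝ) * Real.log p + Real.log p) := by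
        rw [Finset.mul_sum]
        refine Finset.sum_le_sum fun p hp => ?_
        have hp' := (Nat.mem_primesLE.1 hp).2
        have h2 : (n : ℝ) / p ≤ ((n / p : ℕ) : ℝ) + 1 := by
          rw [← Nat.floor_div_eq_div (K := ℝ)]
          exact (Nat.lt_floor_add_one _).le
        have h3 : 0 ≤ Real.log p := Real.log_natCast_nonneg p
        calc _ = (n : ℝ) / p * Real.log p := by ring
          _ ≤ (((n / p : ℕ) : ℝ) + 1) * Real.log p := by gcongr
          _ = _ := by ring
    _ ≤ n * (Real.log n + Real.log 4) := by
        rw [Finset.sum_add_distrib]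
        linarith

theorem exists_sum_primesLE_inv_le : ∃ K : ℝ, ∀ n : ℕ, 2 ≤ n →
    ∑ p ∈ n.primesLE, 1 / (p : ℝ) ≤ Real.log (Real.log n) + K := by
  have key : ∀ n : ℕ, 2 ≤ n → ∑ p ∈ n.primesLE, 1 / (p : ℝ) ≤
      (∑ p ∈ n.primesLE, Real.log p / p) / Real.log n + Real.log (Real.log n)
        - Real.log 4 / Real.log n + (Real.log 4 / Real.log 2 - Real.log (Real.log 2)) := by
    intro n hn
    induction n, hn using Nat.le_induction with
    | base =>
      have h2 : Nat.primesLE 2 = {2} := by decide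
      have hl : Real.log 2 ≠ 0 := (Real.log_pos one_lt_two).ne'
      rw [h2, Finset.sum_singleton, Finset.sum_singleton]
      apply le_of_eq
      push_cast
      field_simp
      ring
    | succ n hn ih =>
      have hA := sum_primesLE_log_div_le (n := n) (by omega)
      have hl : 0 < Real.log n := Real.log_pos (by exact_mod_cast hn)
      have hll : Real.log n ≤ Real.log (n + 1 : ℕ) :=
        Real.log_le_log (by positivity) (by push_cast; linarith)
      have hl' : 0 < Real.log (n + 1 : ℕ) := hl.trans_le hll
      have hstep : ∑ p ∈ (n + 1).primesLE, 1 / (p : ℝ) -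
          (∑ p ∈ (n + 1).primesLE, Real.log p / p) / Real.log (n + 1 : ℕ) =
          ∑ p ∈ n.primesLE, 1 / (p : ℝ) -
            (∑ p ∈ n.primesLE, Real.log p / p) / Real.log (n + 1 : ℕ) := by
        rw [Nat.primesLE_succ]
        split_ifs with hp
        · have hnot : n + 1 ∉ n.primesLE := fun h => by
            have := (Nat.mem_primesLE.1 h).1
            omega
          rw [Finset.sum_insert hnot, Finset.sum_insert hnot]
          field_simp
          ring
        · rfl
      have hlog : 1 - Real.log n / Real.log (n + 1 : ℕ) ≤
          Real.log (Real.log (n + 1 : ℕ)) - Real.log (Real.log n) := by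
        rw [← Real.log_div hl'.ne' hl.ne']
        have := Real.one_sub_inv_le_log_of_pos (div_pos hl' hl)
        rwa [inv_div] at this
      have hinv : 0 ≤ 1 / Real.log n - 1 / Real.log (n + 1 : ℕ) :=
        sub_nonneg.2 (one_div_le_one_div_of_le hl hll)
      have hmul := mul_le_mul_of_nonneg_right hA hinv
      have hexp : (Real.log n + Real.log 4) * (1 / Real.log n - 1 / Real.log (n + 1 : ℕ)) =
          1 - Real.log n / Real.log (n + 1 : ℕ) + Real.log 4 / Real.log n
            - Real.log 4 / Real.log (n + 1 : ℕ) := by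
        field_simp
        ring
      rw [hexp, mul_sub, mul_one_div, mul_one_div] at hmul
      linarith
  refine ⟨1 + (Real.log 4 / Real.log 2 - Real.log (Real.log 2)), fun n hn => ?_⟩
  have hl : 0 < Real.log n := Real.log_pos (by exact_mod_cast hn)
  have h1 := div_le_div_of_nonneg_right (sum_primesLE_log_div_le (n := n) (by omega)) hl.le
  rw [add_div, div_self hl.ne'] at h1
  linarith [key n hn]

theorem exists_prod_one_add_inv_le : ∃ C : ℝ, 0 < C ∧ ∀ N : ℕ, 3 ≤ N →
    ∏ p ∈ N.primeFactors, (1 + 1 / (p : ℝ)) ≤ C * Real.log (Real.log N) := by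
  obtain ⟨K, hK⟩ := exists_sum_primesLE_inv_le
  have h3 : 1 < Real.log 3 := by
    rw [Real.lt_log_iff_exp_lt (by norm_num)]
    exact Real.exp_one_lt_three
  have h33 : 0 < Real.log (Real.log 3) := Real.log_pos h3
  have hl2 : 0 < Real.log 2 := Real.log_pos one_lt_two
  refine ⟨Real.exp (K + 1 / Real.log 2) * (1 + Real.log 2 / Real.log (Real.log 3)),
    by positivity, fun N hN => ?_⟩
  have hN3 : (3 : ℝ) ≤ N := by exact_mod_cast hN
  have hlN : Real.log 3 ≤ Real.log N := Real.log_le_log (by norm_num) hN3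
  have hllN : Real.log (Real.log 3) ≤ Real.log (Real.log N) := Real.log_le_log (by linarith) hlN
  set n := max ⌊Real.log N⌋₊ 2 with hn
  have hn2 : 2 ≤ n := le_max_right _ _
  have hsmall : ∑ p ∈ N.primeFactors.filter (fun p => p ≤ n), 1 / (p : ℝ) ≤
      Real.log (Real.log n) + K := by
    refine (Finset.sum_le_sum_of_subset_of_nonneg ?_ fun _ _ _ => by positivity).trans (hK n hn2)
    intro p hp
    rw [Finset.mem_filter] at hp
    exact Nat.mem_primesLE.2 ⟨hp.2, Nat.prime_of_mem_primeFactors hp.1⟩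
  have hlarge : ∑ p ∈ N.primeFactors.filter (fun p => ¬ p ≤ n), 1 / (p : ℝ) ≤
      1 / Real.log 2 := by
    have hcard : (N.primeFactors.card : ℝ) * Real.log 2 ≤ Real.log N := by
      have h1 : 2 ^ N.primeFactors.card ≤ N :=
        (Finset.pow_card_le_prod _ _ _ fun p hp =>
          (Nat.prime_of_mem_primeFactors hp).two_le).trans
          (Nat.le_of_dvd (by omega) (Nat.prod_primeFactors_dvd N))
      rw [← Real.log_pow]
      exact Real.log_le_log (by positivity) (by exact_mod_cast h1)
    calc _ ≤ ∑ p ∈ N.primeFactors.filter (fun p => ¬ p ≤ n), 1 / Real.log N := by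
          refine Finset.sum_le_sum fun p hp => ?_
          rw [Finset.mem_filter, not_le] at hp
          refine one_div_le_one_div_of_le (by linarith) ?_
          exact (Nat.lt_of_floor_lt ((le_max_left _ _).trans_lt hp.2)).le
      _ ≤ N.primeFactors.card * (1 / Real.log N) := by
          rw [Finset.sum_const, nsmul_eq_mul]
          have : 0 ≤ 1 / Real.log N := one_div_nonneg.2 (by linarith)
          gcongr
          exact Finset.filter_subset _ _
      _ ≤ _ := by
          rw [mul_one_div, div_le_div_iff₀ (by linarith) hl2]
          linarith
  have hlogn : Real.log n ≤ (1 + Real.log 2 / Real.log (Real.log 3)) * Real.log (Real.log N) := by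
    have h0 : 0 ≤ Real.log 2 / Real.log (Real.log 3) * Real.log (Real.log N) := by
      have : 0 ≤ Real.log (Real.log N) := by linarith
      positivity
    rcases le_total ⌊Real.log N⌋₊ 2 with h | h
    · rw [hn, max_eq_right h]
      have : Real.log 2 ≤ Real.log 2 / Real.log (Real.log 3) * Real.log (Real.log N) := by
        rw [div_mul_eq_mul_div, le_div_iff₀ h33]
        gcongr
      push_cast
      linarith
    · rw [hn, max_eq_left h]
      have h1 : (2 : ℝ) ≤ (⌊Real.log N⌋₊ : ℝ) := by exact_mod_cast h
      have : Real.log (⌊Real.log N⌋₊ : ℝ) ≤ Real.log (Real.log N) :=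
        Real.log_le_log (by linarith) (Nat.floor_le (by linarith))
      linarith
  have hln : 0 < Real.log n := Real.log_pos (by exact_mod_cast hn2)
  calc _ ≤ Real.exp (∑ p ∈ N.primeFactors, 1 / (p : ℝ)) :=
        prod_one_add_le_exp _ fun p => by positivity
    _ ≤ Real.exp (K + 1 / Real.log 2 + Real.log (Real.log n)) := by
        rw [Real.exp_le_exp, ← Finset.sum_filter_add_sum_filter_not _ (fun p => p ≤ n)]
        linarith
    _ = Real.exp (K + 1 / Real.log 2) * Real.log n := by
        rw [Real.exp_add, Real.exp_log hln]
    _ ≤ _ := by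
        rw [mul_assoc]
        gcongr

theorem exists_prod_one_add_inv_sqrt_le {ε : ℝ} (hε : 0 < ε) : ∃ C : ℝ, 0 < C ∧ ∀ N : ℕ, N ≠ 0 →
    ∏ p ∈ N.primeFactors, (1 + 1 / √(p : ℝ)) ≤ C * (N : ℝ) ^ ε := by
  set P := ⌈(2 : ℝ) ^ (1 / ε)⌉₊
  refine ⟨2 ^ P, by positivity, fun N hN => ?_⟩
  calc _ ≤ ∏ p ∈ N.primeFactors, ((if p < P then 2 else 1) * (p : ℝ) ^ ε) := by
        refine Finset.prod_le_prod (fun p _ => by positivity) fun p hp => ?_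
        have hp1 : (1 : ℝ) ≤ p := by exact_mod_cast (Nat.prime_of_mem_primeFactors hp).one_le
        have h1 : 1 / √(p : ℝ) ≤ 1 := by
          rw [div_le_one (by positivity)]
          exact Real.one_le_sqrt.2 hp1
        have h2 : 1 ≤ (p : ℝ) ^ ε := Real.one_le_rpow hp1 hε.le
        split_ifs with h
        · linarith
        · have h3 : (2 : ℝ) ^ (1 / ε) ≤ p := (Nat.le_ceil _).trans (by exact_mod_cast not_lt.1 h)
          have h4 := Real.rpow_le_rpow (by positivity) h3 hε.le
          rw [← Real.rpow_mul (by norm_num), one_div_mul_cancel hε.ne', Real.rpow_one] at h4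
          linarith
    _ = 2 ^ (N.primeFactors.filter (fun p => p < P)).card *
          ((∏ p ∈ N.primeFactors, p : ℕ) : ℝ) ^ ε := by
        rw [Finset.prod_mul_distrib, Finset.prod_ite, Finset.prod_const, Finset.prod_const_one,
          mul_one, Real.finsetProd_rpow _ _ fun p _ => by positivity, Nat.cast_prod]
    _ ≤ _ := by
        gcongr
        · norm_num
        · calc _ ≤ (Finset.range P).card := Finset.card_le_card fun p hp =>
                Finset.mem_range.2 (Finset.mem_filter.1 hp).2
            _ = P := Finset.card_range P
        · exact Nat.le_of_dvd (Nat.pos_of_ne_zero hN) (Nat.prod_primeFactors_dvd N)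

theorem summable_and_abs_tsum_sub_sum_le {α : Type*} {g : α → ℝ} (S : Finset α) {c : ℝ}
    (h : ∀ t : Finset α, Disjoint t S → ∑ i ∈ t, |g i| ≤ c) :
    Summable g ∧ |∑' i, g i - ∑ i ∈ S, g i| ≤ c := by
  have hs : Summable g := by
    refine Summable.of_abs (summable_of_sum_le (c := c + ∑ i ∈ S, |g i|)
      (fun i => abs_nonneg (g i)) fun t => ?_)
    rw [← Finset.sum_sdiff (Finset.inter_subset_left : t ∩ S ⊆ t), Finset.sdiff_inter_self_left]
    exact add_le_add (h _ Finset.sdiff_disjoint) (Finset.sum_le_sum_of_subset_of_nonneg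
      Finset.inter_subset_right fun i _ _ => abs_nonneg (g i))
  refine ⟨hs, le_of_tendsto (hs.hasSum.sub_const (∑ i ∈ S, g i)).abs ?_⟩
  filter_upwards [Filter.eventually_ge_atTop S] with t ht
  rw [← Finset.sum_sdiff ht, add_sub_cancel_right]
  exact (Finset.abs_sum_le_sum_abs _ _).trans (h _ Finset.sdiff_disjoint)

theorem sum_abs_K0term_le_sum_image (N : ℕ) (t : Finset (ℕ × ℕ)) :
    ∑ i ∈ t, |K0term N i.1 i.2| ≤
      ∑ f ∈ t.image Prod.fst, ∑ n ∈ t.image Prod.snd, |K0term N f n| := by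
  rw [← Finset.sum_product']
  exact Finset.sum_le_sum_of_subset_of_nonneg Finset.subset_product fun _ _ _ => abs_nonneg _

theorem exists_sum_abs_K0term_le_of_lt_or_lt {ε : ℝ} (hε : 0 < ε) : ∃ C : ℝ, 0 < C ∧
    ∀ N : ℕ, Odd N → 3 ≤ N → ∀ U V : ℝ, 0 < U → 0 < V → ∀ t : Finset (ℕ × ℕ),
    (∀ i ∈ t, Odd i.1 → 0 < i.2 → V < i.1 ∨ U < i.2) → ∑ i ∈ t, |K0term N i.1 i.2| ≤
      C * ((N : ℝ) ^ ε / √U + Real.log (Real.log N) / V) := by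
  obtain ⟨A, hA, hleft⟩ := exists_sum_abs_K0term_le_of_lt_left
  obtain ⟨B, hB, hright⟩ := exists_sum_abs_K0term_le_of_lt_right
  obtain ⟨A', hA', hlog⟩ := exists_prod_one_add_inv_le
  obtain ⟨B', hB', hpow⟩ := exists_prod_one_add_inv_sqrt_le hε
  refine ⟨A * A' + B * B', by positivity, fun N hN hN3 U V hU hV t ht => ?_⟩
  have hL := hlog N hN3
  have hL0 : 0 ≤ Real.log (Real.log N) :=
    nonneg_of_mul_nonneg_right ((Finset.prod_nonneg fun p _ => by positivity).trans hL) hA'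
  have hP := hpow N (by omega)
  have hsupp : ∑ i ∈ t.filter (fun i => Odd i.1 ∧ 0 < i.2), |K0term N i.1 i.2| =
      ∑ i ∈ t, |K0term N i.1 i.2| := by
    refine Finset.sum_filter_of_ne fun i _ hi => ?_
    by_contra h
    exact hi (by rw [K0term, if_neg h, abs_zero])
  rw [← hsupp, ← Finset.sum_filter_add_sum_filter_not _ (fun i => V < (i.1 : ℝ))]
  have h1 : ∑ i ∈ (t.filter (fun i => Odd i.1 ∧ 0 < i.2)).filter (fun i => V < (i.1 : ℝ)),
      |K0term N i.1 i.2| ≤ A * (A' * Real.log (Real.log N)) / V := by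
    refine (sum_abs_K0term_le_sum_image N _).trans
      ((hleft N V _ _ hN hV (fun f hf => ?_) fun n hn => ?_).trans (by gcongr))
    · obtain ⟨i, hi, rfl⟩ := Finset.mem_image.1 hf
      simp only [Finset.mem_filter] at hi
      exact ⟨hi.1.2.1, hi.2⟩
    · obtain ⟨i, hi, rfl⟩ := Finset.mem_image.1 hn
      simp only [Finset.mem_filter] at hi
      exact hi.1.2.2
  have h2 : ∑ i ∈ (t.filter (fun i => Odd i.1 ∧ 0 < i.2)).filter (fun i => ¬ V < (i.1 : ℝ)),
      |K0term N i.1 i.2| ≤ B * (B' * (N : ℝ) ^ ε) / √U := by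
    refine (sum_abs_K0term_le_sum_image N _).trans
      ((hright N U _ _ hN hU (fun f hf => ?_) fun n hn => ?_).trans (by gcongr))
    · obtain ⟨i, hi, rfl⟩ := Finset.mem_image.1 hf
      simp only [Finset.mem_filter] at hi
      exact hi.1.2.1
    · obtain ⟨i, hi, rfl⟩ := Finset.mem_image.1 hn
      simp only [Finset.mem_filter] at hi
      exact (ht i hi.1.1 hi.1.2.1 hi.1.2.2).resolve_left hi.2
  have h3 : 0 ≤ (N : ℝ) ^ ε / √U := by positivity
  have h4 : 0 ≤ Real.log (Real.log N) / V := by positivity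
  calc _ ≤ A * (A' * Real.log (Real.log N)) / V + B * (B' * (N : ℝ) ^ ε) / √U := add_le_add h1 h2
    _ = A * A' * (Real.log (Real.log N) / V) + B * B' * ((N : ℝ) ^ ε / √U) := by ring
    _ ≤ _ := by nlinarith [mul_nonneg (mul_pos hA hA').le h3, mul_nonneg (mul_pos hB hB').le h4]

theorem mem_range_floor_toNat_of_le {n : ℕ} {x : ℝ} (h : (n : ℝ) ≤ x) :
    n ∈ Finset.range (⌊x⌋.toNat + 1) := by
  have : (n : ℤ) ≤ ⌊x⌋ := Int.le_floor.2 (by exact_mod_cast h)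
  rw [Finset.mem_range]
  omega

/-- Lemma 1 (`complete K sum`): truncating K₀(N) at f ≤ V, n ≤ U costs
O(N^ε/√U + (log log N)/V). -/
theorem K0_truncation (ε : ℝ) (hε : 0 < ε) :
    ∃ C : ℝ, 0 < C ∧ ∀ N : ℕ, Odd N → 3 ≤ N → ∀ U V : ℝ, 0 < U → 0 < V →
    |K0 N -
      ∑ f ∈ (Finset.range (⌊V⌋.toNat + 1)).filter (fun f : ℕ => Odd f ∧ (f : ℝ) ≤ V),
        (1 / (f : ℝ)) *
          ∑ n ∈ (Finset.range (⌊U⌋.toNat + 1)).filter (fun n : ℕ => 0 < n ∧ (n : ℝ) ≤ U),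
            (1 / ((n : ℝ) * (Nat.totient (4 * n * f ^ 2) : ℝ))) *
              ∑ a ∈ (Finset.range (4 * n)).filter (fun a => a % 4 = 1),
                (jacobiSym (a : ℤ) n : ℝ) * (CNcard N a n f : ℝ)|
      ≤ C * ((N : ℝ) ^ ε / Real.sqrt U + Real.log (Real.log N) / V) := by
  obtain ⟨C, hC, h⟩ := exists_sum_abs_K0term_le_of_lt_or_lt hε
  refine ⟨C, hC, fun N hN hN3 U V hU hV => ?_⟩
  set G := (Finset.range (⌊V⌋.toNat + 1)).filter (fun f : ℕ => Odd f ∧ (f : ℝ) ≤ V)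
  set F := (Finset.range (⌊U⌋.toNat + 1)).filter (fun n : ℕ => 0 < n ∧ (n : ℝ) ≤ U)
  obtain ⟨hs, hle⟩ := summable_and_abs_tsum_sub_sum_le (g := fun i : ℕ × ℕ => K0term N i.1 i.2)
    (G ×ˢ F) fun t ht => h N hN hN3 U V hU hV t fun i hi hodd hpos => by
      by_contra! hn
      refine Finset.disjoint_left.1 ht hi (Finset.mem_product.2 ⟨?_, ?_⟩)
      · exact Finset.mem_filter.2 ⟨mem_range_floor_toNat_of_le hn.1, hodd, hn.1⟩
      · exact Finset.mem_filter.2 ⟨mem_range_floor_toNat_of_le hn.2, hpos, hn.2⟩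
  rw [hs.tsum_prod, Finset.sum_product] at hle
  refine Eq.trans_le (congrArg (fun x => |K0 N - x|) ?_) hle
  refine Finset.sum_congr rfl fun f hf => ?_
  rw [Finset.mul_sum]
  refine Finset.sum_congr rfl fun n hn => ?_
  rw [K0term, if_pos ⟨(Finset.mem_filter.1 hf).2.1, (Finset.mem_filter.1 hn).2.1⟩]
  exact (mul_assoc _ _ _).symm
end
end

section
/- For all positive integers N and f, the number of residues a ∈ ℤ/fℤ with D_N(a) ≡ 0 (mod f) is at most 8√f. -/
open scoped Classical BigOperators

noncomputable section

/-- A residue class modulo `d` has at most `e` representatives in `ZMod (d * e)`. -/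
theorem ncard_val_dvd_sub_le (n d e : ℕ) (hn : 0 < n) (h : n = d * e) (r : ℤ) :
    {x : ZMod n | (d : ℤ) ∣ x.val - r}.ncard ≤ e := by
  have : NeZero n := ⟨hn.ne'⟩
  have hd : 0 < d := Nat.pos_of_ne_zero (by rintro rfl; simp at h; omega)
  have key := Set.ncard_le_ncard_of_injOn (s := {x : ZMod n | (d : ℤ) ∣ x.val - r})
    (t := (Finset.range e : Set ℕ)) (fun x => x.val / d) ?_ ?_ (Finset.finite_toSet _)
  · simpa [Set.ncard_coe_finset] using key
  · intro x _
    simp only [Finset.coe_range, Set.mem_Iio]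
    exact Nat.div_lt_of_lt_mul (h ▸ ZMod.val_lt x)
  · intro x hx y hy hxy
    simp only [Set.mem_ofPred_eq] at hx hy hxy
    have h1 : (d : ℤ) ∣ (y.val : ℤ) - x.val := by
      have := dvd_sub hy hx
      rwa [sub_sub_sub_cancel_right] at this
    have h2 : x.val % d = y.val % d := (Nat.modEq_iff_dvd.mpr h1)
    apply ZMod.val_injective n
    rw [← Nat.div_add_mod x.val d, ← Nat.div_add_mod y.val d, hxy, h2]

theorem ncard_le_two_mul_of_dvd_sub_or_dvd_add (n d e : ℕ) (hn : 0 < n) (h : n = d * e) (r : ℤ)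
    (S : Set (ZMod n)) (hS : ∀ x ∈ S, (d : ℤ) ∣ x.val - r ∨ (d : ℤ) ∣ x.val + r) :
    S.ncard ≤ 2 * e := by
  have : NeZero n := ⟨hn.ne'⟩
  have hsub : S ⊆ {x : ZMod n | (d : ℤ) ∣ x.val - r} ∪ {x : ZMod n | (d : ℤ) ∣ x.val - (-r)} := by
    intro x hx
    simpa using hS x hx
  calc S.ncard ≤ _ := Set.ncard_le_ncard hsub (Set.toFinite _)
    _ ≤ _ := Set.ncard_union_le _ _
    _ ≤ e + e := add_le_add (ncard_val_dvd_sub_le n d e hn h r)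
        (ncard_val_dvd_sub_le n d e hn h (-r))
    _ = 2 * e := by ring

theorem Int.exists_pow_dvd_pow_dvd_of_pow_dvd_mul {p k : ℕ} (hp : p.Prime) {a b : ℤ}
    (h : (p : ℤ) ^ k ∣ a * b) : ∃ u v, u + v = k ∧ (p : ℤ) ^ u ∣ a ∧ (p : ℤ) ^ v ∣ b := by
  have h' : p ^ k ∣ a.natAbs * b.natAbs := by
    rw [← Int.natAbs_mul]
    exact Int.natCast_dvd.mp (by exact_mod_cast h)
  obtain ⟨d₁, d₂, h₁, h₂, he⟩ := exists_dvd_and_dvd_of_dvd_mul h'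
  obtain ⟨u, -, rfl⟩ := (Nat.dvd_prime_pow hp).mp (Dvd.intro _ he.symm)
  obtain ⟨v, -, rfl⟩ := (Nat.dvd_prime_pow hp).mp (Dvd.intro_left _ he.symm)
  refine ⟨u, v, ?_, ?_, ?_⟩
  · rw [← pow_add] at he
    exact (Nat.pow_right_injective hp.two_le he).symm
  · exact_mod_cast Int.natCast_dvd.mpr h₁
  · exact_mod_cast Int.natCast_dvd.mpr h₂

theorem ZMod.sq_eq_intCast_iff_dvd {n : ℕ} [NeZero n] (c : ℤ) (x : ZMod n) :
    x ^ 2 = (c : ZMod n) ↔ (n : ℤ) ∣ (x.val : ℤ) ^ 2 - c := by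
  rw [← ZMod.intCast_zmod_eq_zero_iff_dvd]
  simp [sub_eq_zero]

theorem ZMod.exists_pow_dvd_of_sq_eq {p k : ℕ} (hp : p.Prime) {c : ℤ} {x y : ZMod (p ^ k)}
    (hx : x ^ 2 = (c : ZMod (p ^ k))) (hy : y ^ 2 = (c : ZMod (p ^ k))) :
    ∃ u v, u + v = k ∧ (p : ℤ) ^ u ∣ x.val - y.val ∧ (p : ℤ) ^ v ∣ x.val + y.val := by
  have : NeZero (p ^ k) := ⟨(pow_pos hp.pos k).ne'⟩
  rw [ZMod.sq_eq_intCast_iff_dvd] at hx hy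
  apply Int.exists_pow_dvd_pow_dvd_of_pow_dvd_mul hp
  have := dvd_sub hx hy
  rwa [Nat.cast_pow, show (x.val : ℤ) ^ 2 - c - ((y.val : ℤ) ^ 2 - c) =
    (x.val - y.val) * (x.val + y.val) by ring] at this

theorem ncard_sqrt_prime_pow_sq_le_four_mul {p : ℕ} (hp : p.Prime) (k : ℕ) (c : ℤ) :
    {x : ZMod (p ^ k) | x ^ 2 = (c : ZMod (p ^ k))}.ncard ^ 2 ≤ 4 * p ^ k := by
  rcases Set.eq_empty_or_nonempty {x : ZMod (p ^ k) | x ^ 2 = (c : ZMod (p ^ k))} with h | ⟨y, hy⟩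
  · simp [h]
  have hb := ncard_le_two_mul_of_dvd_sub_or_dvd_add (p ^ k) (p ^ (k - k / 2)) (p ^ (k / 2))
    (pow_pos hp.pos k) (by rw [← pow_add]; congr 1; omega) y.val
    {x : ZMod (p ^ k) | x ^ 2 = (c : ZMod (p ^ k))} (by
      intro x hx
      obtain ⟨u, v, huv, hu, hv⟩ := ZMod.exists_pow_dvd_of_sq_eq hp hx hy
      push_cast
      rcases le_or_gt (k - k / 2) u with h | h
      · exact Or.inl ((pow_dvd_pow _ h).trans hu)
      · exact Or.inr ((pow_dvd_pow _ (by omega)).trans hv))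
  calc _ ≤ (2 * p ^ (k / 2)) ^ 2 := Nat.pow_le_pow_left hb 2
    _ = 4 * p ^ (k / 2 * 2) := by rw [mul_pow, ← pow_mul]; norm_num
    _ ≤ 4 * p ^ k := Nat.mul_le_mul_left _ (Nat.pow_le_pow_right hp.pos (by omega))

theorem ncard_sqrt_prime_pow_sq_le {p : ℕ} (hp : p.Prime) (h5 : 5 ≤ p) (k : ℕ) (c : ℤ) :
    {x : ZMod (p ^ k) | x ^ 2 = (c : ZMod (p ^ k))}.ncard ^ 2 ≤ p ^ k := by
  have : NeZero (p ^ k) := ⟨(pow_pos hp.pos k).ne'⟩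
  by_cases hall : ∀ x : ZMod (p ^ k), x ^ 2 = (c : ZMod (p ^ k)) →
      (p : ℤ) ^ (k - k / 2) ∣ x.val
  · have hb : {x : ZMod (p ^ k) | x ^ 2 = (c : ZMod (p ^ k))}.ncard ≤ p ^ (k / 2) := by
      refine (Set.ncard_le_ncard (fun x hx => ?_) (Set.toFinite _)).trans
        (ncard_val_dvd_sub_le (p ^ k) (p ^ (k - k / 2)) (p ^ (k / 2))
          (pow_pos hp.pos k) (by rw [← pow_add]; congr 1; omega) 0)
      simpa using hall x hx
    calc _ ≤ (p ^ (k / 2)) ^ 2 := Nat.pow_le_pow_left hb 2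
      _ = p ^ (k / 2 * 2) := by rw [← pow_mul]
      _ ≤ p ^ k := Nat.pow_le_pow_right hp.pos (by omega)
  · push Not at hall
    obtain ⟨y, hy, hndvd⟩ := hall
    obtain ⟨m, hm, hmk⟩ : ∃ m, ¬ (p : ℤ) ^ (m + 1) ∣ y.val ∧ 2 * m + 1 ≤ k := by
      have h0 : k - k / 2 ≠ 0 := fun h => hndvd (by simp [h])
      exact ⟨k - k / 2 - 1, by rwa [Nat.sub_add_cancel (by omega)], by omega⟩
    have hb := ncard_le_two_mul_of_dvd_sub_or_dvd_add (p ^ k) (p ^ (k - m)) (p ^ m)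
      (pow_pos hp.pos k) (by rw [← pow_add]; congr 1; omega) y.val
      {x : ZMod (p ^ k) | x ^ 2 = (c : ZMod (p ^ k))} (by
        intro x hx
        obtain ⟨u, v, huv, hu, hv⟩ := ZMod.exists_pow_dvd_of_sq_eq hp hx hy
        push_cast
        rcases le_or_gt (k - m) u with h | h
        · exact Or.inl ((pow_dvd_pow _ h).trans hu)
        rcases le_or_gt (k - m) v with h' | h'
        · exact Or.inr ((pow_dvd_pow _ h').trans hv)
        exfalso
        apply hm
        have h2 : (p : ℤ) ^ (m + 1) ∣ 2 * y.val := by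
          have := dvd_sub ((pow_dvd_pow (p : ℤ) (by omega : m + 1 ≤ v)).trans hv)
            ((pow_dvd_pow (p : ℤ) (by omega : m + 1 ≤ u)).trans hu)
          rwa [show (x.val + y.val - (x.val - y.val) : ℤ) = 2 * y.val by ring] at this
        have hc : IsCoprime ((p : ℤ) ^ (m + 1)) 2 := by
          apply IsCoprime.pow_left
          exact_mod_cast Nat.isCoprime_iff_coprime.mpr
            ((Nat.coprime_primes hp Nat.prime_two).mpr (by omega))
        exact hc.dvd_of_dvd_mul_left h2)
    calc _ ≤ (2 * p ^ m) ^ 2 := Nat.pow_le_pow_left hb 2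
      _ = 4 * p ^ (m * 2) := by rw [mul_pow, ← pow_mul]; norm_num
      _ ≤ p * p ^ (m * 2) := Nat.mul_le_mul_right _ (by omega)
      _ = p ^ (m * 2 + 1) := by ring
      _ ≤ p ^ k := Nat.pow_le_pow_right hp.pos (by omega)

theorem ncard_sqrt_mul_of_coprime {a b : ℕ} (hab : a.Coprime b) (c : ℤ) :
    {x : ZMod (a * b) | x ^ 2 = (c : ZMod (a * b))}.ncard =
      {x : ZMod a | x ^ 2 = (c : ZMod a)}.ncard * {x : ZMod b | x ^ 2 = (c : ZMod b)}.ncard := by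
  rw [← Set.ncard_prod, ← Set.ncard_preimage_of_injective_subset_range
    (ZMod.chineseRemainder hab).injective (by simp [(ZMod.chineseRemainder hab).surjective.range_eq])]
  congr 1
  ext x
  rw [Set.mem_preimage, Set.mem_prod, Set.mem_ofPred_eq, Set.mem_ofPred_eq, Set.mem_ofPred_eq,
    ← (ZMod.chineseRemainder hab).injective.eq_iff, map_pow, map_intCast, Prod.ext_iff]
  simp

theorem ncard_sqrt_sq_le (f : ℕ) (hf : 0 < f) (c : ℤ) :
    {x : ZMod f | x ^ 2 = (c : ZMod f)}.ncard ^ 2 ≤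
      (if 2 ∣ f then 4 else 1) * (if 3 ∣ f then 4 else 1) * f := by
  induction f using Nat.recOnPosPrimePosCoprime with
  | zero => omega
  | one =>
    have : {x : ZMod 1 | x ^ 2 = (c : ZMod 1)}.ncard ≤ 1 :=
      Set.ncard_le_one_of_subsingleton _
    simpa using this
  | prime_pow p k hp hk =>
    by_cases h5 : 5 ≤ p
    · refine (ncard_sqrt_prime_pow_sq_le hp h5 k c).trans (Nat.le_mul_of_pos_left _ ?_)
      positivity
    · refine (ncard_sqrt_prime_pow_sq_le_four_mul hp k c).trans (Nat.mul_le_mul_right _ ?_)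
      have h23 : p = 2 ∨ p = 3 := by
        have := hp.two_le
        interval_cases p <;> first | omega | (exfalso; revert hp; norm_num)
      rcases h23 with rfl | rfl
      · rw [if_pos (dvd_pow_self 2 hk.ne')]
        split_ifs <;> norm_num
      · rw [if_pos (dvd_pow_self 3 hk.ne')]
        split_ifs <;> norm_num
  | coprime a b ha hb hab iha ihb =>
    have hw : ∀ q : ℕ, q.Prime → (if q ∣ a * b then 4 else 1) =
        (if q ∣ a then 4 else 1) * (if q ∣ b then 4 else 1) := by
      intro q hq
      have hnot : ¬ (q ∣ a ∧ q ∣ b) := fun h => Nat.not_coprime_of_dvd_of_dvd hq.one_lt h.1 h.2 hab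
      simp only [hq.dvd_mul]
      by_cases h1 : q ∣ a <;> by_cases h2 : q ∣ b <;> simp_all
    rw [ncard_sqrt_mul_of_coprime hab, hw 2 Nat.prime_two, hw 3 Nat.prime_three, mul_pow]
    refine (Nat.mul_le_mul (iha (by omega)) (ihb (by omega))).trans (le_of_eq ?_)
    ring

/-- Lemma 2 (`bound quad cong soln count`): the number of a ∈ ℤ/fℤ with D_N(a) ≡ 0 (mod f)
is at most 8√f. -/
theorem count_roots_DN_le (N f : ℕ) (hN : 0 < N) (hf : 0 < f) :
    (Nat.card {a : ZMod f //
        a ^ 2 - 2 * ((N : ZMod f) + 1) * a + ((N : ZMod f) - 1) ^ 2 = 0} : ℝ)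
      ≤ 8 * Real.sqrt f := by
  have hcard : Nat.card {a : ZMod f //
      a ^ 2 - 2 * ((N : ZMod f) + 1) * a + ((N : ZMod f) - 1) ^ 2 = 0} =
      {x : ZMod f | x ^ 2 = ((4 * N : ℤ) : ZMod f)}.ncard := by
    rw [← Nat.card_coe_set_eq]
    refine Nat.card_congr ((Equiv.subRight ((N : ZMod f) + 1)).subtypeEquiv fun a => ?_)
    rw [Set.mem_ofPred_eq, ← sub_eq_zero (b := ((4 * N : ℤ) : ZMod f)), Equiv.subRight_apply]
    push_cast
    ring_nf
  have hle : {x : ZMod f | x ^ 2 = ((4 * N : ℤ) : ZMod f)}.ncard ^ 2 ≤ 64 * f := by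
    refine (ncard_sqrt_sq_le f hf _).trans (Nat.mul_le_mul_right _ ?_)
    split_ifs <;> norm_num
  rw [hcard]
  rw [← sq_le_sq₀ (by positivity) (by positivity), mul_pow, Real.sq_sqrt (Nat.cast_nonneg f)]
  norm_num
  exact_mod_cast hle
end
end

section
/- Let N be a positive integer, ℓ a prime, and e ≥ 1. Then the number of residues a ∈ ℤ/ℓ^eℤ with D_N(a) ≡ 0 (mod ℓ^e) is at most max{ℓ^⌊e/2⌋, 2·ℓ^{(e−1)/2}} if ℓ is odd, and at most max{2^⌊e/2⌋, 4·2^{(e−1)/2}} if ℓ = 2. -/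
open scoped Classical BigOperators

noncomputable section

theorem Prime.pow_sub_dvd_of_pow_dvd_mul {p : ℤ} (hp : Prime p) {d e : ℕ} {a b : ℤ}
    (hab : p ^ e ∣ a * b) (ha : ¬ p ^ (d + 1) ∣ a) : p ^ (e - d) ∣ b := by
  induction d generalizing e a with
  | zero => exact hp.pow_dvd_of_dvd_mul_left e (by simpa using ha) hab
  | succ d ih =>
    by_cases hpa : p ∣ a
    · obtain ⟨c, rfl⟩ := hpa
      cases e with
      | zero => simp
      | succ e =>
        rw [Nat.add_sub_add_right]
        refine ih (a := c) ?_ fun h => ha ?_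
        · rw [pow_succ', mul_assoc] at hab
          exact (mul_dvd_mul_iff_left hp.ne_zero).1 hab
        · rw [pow_succ' p (d + 1)]
          exact mul_dvd_mul_left p h
    · exact (pow_dvd_pow p (Nat.sub_le _ _)).trans (hp.pow_dvd_of_dvd_mul_left e hpa hab)

theorem ZMod.card_filter_pow_dvd_sub_le {p e k : ℕ} [NeZero (p ^ e)] (hk : k ≤ e)
    (c : ZMod (p ^ e)) :
    (Finset.univ.filter fun x : ZMod (p ^ e) => (p : ZMod (p ^ e)) ^ k ∣ x - c).card
      ≤ p ^ (e - k) := by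
  have hp : 0 < p ^ (e - k) := by
    have h : p ^ k * p ^ (e - k) ≠ 0 := by
      rw [← pow_add, Nat.add_sub_cancel' hk]
      exact NeZero.ne _
    exact Nat.pos_of_ne_zero (right_ne_zero_of_mul h)
  have hzero : (p : ZMod (p ^ e)) ^ k * (p : ZMod (p ^ e)) ^ (e - k) = 0 := by
    rw [← pow_add, Nat.add_sub_cancel' hk]
    exact_mod_cast ZMod.natCast_self (p ^ e)
  calc _ ≤ ((Finset.range (p ^ (e - k))).image
        fun t : ℕ => c + (p : ZMod (p ^ e)) ^ k * (t : ZMod (p ^ e))).card := by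
        refine Finset.card_le_card fun x hx => ?_
        obtain ⟨y, hy⟩ := (Finset.mem_filter.1 hx).2
        refine Finset.mem_image.2
          ⟨y.val % p ^ (e - k), Finset.mem_range.2 (Nat.mod_lt _ hp), ?_⟩
        have hval : y = ((y.val % p ^ (e - k) : ℕ) : ZMod (p ^ e))
            + (p : ZMod (p ^ e)) ^ (e - k) * ((y.val / p ^ (e - k) : ℕ) : ZMod (p ^ e)) := by
          conv_lhs => rw [← ZMod.natCast_zmod_val y, ← Nat.mod_add_div y.val (p ^ (e - k))]
          push_cast
          rfl
        linear_combination -hy - (p : ZMod (p ^ e)) ^ k * hval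
          - ((y.val / p ^ (e - k) : ℕ) : ZMod (p ^ e)) * hzero
    _ ≤ _ := Finset.card_image_le.trans (Finset.card_range _).le

theorem ZMod.pow_dvd_intCast {p e k : ℕ} {x : ℤ} (h : (p : ℤ) ^ k ∣ x) :
    (p : ZMod (p ^ e)) ^ k ∣ (x : ZMod (p ^ e)) := by
  simpa using map_dvd (Int.castRingHom (ZMod (p ^ e))) h

theorem ZMod.card_filter_sq_eq_zero_le {p e : ℕ} (hp : p.Prime) [NeZero (p ^ e)] (he : 1 ≤ e) :
    (Finset.univ.filter fun x : ZMod (p ^ e) => x ^ 2 = 0).card ≤ p ^ (e / 2) := by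
  have hle : (e - 1) / 2 + 1 ≤ e := by omega
  have hexp : e - ((e - 1) / 2 + 1) = e / 2 := by omega
  rw [← hexp]
  refine (Finset.card_le_card fun x hx => ?_).trans (ZMod.card_filter_pow_dvd_sub_le hle 0)
  obtain ⟨X, rfl⟩ := ZMod.intCast_surjective x
  have hX : (p : ℤ) ^ e ∣ X * X := by
    have h := (Finset.mem_filter.1 hx).2
    have h0 : ((X * X : ℤ) : ZMod (p ^ e)) = 0 := by
      push_cast
      linear_combination h
    exact_mod_cast (ZMod.intCast_zmod_eq_zero_iff_dvd _ (p ^ e)).1 h0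
  refine Finset.mem_filter.2 ⟨Finset.mem_univ _, ?_⟩
  rw [sub_zero]
  refine ZMod.pow_dvd_intCast ?_
  by_contra hn
  exact hn ((pow_dvd_pow _ (by omega)).trans
    ((Nat.prime_iff_prime_int.1 hp).pow_sub_dvd_of_pow_dvd_mul hX hn))

theorem ZMod.card_filter_sq_eq_sq_le {p e d : ℕ} (hp : p.Prime) [NeZero (p ^ e)] (hd : d ≤ e)
    {y : ℤ} (hy : ¬ (p : ℤ) ^ (d + 1) ∣ 2 * y) :
    (Finset.univ.filter fun x : ZMod (p ^ e) => x ^ 2 = (y : ZMod (p ^ e)) ^ 2).card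
      ≤ 2 * p ^ d := by
  have hcard := fun c : ZMod (p ^ e) => ZMod.card_filter_pow_dvd_sub_le (Nat.sub_le e d) c
  rw [Nat.sub_sub_self hd] at hcard
  rw [two_mul]
  refine (Finset.card_le_card fun x hx => ?_).trans <| (Finset.card_union_le _ _).trans
    (add_le_add (hcard (y : ZMod (p ^ e))) (hcard (-(y : ZMod (p ^ e)))))
  obtain ⟨X, rfl⟩ := ZMod.intCast_surjective x
  have hX : (p : ℤ) ^ e ∣ (X - y) * (X + y) := by
    have h := (Finset.mem_filter.1 hx).2
    have h0 : (((X - y) * (X + y) : ℤ) : ZMod (p ^ e)) = 0 := by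
      push_cast
      linear_combination h
    exact_mod_cast (ZMod.intCast_zmod_eq_zero_iff_dvd _ (p ^ e)).1 h0
  have hp' := Nat.prime_iff_prime_int.1 hp
  simp only [Finset.mem_union, Finset.mem_filter, Finset.mem_univ, true_and]
  by_cases hA : (p : ℤ) ^ (d + 1) ∣ X - y
  · have hB : ¬ (p : ℤ) ^ (d + 1) ∣ X + y := fun hB => hy <| by
      have h := dvd_sub hB hA
      rwa [show X + y - (X - y) = 2 * y by ring] at h
    rw [mul_comm] at hX
    left
    simpa using ZMod.pow_dvd_intCast (e := e) (hp'.pow_sub_dvd_of_pow_dvd_mul hX hB)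
  · right
    simpa using ZMod.pow_dvd_intCast (e := e) (hp'.pow_sub_dvd_of_pow_dvd_mul hX hA)

theorem ZMod.card_filter_sq_eq_le {p e : ℕ} (hp : p.Prime) [NeZero (p ^ e)] (he : 1 ≤ e)
    (n : ZMod (p ^ e)) :
    (Finset.univ.filter fun x : ZMod (p ^ e) => x ^ 2 = n).card
      ≤ max (p ^ (e / 2)) ((if p = 2 then 4 else 2) * p ^ ((e - 1) / 2)) := by
  by_cases hn : ∃ y : ZMod (p ^ e), y ^ 2 = n
  swap
  · rw [Finset.filter_false_of_mem fun x _ hx => hn ⟨x, hx⟩]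
    simp
  obtain ⟨x, rfl⟩ := hn
  obtain ⟨y, rfl⟩ := ZMod.intCast_surjective x
  by_cases hy : (p : ℤ) ^ ((e - 1) / 2 + 1) ∣ y
  · have h0 : (y : ZMod (p ^ e)) ^ 2 = 0 := by
      have h : ((p ^ e : ℕ) : ℤ) ∣ y ^ 2 := by
        push_cast
        refine (pow_dvd_pow (p : ℤ) ?_).trans (pow_mul (p : ℤ) _ 2 ▸ pow_dvd_pow_of_dvd hy 2)
        omega
      exact_mod_cast (ZMod.intCast_zmod_eq_zero_iff_dvd (y ^ 2) (p ^ e)).2 h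
    rw [h0]
    exact le_max_of_le_left (ZMod.card_filter_sq_eq_zero_le hp he)
  · refine le_max_of_le_right ?_
    split_ifs with h2
    · subst h2
      refine (ZMod.card_filter_sq_eq_sq_le hp (d := (e - 1) / 2 + 1) (by omega)
        fun h => hy ?_).trans (by rw [pow_succ]; omega)
      rw [pow_succ' _ ((e - 1) / 2 + 1)] at h
      exact (mul_dvd_mul_iff_left two_ne_zero).1 h
    · refine ZMod.card_filter_sq_eq_sq_le hp (by omega) fun h => hy ?_
      refine (Nat.prime_iff_prime_int.1 hp).pow_dvd_of_dvd_mul_left _ (fun h' => h2 ?_) h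
      exact (Nat.prime_dvd_prime_iff_eq hp Nat.prime_two).1 (by exact_mod_cast h')

theorem pow_half_pred_le_rpow {p : ℝ} (hp : 1 ≤ p) {e : ℕ} (he : 1 ≤ e) :
    p ^ ((e - 1) / 2) ≤ p ^ (((e : ℝ) - 1) / 2) := by
  rw [← Real.rpow_natCast]
  refine Real.rpow_le_rpow_of_exponent_le hp (Nat.cast_div_le.trans ?_)
  push_cast [Nat.cast_sub he]
  exact le_rfl

/-- the prime power modulus bound in the proof of Lemma 2:
#{a ∈ ℤ/ℓ^eℤ : D_N(a) ≡ 0 (mod ℓ^e)} ≤ max{ℓ^⌊e/2⌋, 2ℓ^{(e−1)/2}} for odd ℓ, and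
≤ max{2^⌊e/2⌋, 4·2^{(e−1)/2}} for ℓ = 2. -/
theorem count_roots_DN_prime_pow_le (N ℓ e : ℕ) (hN : 0 < N) (hℓ : ℓ.Prime) (he : 1 ≤ e) :
    (Nat.card {a : ZMod (ℓ ^ e) //
        a ^ 2 - 2 * ((N : ZMod (ℓ ^ e)) + 1) * a + ((N : ZMod (ℓ ^ e)) - 1) ^ 2 = 0} : ℝ)
      ≤ if ℓ = 2 then max ((2 : ℝ) ^ (e / 2)) (4 * (2 : ℝ) ^ (((e : ℝ) - 1) / 2))
        else max ((ℓ : ℝ) ^ (e / 2)) (2 * (ℓ : ℝ) ^ (((e : ℝ) - 1) / 2)) := by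
  have : NeZero (ℓ ^ e) := ⟨pow_ne_zero e hℓ.ne_zero⟩
  have hcard : Nat.card {a : ZMod (ℓ ^ e) //
      a ^ 2 - 2 * ((N : ZMod (ℓ ^ e)) + 1) * a + ((N : ZMod (ℓ ^ e)) - 1) ^ 2 = 0}
      ≤ (Finset.univ.filter fun x : ZMod (ℓ ^ e) => x ^ 2 = 4 * N).card := by
    rw [Nat.card_eq_fintype_card, Fintype.card_subtype]
    refine Finset.card_le_card_of_injOn (fun a => a - (N + 1)) (fun a ha => ?_)
      sub_left_injective.injOn
    have h := (Finset.mem_filter.1 ha).2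
    refine Finset.mem_filter.2 ⟨Finset.mem_univ _, ?_⟩
    linear_combination h
  have hbound : (Nat.card {a : ZMod (ℓ ^ e) //
      a ^ 2 - 2 * ((N : ZMod (ℓ ^ e)) + 1) * a + ((N : ZMod (ℓ ^ e)) - 1) ^ 2 = 0} : ℝ)
      ≤ max ((ℓ : ℝ) ^ (e / 2)) ((if ℓ = 2 then 4 else 2) * (ℓ : ℝ) ^ ((e - 1) / 2)) := by
    exact_mod_cast hcard.trans (ZMod.card_filter_sq_eq_le hℓ he _)
  have hrpow := pow_half_pred_le_rpow (p := ℓ) (by exact_mod_cast hℓ.one_le) he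
  refine hbound.trans ?_
  split_ifs with h2
  · subst h2
    exact max_le_max le_rfl (mul_le_mul_of_nonneg_left hrpow (by norm_num))
  · exact max_le_max le_rfl (mul_le_mul_of_nonneg_left hrpow (by norm_num))
end
end

section
/- Suppose N and f are odd positive integers, n is a positive integer, and a ≡ 1 (mod 4). Let ℓ be an odd prime dividing nf, and suppose ℓ ∤ 4N + af². Then #C_N^{(ℓ)}(a,n,f) = 1 + ((4N+af²)/ℓ) if ℓ ∤ (N−1)² − af², and #C_N^{(ℓ)}(a,n,f) = 1 if ℓ | (N−1)² − af², where (·/ℓ) is the Legendre symbol. -/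
open scoped Classical BigOperators

noncomputable section

/-- the modulus ℓ^e with e = ν_ℓ(4nf²) -/
def CNlMod (n f ℓ : ℕ) : ℕ := ℓ ^ ((4 * n * f ^ 2).factorization ℓ)

/-- #C_N^{(ℓ)}(a,n,f): the number of z ∈ (ℤ/ℓ^eℤ)^*, e = ν_ℓ(4nf²),
with D_N(z) ≡ af² (mod ℓ^e) -/
def CNl (N a n f ℓ : ℕ) : ℕ :=
  Nat.card {z : (ZMod (CNlMod n f ℓ))ˣ //
    ((z : ZMod (CNlMod n f ℓ))) ^ 2
        - 2 * ((N : ZMod (CNlMod n f ℓ)) + 1) * ((z : ZMod (CNlMod n f ℓ)))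
        + ((N : ZMod (CNlMod n f ℓ)) - 1) ^ 2
      = (a : ZMod (CNlMod n f ℓ)) * (f : ZMod (CNlMod n f ℓ)) ^ 2}

/-- Lifting a square root of `s` modulo an odd prime to every power of that prime. -/
theorem exists_sq_sub_dvd_prime_pow {p : ℕ} (hp : p.Prime) (hodd : Odd p) {s x : ℤ}
    (hx : (p : ℤ) ∣ x ^ 2 - s) (hpx : ¬ (p : ℤ) ∣ x) (k : ℕ) :
    ∃ w : ℤ, (p : ℤ) ∣ w - x ∧ (p : ℤ) ^ (k + 1) ∣ w ^ 2 - s := by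
  have hpZ : Prime (p : ℤ) := Nat.prime_iff_prime_int.mp hp
  have h2 : ¬ (p : ℤ) ∣ 2 := by
    intro h
    have h' : p ∣ 2 := by exact_mod_cast h
    rcases (Nat.dvd_prime Nat.prime_two).mp h' with h | h
    · exact hp.one_lt.ne' h
    · subst h
      exact absurd hodd (by decide)
  induction k with
  | zero => exact ⟨x, by simp, by simpa using hx⟩
  | succ k ih =>
    obtain ⟨w, hwx, m, hm⟩ := ih
    have hw : ¬ (p : ℤ) ∣ w := fun h => hpx (by simpa using dvd_sub h hwx)
    have hco : IsCoprime (p : ℤ) (2 * w) := (hpZ.coprime_iff_not_dvd).mpr fun h =>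
      (hpZ.dvd_or_dvd h).elim h2 hw
    obtain ⟨u, v, huv⟩ := hco
    refine ⟨w - p ^ (k + 1) * (v * m), ?_, ?_⟩
    · have : w - p ^ (k + 1) * (v * m) - x = (w - x) - p * (p ^ k * (v * m)) := by ring
      rw [this]
      exact dvd_sub hwx (dvd_mul_right _ _)
    · refine ⟨u * m + p ^ k * (v * m) ^ 2, ?_⟩
      linear_combination hm - (p : ℤ) ^ (k + 1) * m * huv

/-- If `p` does not divide both `a` and `b`, a power of `p` dividing `a * b` divides `a` or `b`. -/
theorem Prime.pow_dvd_or_pow_dvd_of_dvd_mul {p a b : ℤ} (hp : Prime p) {k : ℕ}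
    (h : p ^ k ∣ a * b) (hab : ¬ (p ∣ a ∧ p ∣ b)) : p ^ k ∣ a ∨ p ^ k ∣ b := by
  by_cases ha : p ∣ a
  · have hb : IsCoprime p b := (hp.coprime_iff_not_dvd).mpr fun hb => hab ⟨ha, hb⟩
    exact Or.inl (hb.pow_left.dvd_of_dvd_mul_right h)
  · have ha : IsCoprime p a := (hp.coprime_iff_not_dvd).mpr ha
    exact Or.inr (ha.pow_left.dvd_of_dvd_mul_left h)

theorem ZMod.isUnit_intCast_prime_pow_iff {p : ℕ} (hp : p.Prime) {k : ℕ} (hk : k ≠ 0) (t : ℤ) :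
    IsUnit (t : ZMod (p ^ k)) ↔ ¬ (p : ℤ) ∣ t := by
  rw [ZMod.coe_int_isUnit_iff_isCoprime, Nat.cast_pow,
    IsCoprime.pow_left_iff (Nat.pos_of_ne_zero hk),
    (Nat.prime_iff_prime_int.mp hp).coprime_iff_not_dvd]

theorem CNl_eq_ncard (N a n f ℓ : ℕ) :
    CNl N a n f ℓ = Set.ncard {z : ZMod (CNlMod n f ℓ) | IsUnit z ∧
      (z - ((N + 1 : ℤ) : ZMod (CNlMod n f ℓ))) ^ 2 =
        ((4 * N + a * f ^ 2 : ℤ) : ZMod (CNlMod n f ℓ))} := by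
  rw [CNl, ← Nat.card_coe_set_eq]
  refine Nat.card_congr (Equiv.ofBijective (fun z => ⟨(z.1 : ZMod (CNlMod n f ℓ)),
    z.1.isUnit, ?_⟩) ⟨?_, ?_⟩)
  · have := z.2
    push_cast
    linear_combination this
  · intro z z' h
    exact Subtype.ext (Units.ext (congrArg Subtype.val h))
  · rintro ⟨z, ⟨u, rfl⟩, hz⟩
    refine ⟨⟨u, ?_⟩, rfl⟩
    push_cast at hz
    linear_combination hz

/-- Given a square root `w` of `s` modulo `p ^ k` with `p ∤ 2 * w`, the solutions of
`(t - c) ^ 2 = s` are `c + w` and `c - w`. -/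
theorem ZMod.sub_sq_eq_iff_of_prime_pow {p : ℕ} (hp : p.Prime) {k : ℕ} {s w c : ℤ}
    (hw : (p : ℤ) ^ k ∣ w ^ 2 - s) (h2w : ¬ (p : ℤ) ∣ 2 * w) (z : ZMod (p ^ k)) :
    (z - (c : ZMod (p ^ k))) ^ 2 = (s : ZMod (p ^ k)) ↔
      z = ((c + w : ℤ) : ZMod (p ^ k)) ∨ z = ((c - w : ℤ) : ZMod (p ^ k)) := by
  have hs : (w : ZMod (p ^ k)) ^ 2 = s := by
    have h := (ZMod.intCast_zmod_eq_zero_iff_dvd (w ^ 2 - s) (p ^ k)).mpr (by exact_mod_cast hw)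
    push_cast at h
    exact sub_eq_zero.mp h
  constructor
  · intro h
    obtain ⟨t, rfl⟩ := ZMod.intCast_surjective z
    have hd : (p : ℤ) ^ k ∣ (t - (c + w)) * (t - (c - w)) := by
      have h0 : (((t - (c + w)) * (t - (c - w)) : ℤ) : ZMod (p ^ k)) = 0 := by
        push_cast
        linear_combination h - hs
      exact_mod_cast (ZMod.intCast_zmod_eq_zero_iff_dvd _ _).mp h0
    have hzero : ∀ r : ℤ, (p : ℤ) ^ k ∣ t - r → (t : ZMod (p ^ k)) = (r : ZMod (p ^ k)) := by
      intro r hr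
      have h := (ZMod.intCast_zmod_eq_zero_iff_dvd (t - r) (p ^ k)).mpr (by exact_mod_cast hr)
      push_cast at h
      exact sub_eq_zero.mp h
    refine ((Nat.prime_iff_prime_int.mp hp).pow_dvd_or_pow_dvd_of_dvd_mul hd ?_).imp
      (hzero _) (hzero _)
    rintro ⟨h1, h2⟩
    exact h2w ((by ring : (t - (c - w)) - (t - (c + w)) = 2 * w) ▸ dvd_sub h2 h1)
  · rintro (rfl | rfl) <;> push_cast <;> linear_combination hs

/-- Lemma 3 (`counting solutions`), first case: ℓ an odd prime dividing nf with
ℓ ∤ 4N + af². -/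
theorem CNl_ell_not_dvd_disc (N f n a ℓ : ℕ) (hN : Odd N) (hN0 : 0 < N) (hf : Odd f)
    (hf0 : 0 < f) (hn : 0 < n) (ha : a % 4 = 1) (hℓ : ℓ.Prime) (hℓodd : Odd ℓ)
    (hdvd : ℓ ∣ n * f) (hnd : ¬ (ℓ : ℤ) ∣ (4 * (N : ℤ) + (a : ℤ) * (f : ℤ) ^ 2)) :
    (CNl N a n f ℓ : ℤ) =
      if (ℓ : ℤ) ∣ (((N : ℤ) - 1) ^ 2 - (a : ℤ) * (f : ℤ) ^ 2) then 1
      else 1 + jacobiSym (4 * (N : ℤ) + (a : ℤ) * (f : ℤ) ^ 2) ℓ := by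
  have hp : Prime (ℓ : ℤ) := Nat.prime_iff_prime_int.mp hℓ
  have : Fact ℓ.Prime := ⟨hℓ⟩
  have h2 : ¬ (ℓ : ℤ) ∣ 2 := by
    intro h
    have h' : ℓ ∣ 2 := by exact_mod_cast h
    rcases (Nat.dvd_prime Nat.prime_two).mp h' with h | h
    · exact hℓ.one_lt.ne' h
    · subst h
      exact absurd hℓodd (by decide)
  rw [CNl_eq_ncard]
  unfold CNlMod
  have hk : (4 * n * f ^ 2).factorization ℓ ≠ 0 := by
    have hd : ℓ ∣ 4 * n * f ^ 2 := hdvd.trans ⟨4 * f, by ring⟩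
    exact (hℓ.factorization_pos_of_dvd (by positivity) hd).ne'
  generalize (4 * n * f ^ 2).factorization ℓ = k at hk ⊢
  have hprod : ((N : ℤ) - 1) ^ 2 - (a : ℤ) * (f : ℤ) ^ 2 =
      ((N : ℤ) + 1) ^ 2 - (4 * (N : ℤ) + (a : ℤ) * (f : ℤ) ^ 2) := by ring
  rw [hprod]
  generalize 4 * (N : ℤ) + (a : ℤ) * (f : ℤ) ^ 2 = s at hnd ⊢
  generalize (N : ℤ) + 1 = c
  have hroot : ∀ w : ℤ, (ℓ : ℤ) ∣ w ^ 2 - s → ¬ (ℓ : ℤ) ∣ w := fun w hw h =>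
    hnd (by simpa using dvd_sub (dvd_pow h two_ne_zero) hw)
  have hdouble : ∀ w : ℤ, (ℓ : ℤ) ∣ w ^ 2 - s → ¬ (ℓ : ℤ) ∣ 2 * w := fun w hw h =>
    (hp.dvd_or_dvd h).elim h2 (hroot w hw)
  have hlift : ∀ x : ℤ, (ℓ : ℤ) ∣ x ^ 2 - s →
      ∃ w : ℤ, (ℓ : ℤ) ∣ w - x ∧ (ℓ : ℤ) ^ k ∣ w ^ 2 - s := by
    intro x hx
    obtain ⟨j, rfl⟩ := Nat.exists_eq_succ_of_ne_zero hk
    exact exists_sq_sub_dvd_prime_pow hℓ hℓodd hx (hroot x hx) j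
  split_ifs with hc
  · obtain ⟨w, hwc, hw⟩ := hlift c hc
    have h2w := hdouble w ((dvd_pow_self _ hk).trans hw)
    have hset : {z : ZMod (ℓ ^ k) | IsUnit z ∧ (z - (c : ZMod (ℓ ^ k))) ^ 2 = s} =
        {((c + w : ℤ) : ZMod (ℓ ^ k))} := by
      ext z
      rw [Set.mem_ofPred_eq, Set.mem_singleton_iff, ZMod.sub_sq_eq_iff_of_prime_pow hℓ hw h2w]
      constructor
      · rintro ⟨hu, rfl | rfl⟩
        · rfl
        · rw [ZMod.isUnit_intCast_prime_pow_iff hℓ hk] at hu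
          exact absurd ((dvd_sub_comm).mp hwc) hu
      · rintro rfl
        refine ⟨(ZMod.isUnit_intCast_prime_pow_iff hℓ hk _).mpr fun h => h2w ?_, Or.inl rfl⟩
        exact (by ring : (c + w) + (w - c) = 2 * w) ▸ dvd_add h hwc
    rw [hset, Set.ncard_singleton, Nat.cast_one]
  · rw [← jacobiSym.legendreSym.to_jacobiSym]
    have hs0 : (s : ZMod ℓ) ≠ 0 := by
      rwa [Ne, ZMod.intCast_zmod_eq_zero_iff_dvd]
    rcases legendreSym.eq_one_or_neg_one ℓ hs0 with hs | hs
    · obtain ⟨y, hy⟩ := (legendreSym.eq_one_iff ℓ hs0).mp hs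
      obtain ⟨x, rfl⟩ := ZMod.intCast_surjective y
      have hx : (ℓ : ℤ) ∣ x ^ 2 - s := by
        rw [← ZMod.intCast_zmod_eq_zero_iff_dvd]
        push_cast
        linear_combination -hy
      obtain ⟨w, -, hw⟩ := hlift x hx
      have hwℓ := (dvd_pow_self _ hk).trans hw
      have h2w := hdouble w hwℓ
      have hcw : ¬ (ℓ : ℤ) ∣ (c + w) * (c - w) := fun h => hc <|
        (by ring : (c + w) * (c - w) + (w ^ 2 - s) = c ^ 2 - s) ▸ dvd_add h hwℓ
      have hset : {z : ZMod (ℓ ^ k) | IsUnit z ∧ (z - (c : ZMod (ℓ ^ k))) ^ 2 = s} =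
          {((c + w : ℤ) : ZMod (ℓ ^ k)), ((c - w : ℤ) : ZMod (ℓ ^ k))} := by
        ext z
        rw [Set.mem_ofPred_eq, Set.mem_insert_iff, Set.mem_singleton_iff,
          ZMod.sub_sq_eq_iff_of_prime_pow hℓ hw h2w, and_iff_right_iff_imp]
        rintro (rfl | rfl) <;> rw [ZMod.isUnit_intCast_prime_pow_iff hℓ hk]
        · exact fun h => hcw (h.mul_right _)
        · exact fun h => hcw (h.mul_left _)
      have hne : ((c + w : ℤ) : ZMod (ℓ ^ k)) ≠ ((c - w : ℤ) : ZMod (ℓ ^ k)) := by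
        rw [Ne, ZMod.intCast_eq_intCast_iff_dvd_sub, Nat.cast_pow]
        intro h
        exact h2w ((by ring : -((c - w) - (c + w)) = 2 * w) ▸
          dvd_neg.mpr ((dvd_pow_self _ hk).trans h))
      rw [hset, Set.ncard_pair hne, hs]
      norm_num
    · have hset : {z : ZMod (ℓ ^ k) | IsUnit z ∧ (z - (c : ZMod (ℓ ^ k))) ^ 2 = s} = ∅ := by
        refine Set.eq_empty_of_forall_notMem ?_
        rintro z ⟨-, hz⟩
        refine (legendreSym.eq_neg_one_iff ℓ).mp hs ?_
        have h := congrArg (ZMod.castHom (dvd_pow_self ℓ hk) (ZMod ℓ)) hz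
        rw [map_pow, map_intCast] at h
        exact ⟨_, h.symm.trans (sq _)⟩
      rw [hset, Set.ncard_empty, hs]
      norm_num
end
end

section
/- Suppose N and f are odd positive integers, n is a positive integer, and a ≡ 1 (mod 4). Let ℓ be an odd prime dividing nf, set e = ν_ℓ(nf²), and suppose ℓ | 4N + af² with s = ν_ℓ(4N + af²). Then #C_N^{(ℓ)}(a,n,f) = 2·((N+1)/ℓ)²·ℓ^{s/2} if 1 ≤ s < e, s is even and (((4N+af²)/ℓ^s)/ℓ) = 1; #C_N^{(ℓ)}(a,n,f) = ((N+1)/ℓ)²·ℓ^{⌊e/2⌋} if s ≥ e; and #C_N^{(ℓ)}(a,n,f) = 0 otherwise. Here (·/ℓ) is the Legendre symbol. -/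
open scoped Classical BigOperators

noncomputable section

theorem ZMod.natCard_subtype_eq_card_filter (m : ℕ) [NeZero m] (P : ZMod m → Prop) :
    Nat.card {w : ZMod m // P w} = ((Finset.Ico (0 : ℤ) m).filter fun x : ℤ => P x).card := by
  rw [Nat.card_eq_fintype_card, Fintype.card_subtype]
  refine Finset.card_bij (fun w _ => (w.val : ℤ)) ?_ ?_ ?_
  · intro w hw
    simp only [Finset.mem_filter, Finset.mem_univ, true_and, Finset.mem_Ico] at hw ⊢
    refine ⟨⟨by positivity, by exact_mod_cast w.val_lt⟩, ?_⟩
    simpa using hw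
  · intro w _ w' _ h
    exact ZMod.val_injective m (by exact_mod_cast h)
  · intro x hx
    simp only [Finset.mem_filter, Finset.mem_Ico] at hx
    refine ⟨(x : ZMod m), by simpa using hx.2, ?_⟩
    rw [ZMod.val_intCast, Int.emod_eq_of_lt hx.1.1 hx.1.2]

theorem Int.card_Ico_filter_dvd_sub (v : ℤ) {q k : ℕ} (hq : 0 < q) :
    ((Finset.Ico (0 : ℤ) ((q * k : ℕ) : ℤ)).filter fun x => (q : ℤ) ∣ x - v).card = k := by
  have hq' : (0 : ℤ) < q := by exact_mod_cast hq
  have h := Int.Ico_filter_modEq_card 0 ((q * k : ℕ) : ℤ) hq' v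
  have hset : ((Finset.Ico (0 : ℤ) ((q * k : ℕ) : ℤ)).filter fun x => (q : ℤ) ∣ x - v) =
      (Finset.Ico (0 : ℤ) ((q * k : ℕ) : ℤ)).filter fun x => x ≡ v [ZMOD q] := by
    refine Finset.filter_congr fun x _ => ?_
    rw [Int.modEq_comm, Int.modEq_iff_dvd]
  rw [hset]
  have hr : (((q * k : ℕ) : ℤ) - v) / ((q : ℤ) : ℚ) = (0 - v) / ((q : ℤ) : ℚ) + ((k : ℤ) : ℚ) := by
    have : (q : ℚ) ≠ 0 := by positivity
    push_cast
    field_simp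
    ring
  rw [Int.cast_natCast q, Int.cast_natCast (q * k)] at h
  rw [Int.cast_natCast q, Int.cast_natCast (q * k)] at hr
  rw [hr, Int.cast_zero, Int.ceil_add_intCast] at h
  simpa using h

section

variable {p : ℕ}

theorem Int.pow_succ_dvd_of_pow_dvd_sq (hp : p.Prime) {t : ℕ} {w : ℤ}
    (h : (p : ℤ) ^ (2 * t + 1) ∣ w ^ 2) : (p : ℤ) ^ (t + 1) ∣ w := by
  have hp0 : (p : ℤ) ≠ 0 := by exact_mod_cast hp.ne_zero
  have h1 : (p : ℤ) ^ t ∣ w := by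
    rw [← Int.pow_dvd_pow_iff two_ne_zero, ← pow_mul]
    exact (pow_dvd_pow _ (by omega)).trans h
  obtain ⟨u, rfl⟩ := h1
  have h2 : (p : ℤ) ^ (2 * t + 1) = ((p : ℤ) ^ t) ^ 2 * p := by ring
  rw [h2, mul_pow] at h
  have h3 := Int.dvd_of_mul_dvd_mul_left (by positivity) h
  rw [pow_succ]
  exact mul_dvd_mul_left _ ((Nat.prime_iff_prime_int.mp hp).dvd_of_dvd_pow h3)

theorem Int.pow_dvd_sq_iff (hp : p.Prime) (e : ℕ) (w : ℤ) :
    (p : ℤ) ^ e ∣ w ^ 2 ↔ (p : ℤ) ^ (e - e / 2) ∣ w := by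
  constructor
  · intro h
    obtain ⟨t, rfl | rfl⟩ := Nat.even_or_odd' e
    · rw [← Int.pow_dvd_pow_iff two_ne_zero, ← pow_mul]
      exact (pow_dvd_pow _ (by omega)).trans h
    · rw [show 2 * t + 1 - (2 * t + 1) / 2 = t + 1 by omega]
      exact Int.pow_succ_dvd_of_pow_dvd_sq hp h
  · intro h
    have h2 := pow_dvd_pow_of_dvd h 2
    rw [← pow_mul] at h2
    exact (pow_dvd_pow _ (by omega)).trans h2

theorem Int.not_pow_dvd_sq_sub_of_odd (hp : p.Prime) {t e : ℕ} (he : 2 * t + 1 < e) {m : ℤ}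
    (hm : ¬ (p : ℤ) ∣ m) (w : ℤ) : ¬ (p : ℤ) ^ e ∣ w ^ 2 - (p : ℤ) ^ (2 * t + 1) * m := by
  intro h
  have hp0 : (p : ℤ) ≠ 0 := by exact_mod_cast hp.ne_zero
  have h1 : (p : ℤ) ^ (2 * t + 1) ∣ w ^ 2 :=
    (dvd_sub_left (dvd_mul_right _ _)).mp ((pow_dvd_pow _ he.le).trans h)
  have h2 := pow_dvd_pow_of_dvd (Int.pow_succ_dvd_of_pow_dvd_sq hp h1) 2
  have h3 : (p : ℤ) ^ (2 * t + 1) * p ∣ (p : ℤ) ^ (2 * t + 1) * m := by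
    rw [← pow_succ]
    refine (dvd_sub_right ?_).mp ((pow_dvd_pow _ he).trans h)
    rw [← pow_mul] at h2
    exact (pow_dvd_pow _ (by omega)).trans h2
  exact hm (Int.dvd_of_mul_dvd_mul_left (by positivity) h3)

theorem Int.exists_sq_sub_dvd_pow (hp : p.Prime) (hp2 : p ≠ 2) {m r : ℤ} (hm : ¬ (p : ℤ) ∣ m)
    (hr : (p : ℤ) ∣ r ^ 2 - m) (k : ℕ) : ∃ x : ℤ, (p : ℤ) ^ (k + 1) ∣ x ^ 2 - m := by
  have hpp := Nat.prime_iff_prime_int.mp hp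
  induction k with
  | zero => exact ⟨r, by simpa using hr⟩
  | succ k ih =>
    obtain ⟨x, c, hc⟩ := ih
    have hx : ¬ (p : ℤ) ∣ 2 * x := by
      intro h
      rcases hpp.dvd_or_dvd h with h | h
      · exact hp2 ((Nat.prime_dvd_prime_iff_eq hp Nat.prime_two).mp (by exact_mod_cast h))
      · refine hm ((dvd_sub_right (dvd_pow h two_ne_zero)).mp ?_)
        rw [hc, pow_succ, mul_assoc]
        exact (dvd_mul_right _ _).mul_left _
    obtain ⟨u, v, huv⟩ := (hpp.irreducible.coprime_iff_not_dvd.mpr hx)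
    refine ⟨x - (p : ℤ) ^ (k + 1) * (v * c), c * u + (p : ℤ) ^ k * (v * c) ^ 2, ?_⟩
    linear_combination hc - c * (p : ℤ) ^ (k + 1) * huv

theorem Int.pow_dvd_sq_sub_iff (hp : p.Prime) (hp2 : p ≠ 2) {k : ℕ} {m r : ℤ}
    (hm : ¬ (p : ℤ) ∣ m) (hr : (p : ℤ) ^ (k + 1) ∣ r ^ 2 - m) (u : ℤ) :
    (p : ℤ) ^ (k + 1) ∣ u ^ 2 - m ↔
      (p : ℤ) ^ (k + 1) ∣ u - r ∨ (p : ℤ) ^ (k + 1) ∣ u - -r := by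
  have hpp := Nat.prime_iff_prime_int.mp hp
  have key : (p : ℤ) ^ (k + 1) ∣ u ^ 2 - m ↔ (p : ℤ) ^ (k + 1) ∣ (u - r) * (u - -r) := by
    rw [show u ^ 2 - m = (u - r) * (u - -r) + (r ^ 2 - m) by ring]
    exact dvd_add_left hr
  rw [key]
  constructor
  · intro h
    by_cases h1 : (p : ℤ) ∣ u - r
    · by_cases h2 : (p : ℤ) ∣ u - -r
      · exfalso
        have h3 : (p : ℤ) ∣ 2 * r := by
          have := dvd_sub h2 h1
          rwa [show u - -r - (u - r) = 2 * r by ring] at this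
        rcases hpp.dvd_or_dvd h3 with h | h
        · exact hp2 ((Nat.prime_dvd_prime_iff_eq hp Nat.prime_two).mp (by exact_mod_cast h))
        · exact hm ((dvd_sub_right (dvd_pow h two_ne_zero)).mp
            ((dvd_pow_self _ (by omega)).trans hr))
      · exact Or.inl
          ((hpp.irreducible.coprime_iff_not_dvd.mpr h2).pow_left.dvd_of_dvd_mul_right h)
    · exact Or.inr
        ((hpp.irreducible.coprime_iff_not_dvd.mpr h1).pow_left.dvd_of_dvd_mul_left h)
  · rintro (h | h)
    · exact h.mul_right _
    · exact h.mul_left _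

theorem Int.pow_dvd_sq_sub_pow_mul_iff (hp : p.Prime) (hp2 : p ≠ 2) {t k : ℕ} {m r : ℤ}
    (hm : ¬ (p : ℤ) ∣ m) (hr : (p : ℤ) ^ (k + 1) ∣ r ^ 2 - m) (w : ℤ) :
    (p : ℤ) ^ (2 * t + (k + 1)) ∣ w ^ 2 - (p : ℤ) ^ (2 * t) * m ↔
      (p : ℤ) ^ (t + (k + 1)) ∣ w - (p : ℤ) ^ t * r ∨
        (p : ℤ) ^ (t + (k + 1)) ∣ w - -((p : ℤ) ^ t * r) := by
  have hp0 : (p : ℤ) ≠ 0 := by exact_mod_cast hp.ne_zero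
  by_cases hw : (p : ℤ) ^ t ∣ w
  · obtain ⟨u, rfl⟩ := hw
    rw [show ((p : ℤ) ^ t * u) ^ 2 - (p : ℤ) ^ (2 * t) * m = (p : ℤ) ^ (2 * t) * (u ^ 2 - m) by ring,
      ← mul_neg, ← mul_sub, ← mul_sub, pow_add, pow_add _ t,
      mul_dvd_mul_iff_left (by positivity), mul_dvd_mul_iff_left (by positivity),
      mul_dvd_mul_iff_left (by positivity)]
    exact Int.pow_dvd_sq_sub_iff hp hp2 hm hr u
  · refine iff_of_false (fun h => hw ?_) ?_
    · rw [← Int.pow_dvd_pow_iff two_ne_zero, ← pow_mul, mul_comm t]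
      exact (dvd_sub_left (dvd_mul_right _ _)).mp ((pow_dvd_pow _ (by omega)).trans h)
    · rintro (h | h)
      · exact hw ((dvd_sub_left (dvd_mul_right _ _)).mp ((pow_dvd_pow _ (by omega)).trans h))
      · exact hw ((dvd_sub_left (dvd_mul_right _ _).neg_right).mp
          ((pow_dvd_pow _ (by omega)).trans h))

theorem ZMod.natCard_sq_eq (hp : p.Prime) (e : ℕ) (M : ℤ) :
    Nat.card {w : ZMod (p ^ e) // w ^ 2 = (M : ZMod (p ^ e))} =
      ((Finset.Ico (0 : ℤ) ((p ^ e : ℕ) : ℤ)).filter fun x => (p : ℤ) ^ e ∣ x ^ 2 - M).card := by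
  have : NeZero (p ^ e) := ⟨pow_ne_zero _ hp.ne_zero⟩
  rw [ZMod.natCard_subtype_eq_card_filter]
  congr 1
  ext x
  simp only [Finset.mem_filter]
  refine and_congr_right fun _ => ?_
  rw [← Int.cast_pow, eq_comm, ZMod.intCast_eq_intCast_iff_dvd_sub]
  push_cast
  rfl

theorem ZMod.natCard_sq_eq_of_dvd (hp : p.Prime) {e : ℕ} {M : ℤ} (hM : (p : ℤ) ^ e ∣ M) :
    Nat.card {w : ZMod (p ^ e) // w ^ 2 = (M : ZMod (p ^ e))} = p ^ (e / 2) := by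
  rw [ZMod.natCard_sq_eq hp]
  have h := Int.card_Ico_filter_dvd_sub 0 (k := p ^ (e / 2)) (pow_pos hp.pos (e - e / 2))
  rw [← pow_add, show e - e / 2 + e / 2 = e by omega] at h
  rw [← h]
  congr 1
  refine Finset.filter_congr fun x _ => ?_
  rw [dvd_sub_left hM, Int.pow_dvd_sq_iff hp]
  simp

theorem ZMod.natCard_sq_eq_of_odd (hp : p.Prime) {t e : ℕ} (he : 2 * t + 1 < e) {m : ℤ}
    (hm : ¬ (p : ℤ) ∣ m) :
    Nat.card {w : ZMod (p ^ e) //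
      w ^ 2 = (((p : ℤ) ^ (2 * t + 1) * m : ℤ) : ZMod (p ^ e))} = 0 := by
  rw [ZMod.natCard_sq_eq hp, Finset.card_eq_zero, Finset.filter_eq_empty_iff]
  exact fun x _ => Int.not_pow_dvd_sq_sub_of_odd hp he hm x

theorem ZMod.natCard_sq_eq_of_not_residue (hp : p.Prime) {t e : ℕ} (he : 2 * t < e)
    {m : ℤ} (hm : ∀ r : ℤ, ¬ (p : ℤ) ∣ r ^ 2 - m) :
    Nat.card {w : ZMod (p ^ e) //
      w ^ 2 = (((p : ℤ) ^ (2 * t) * m : ℤ) : ZMod (p ^ e))} = 0 := by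
  have hp0 : (p : ℤ) ≠ 0 := by exact_mod_cast hp.ne_zero
  rw [ZMod.natCard_sq_eq hp, Finset.card_eq_zero, Finset.filter_eq_empty_iff]
  intro w _ h
  have h1 : (p : ℤ) ^ t ∣ w := by
    rw [← Int.pow_dvd_pow_iff two_ne_zero, ← pow_mul, mul_comm t]
    exact (dvd_sub_left (dvd_mul_right _ _)).mp ((pow_dvd_pow _ he.le).trans h)
  obtain ⟨u, rfl⟩ := h1
  have h2 := (pow_dvd_pow (p : ℤ) he).trans h
  rw [show ((p : ℤ) ^ t * u) ^ 2 - (p : ℤ) ^ (2 * t) * m = (p : ℤ) ^ (2 * t) * (u ^ 2 - m) by ring,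
    Nat.succ_eq_add_one, pow_succ] at h2
  exact hm u (Int.dvd_of_mul_dvd_mul_left (by positivity) h2)

theorem ZMod.natCard_sq_eq_of_residue (hp : p.Prime) (hp2 : p ≠ 2) {t e : ℕ} (he : 2 * t < e)
    {m r : ℤ} (hm : ¬ (p : ℤ) ∣ m) (hr : (p : ℤ) ∣ r ^ 2 - m) :
    Nat.card {w : ZMod (p ^ e) //
      w ^ 2 = (((p : ℤ) ^ (2 * t) * m : ℤ) : ZMod (p ^ e))} = 2 * p ^ t := by
  have hpp := Nat.prime_iff_prime_int.mp hp
  have hp0 : (p : ℤ) ≠ 0 := hpp.ne_zero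
  obtain ⟨k, rfl⟩ : ∃ k, e = 2 * t + (k + 1) := ⟨e - 2 * t - 1, by omega⟩
  obtain ⟨x, hx⟩ := Int.exists_sq_sub_dvd_pow hp hp2 hm hr k
  have hcard (v : ℤ) : ((Finset.Ico (0 : ℤ) ((p ^ (2 * t + (k + 1)) : ℕ) : ℤ)).filter
      fun y => (p : ℤ) ^ (t + (k + 1)) ∣ y - v).card = p ^ t := by
    have h := Int.card_Ico_filter_dvd_sub v (k := p ^ t) (pow_pos hp.pos (t + (k + 1)))
    rw [← pow_add, show t + (k + 1) + t = 2 * t + (k + 1) by ring] at h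
    simpa only [Nat.cast_pow] using h
  rw [ZMod.natCard_sq_eq hp, Finset.filter_congr fun w _ =>
    Int.pow_dvd_sq_sub_pow_mul_iff hp hp2 hm hx w, Finset.filter_or,
    Finset.card_union_of_disjoint, hcard, hcard, two_mul]
  rw [Finset.disjoint_filter]
  intro w _ h1 h2
  have h3 := dvd_sub h2 h1
  rw [show w - -((p : ℤ) ^ t * x) - (w - (p : ℤ) ^ t * x) = (p : ℤ) ^ t * (2 * x) by ring,
    pow_add] at h3
  have h4 := (dvd_pow_self _ (Nat.succ_ne_zero k)).trans
    (Int.dvd_of_mul_dvd_mul_left (by positivity) h3)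
  rcases hpp.dvd_or_dvd h4 with h | h
  · exact hp2 ((Nat.prime_dvd_prime_iff_eq hp Nat.prime_two).mp (by exact_mod_cast h))
  · exact hm ((dvd_sub_right (dvd_pow h two_ne_zero)).mp
      ((dvd_pow_self _ (by omega)).trans hx))

theorem ZMod.isNilpotent_natCast_of_dvd (e : ℕ) {x : ℕ} (h : p ∣ x) :
    IsNilpotent (x : ZMod (p ^ e)) := by
  refine ⟨e, ?_⟩
  rw [← Nat.cast_pow, ZMod.natCast_eq_zero_iff]
  exact pow_dvd_pow_of_dvd h e

theorem ZMod.natCard_units_sub_sq_eq (hp : p.Prime) {e c M : ℕ} (he : e ≠ 0) (hM : p ∣ M) :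
    Nat.card {z : (ZMod (p ^ e))ˣ // ((z : ZMod (p ^ e)) - c) ^ 2 = (M : ZMod (p ^ e))} =
      if p ∣ c then 0 else Nat.card {w : ZMod (p ^ e) // w ^ 2 = (M : ZMod (p ^ e))} := by
  have hnil {w : ZMod (p ^ e)} (hw : w ^ 2 = (M : ZMod (p ^ e))) : IsNilpotent w := by
    rw [← IsNilpotent.pow_iff_pos two_ne_zero, hw]
    exact ZMod.isNilpotent_natCast_of_dvd e hM
  split_ifs with hc
  · have : Fact (1 < p ^ e) := ⟨Nat.one_lt_pow he hp.one_lt⟩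
    rw [Nat.card_eq_zero]
    refine Or.inl ⟨fun ⟨z, hz⟩ => ?_⟩
    have h := Commute.isNilpotent_add (Commute.all _ _) (hnil hz)
      (ZMod.isNilpotent_natCast_of_dvd e hc)
    rw [sub_add_cancel] at h
    exact h.not_isUnit z.isUnit
  · refine Nat.card_eq_of_bijective
      (fun z => (⟨(z.1 : ZMod (p ^ e)) - c, z.2⟩ :
        {w : ZMod (p ^ e) // w ^ 2 = (M : ZMod (p ^ e))})) ⟨?_, ?_⟩
    · rintro ⟨z, hz⟩ ⟨z', hz'⟩ h
      simpa [Units.ext_iff] using h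
    · rintro ⟨w, hw⟩
      have hcu : IsUnit (c : ZMod (p ^ e)) := by
        rw [ZMod.isUnit_iff_coprime]
        exact (((Nat.Prime.coprime_iff_not_dvd hp).mpr hc).symm).pow_right e
      have hu : IsUnit (w + c) :=
        (hnil hw).isUnit_add_right_of_commute hcu (Commute.all _ _)
      exact ⟨⟨hu.unit, by simpa using hw⟩, by simp⟩

theorem Nat.Prime.int_gcd_eq_one_iff (hp : p.Prime) (a : ℤ) : a.gcd p = 1 ↔ ¬ (p : ℤ) ∣ a := by
  rw [← Int.isCoprime_iff_gcd_eq_one, isCoprime_comm,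
    (Nat.prime_iff_prime_int.mp hp).irreducible.coprime_iff_not_dvd]

theorem jacobiSym_sq_of_prime (hp : p.Prime) (a : ℤ) :
    jacobiSym a p ^ 2 = if (p : ℤ) ∣ a then 0 else 1 := by
  split_ifs with h
  · rw [sq_eq_zero_iff, jacobiSym.eq_zero_iff]
    exact ⟨hp.ne_zero, fun h' => (hp.int_gcd_eq_one_iff a).mp h' h⟩
  · exact jacobiSym.sq_one ((hp.int_gcd_eq_one_iff a).mpr h)

theorem jacobiSym_eq_one_iff_of_prime (hp : p.Prime) {a : ℤ} (ha : ¬ (p : ℤ) ∣ a) :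
    jacobiSym a p = 1 ↔ ∃ r : ℤ, (p : ℤ) ∣ r ^ 2 - a := by
  have : Fact p.Prime := ⟨hp⟩
  rw [← jacobiSym.legendreSym.to_jacobiSym, legendreSym.eq_one_iff p
    (by rwa [Ne, ZMod.intCast_zmod_eq_zero_iff_dvd])]
  constructor
  · rintro ⟨y, hy⟩
    obtain ⟨r, rfl⟩ := ZMod.intCast_surjective y
    refine ⟨r, ?_⟩
    rw [← ZMod.intCast_eq_intCast_iff_dvd_sub, hy]
    push_cast
    ring
  · rintro ⟨r, hr⟩
    rw [← ZMod.intCast_eq_intCast_iff_dvd_sub] at hr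
    exact ⟨r, by rw [hr]; push_cast; ring⟩

theorem ZMod.natCard_sq_eq_natCast (hp : p.Prime) (hp2 : p ≠ 2) (e : ℕ) {M : ℕ} (hM : M ≠ 0) :
    (Nat.card {w : ZMod (p ^ e) // w ^ 2 = (M : ZMod (p ^ e))} : ℤ) =
      if M.factorization p < e ∧ Even (M.factorization p) ∧
          jacobiSym ((M : ℤ) / (p : ℤ) ^ M.factorization p) p = 1
        then 2 * (p : ℤ) ^ (M.factorization p / 2)
      else if e ≤ M.factorization p then (p : ℤ) ^ (e / 2) else 0 := by
  have hp0 : (p : ℤ) ≠ 0 := by exact_mod_cast hp.ne_zero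
  have hnd := Nat.not_dvd_ordCompl hp hM
  have hmul := Nat.ordProj_mul_ordCompl_eq_self M p
  set s := M.factorization p
  set m := M / p ^ s
  have hm : ¬ (p : ℤ) ∣ (m : ℤ) := by exact_mod_cast hnd
  have hMm : (M : ℤ) = (p : ℤ) ^ s * (m : ℤ) := by exact_mod_cast hmul.symm
  have hcast : (M : ZMod (p ^ e)) = (((p : ℤ) ^ s * m : ℤ) : ZMod (p ^ e)) := by
    rw [← hMm, Int.cast_natCast]
  rw [hcast, hMm, Int.mul_ediv_cancel_left _ (pow_ne_zero _ hp0)]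
  by_cases hse : s < e
  · simp only [hse, true_and, not_le.mpr hse, if_false]
    obtain ⟨t, ht | ht⟩ := Nat.even_or_odd' s
    · rw [ht] at hse ⊢
      simp only [even_two_mul, true_and]
      split_ifs with hj
      · obtain ⟨r, hr⟩ := (jacobiSym_eq_one_iff_of_prime hp hm).mp hj
        rw [ZMod.natCard_sq_eq_of_residue hp hp2 hse hm hr]
        simp
      · rw [jacobiSym_eq_one_iff_of_prime hp hm, not_exists] at hj
        rw [ZMod.natCard_sq_eq_of_not_residue hp hse hj, Nat.cast_zero]
    · rw [ht] at hse ⊢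
      rw [ZMod.natCard_sq_eq_of_odd hp hse hm]
      simp
  · have hes : e ≤ s := not_lt.mp hse
    rw [ZMod.natCard_sq_eq_of_dvd hp ((pow_dvd_pow _ hes).mul_right _)]
    simp [hse, hes]

end

/-- Lemma 3 (`counting solutions`), second case: ℓ an odd prime dividing nf with
ℓ ∣ 4N + af², where s = ν_ℓ(4N + af²) and e = ν_ℓ(nf²). -/
theorem CNl_ell_dvd_disc (N f n a ℓ : ℕ) (hN : Odd N) (hN0 : 0 < N) (hf : Odd f)
    (hf0 : 0 < f) (hn : 0 < n) (ha : a % 4 = 1) (hℓ : ℓ.Prime) (hℓodd : Odd ℓ)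
    (hdvd : ℓ ∣ n * f) (hd : ℓ ∣ 4 * N + a * f ^ 2) :
    (CNl N a n f ℓ : ℤ) =
      if 1 ≤ (4 * N + a * f ^ 2).factorization ℓ ∧
          (4 * N + a * f ^ 2).factorization ℓ < (n * f ^ 2).factorization ℓ ∧
          Even ((4 * N + a * f ^ 2).factorization ℓ) ∧
          jacobiSym ((4 * (N : ℤ) + (a : ℤ) * (f : ℤ) ^ 2) /
            (ℓ : ℤ) ^ ((4 * N + a * f ^ 2).factorization ℓ)) ℓ = 1
        then 2 * (jacobiSym ((N : ℤ) + 1) ℓ) ^ 2 *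
          (ℓ : ℤ) ^ ((4 * N + a * f ^ 2).factorization ℓ / 2)
      else if (n * f ^ 2).factorization ℓ ≤ (4 * N + a * f ^ 2).factorization ℓ
        then (jacobiSym ((N : ℤ) + 1) ℓ) ^ 2 * (ℓ : ℤ) ^ ((n * f ^ 2).factorization ℓ / 2)
      else 0 := by
  have hℓ2 : ℓ ≠ 2 := by
    rintro rfl
    exact absurd hℓodd (by decide)
  set e := (n * f ^ 2).factorization ℓ
  have hmod : CNlMod n f ℓ = ℓ ^ e := by
    rw [CNlMod, mul_assoc, Nat.factorization_mul (by norm_num) (by positivity), Finsupp.add_apply,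
      Nat.factorization_eq_zero_of_not_dvd, zero_add]
    intro h
    exact hℓ2 ((Nat.prime_dvd_prime_iff_eq hℓ Nat.prime_two).mp
      (hℓ.dvd_of_dvd_pow (m := 2) (n := 2) h))
  have he0 : e ≠ 0 := by
    refine (hℓ.factorization_pos_of_dvd (by positivity) (hdvd.trans ?_)).ne'
    exact mul_dvd_mul_left n (dvd_pow_self f two_ne_zero)
  have hs : 1 ≤ (4 * N + a * f ^ 2).factorization ℓ :=
    hℓ.factorization_pos_of_dvd (by positivity) hd
  have hcard : CNl N a n f ℓ = Nat.card {z : (ZMod (ℓ ^ e))ˣ //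
      ((z : ZMod (ℓ ^ e)) - (N + 1 : ℕ)) ^ 2 = ((4 * N + a * f ^ 2 : ℕ) : ZMod (ℓ ^ e))} := by
    rw [CNl, hmod]
    refine Nat.card_congr (Equiv.subtypeEquivRight fun z => ?_)
    push_cast
    rw [← sub_eq_zero, ← sub_eq_zero (b := (4 * N + a * f ^ 2 : ZMod (ℓ ^ e)))]
    ring_nf
  have hcount := ZMod.natCard_sq_eq_natCast hℓ hℓ2 e
    (show 4 * N + a * f ^ 2 ≠ 0 by positivity)
  have hjac := jacobiSym_sq_of_prime hℓ ((N : ℤ) + 1)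
  have hcast : (ℓ : ℤ) ∣ (N : ℤ) + 1 ↔ ℓ ∣ N + 1 := by norm_cast
  simp only [hcast] at hjac
  rw [hcard, ZMod.natCard_units_sub_sq_eq hℓ he0 hd, hjac]
  by_cases hc : ℓ ∣ N + 1
  · simp [hc]
  · simp only [hc, if_false, hcount, hs, true_and, mul_one, one_mul]
    push_cast
    rfl
end
end

section
/- Suppose N and f are odd positive integers and ℓ is an odd prime dividing f. Then #C_N^{(ℓ)}(1,1,f) = 1 + ((N(N−1)²)/ℓ) if ℓ ∤ N; = 2·ℓ^{ν_ℓ(N)/2} if 1 ≤ ν_ℓ(N) < 2ν_ℓ(f), ν_ℓ(N) is even and (N_ℓ/ℓ) = 1; = ℓ^{ν_ℓ(f)} if 2ν_ℓ(f) ≤ ν_ℓ(N); and = 0 otherwise. Here (·/ℓ) is the Legendre symbol, ν_ℓ the ℓ-adic valuation, and N_ℓ = N/ℓ^{ν_ℓ(N)} the ℓ-free part of N. -/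
open scoped Classical BigOperators

noncomputable section

/-- A residue class modulo `m` meets `[0, m * k)` in exactly `k` integers. -/
theorem card_Ico_filter_modEq (m k : ℕ) (hm : 0 < m) (v : ℤ) :
    ((Finset.Ico (0 : ℤ) ((m : ℤ) * k)).filter (fun x => x ≡ v [ZMOD m])).card = k := by
  have h := Int.Ico_filter_modEq_card (0 : ℤ) ((m : ℤ) * k) (r := (m : ℤ)) (by exact_mod_cast hm) v
  have hm' : (m : ℚ) ≠ 0 := by exact_mod_cast hm.ne'
  have e : ((((m : ℤ) * k : ℤ) : ℚ) - (v : ℚ)) / ((m : ℤ) : ℚ)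
      = (((0 : ℤ) : ℚ) - (v : ℚ)) / ((m : ℤ) : ℚ) + (k : ℕ) := by
    push_cast
    field_simp
    ring
  rw [e, Int.ceil_add_natCast, add_sub_cancel_left, max_eq_left (by positivity)] at h
  convert (Nat.cast_injective h : _ = k)

/-- `CNl` counted by integer representatives, after completing the square in `D_N`. -/
theorem CNl_one_one_eq_card (N f ℓ : ℕ) (hf0 : 0 < f) (hℓ : ℓ.Prime) (hℓodd : Odd ℓ)
    (hdvd : ℓ ∣ f) :
    CNl N 1 1 f ℓ = ((Finset.Ico (0 : ℤ) ((ℓ : ℤ) ^ (2 * f.factorization ℓ))).filter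
      (fun z => ¬ (ℓ : ℤ) ∣ z ∧
        (ℓ : ℤ) ^ (2 * f.factorization ℓ) ∣ (z - (N + 1)) ^ 2 - 4 * N)).card := by
  have hq : CNlMod 1 f ℓ = ℓ ^ (2 * f.factorization ℓ) := by
    unfold CNlMod
    have h4 : (4 : ℕ).factorization ℓ = 0 := by
      refine Nat.factorization_eq_zero_of_not_dvd fun h => ?_
      have : ℓ ∣ 2 := hℓ.dvd_of_dvd_pow (n := 2) (by simpa using h)
      have := (Nat.prime_dvd_prime_iff_eq hℓ Nat.prime_two).1 this
      subst this
      exact absurd hℓodd (by decide)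
    rw [mul_one, Nat.factorization_mul (by norm_num) (by positivity), Nat.factorization_pow]
    simp [h4]
  have hs : 0 < f.factorization ℓ := hℓ.factorization_pos_of_dvd hf0.ne' hdvd
  unfold CNl
  rw [hq]
  set s := f.factorization ℓ with hs_def
  have hqz : ((ℓ : ℤ) ^ (2 * s)) = ((ℓ ^ (2 * s) : ℕ) : ℤ) := by push_cast; rfl
  have hff : ((f : ZMod (ℓ ^ (2 * s)))) ^ 2 = 0 := by
    have : ℓ ^ (2 * s) ∣ f ^ 2 := by
      rw [mul_comm, pow_mul]
      exact pow_dvd_pow_of_dvd (Nat.ordProj_dvd f ℓ) 2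
    exact_mod_cast (ZMod.natCast_eq_zero_iff (f ^ 2) _).2 this
  have hunit : ∀ z : ℤ, IsUnit (z : ZMod (ℓ ^ (2 * s))) ↔ ¬ (ℓ : ℤ) ∣ z := by
    intro z
    rw [ZMod.coe_int_isUnit_iff_isCoprime]
    push_cast
    rw [IsCoprime.pow_left_iff (by omega),
      (Nat.prime_iff_prime_int.1 hℓ).irreducible.coprime_iff_not_dvd]
  have heq : ∀ z : ℤ, ((z : ZMod (ℓ ^ (2 * s)))) ^ 2
        - 2 * ((N : ZMod (ℓ ^ (2 * s))) + 1) * (z : ZMod (ℓ ^ (2 * s)))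
        + ((N : ZMod (ℓ ^ (2 * s))) - 1) ^ 2
      = ((1 : ℕ) : ZMod (ℓ ^ (2 * s))) * (f : ZMod (ℓ ^ (2 * s))) ^ 2 ↔
      (ℓ : ℤ) ^ (2 * s) ∣ (z - (N + 1)) ^ 2 - 4 * N := by
    intro z
    rw [hff, mul_zero, hqz, ← ZMod.intCast_zmod_eq_zero_iff_dvd]
    push_cast
    constructor <;> intro h <;> linear_combination h
  have : NeZero (ℓ ^ (2 * s)) := ⟨pow_ne_zero _ hℓ.ne_zero⟩
  have hval : ∀ u : ZMod (ℓ ^ (2 * s)), ((u.val : ℤ) : ZMod (ℓ ^ (2 * s))) = u := by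
    intro u
    simp
  set S := (Finset.Ico (0 : ℤ) ((ℓ : ℤ) ^ (2 * s))).filter (fun z => ¬ (ℓ : ℤ) ∣ z ∧
    (ℓ : ℤ) ^ (2 * s) ∣ (z - (N + 1)) ^ 2 - 4 * N) with hS
  have hmem : ∀ z, z ∈ S ↔ (0 ≤ z ∧ z < (ℓ : ℤ) ^ (2 * s)) ∧ ¬ (ℓ : ℤ) ∣ z ∧
      (ℓ : ℤ) ^ (2 * s) ∣ (z - (N + 1)) ^ 2 - 4 * N := by
    intro z
    rw [hS, Finset.mem_filter, Finset.mem_Ico]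
  let g : {z : (ZMod (ℓ ^ (2 * s)))ˣ // ((z : ZMod (ℓ ^ (2 * s)))) ^ 2
        - 2 * ((N : ZMod (ℓ ^ (2 * s))) + 1) * (z : ZMod (ℓ ^ (2 * s)))
        + ((N : ZMod (ℓ ^ (2 * s))) - 1) ^ 2
      = ((1 : ℕ) : ZMod (ℓ ^ (2 * s))) * (f : ZMod (ℓ ^ (2 * s))) ^ 2} → S := fun u =>
    ⟨((u.1 : ZMod (ℓ ^ (2 * s))).val : ℤ), (hmem _).2 ⟨⟨by positivity, by
        rw [hqz]; exact_mod_cast ZMod.val_lt _⟩,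
      (hunit _).1 (by rw [hval]; exact u.1.isUnit), (heq _).1 (by rw [hval]; exact u.2)⟩⟩
  have hg : Function.Bijective g := by
    constructor
    · intro u v huv
      have h : ((u.1 : ZMod (ℓ ^ (2 * s))).val : ℤ) = ((v.1 : ZMod (ℓ ^ (2 * s))).val : ℤ) :=
        congrArg Subtype.val huv
      exact Subtype.ext (Units.ext (ZMod.val_injective _ (by exact_mod_cast h)))
    · rintro ⟨z, hz⟩
      obtain ⟨⟨hz0, hzq⟩, hzu, hze⟩ := (hmem z).1 hz
      obtain ⟨u, hu⟩ := (hunit z).2 hzu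
      refine ⟨⟨u, by rw [hu]; exact (heq z).2 hze⟩, Subtype.ext ?_⟩
      change ((u : ZMod (ℓ ^ (2 * s))).val : ℤ) = z
      rw [hu, ZMod.val_intCast, ← hqz]
      exact Int.emod_eq_of_lt hz0 hzq
  rw [Nat.card_eq_of_bijective g hg, Nat.card_eq_fintype_card, Fintype.card_coe]

/-- Square roots of `(p ^ t * c) ^ 2` modulo `p ^ e` when `2 * t < e` and `p ∤ 2 * c`. -/
theorem pow_dvd_sq_sub_sq_iff {p : ℤ} (hp : Prime p) {c : ℤ} (hc : ¬ p ∣ 2 * c) {t e : ℕ}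
    (hte : 2 * t < e) (x : ℤ) :
    p ^ e ∣ x ^ 2 - (p ^ t * c) ^ 2 ↔
      x ≡ p ^ t * c [ZMOD p ^ (e - t)] ∨ x ≡ -(p ^ t * c) [ZMOD p ^ (e - t)] := by
  obtain ⟨d, rfl⟩ : ∃ d, e = 2 * t + (d + 1) := ⟨e - 2 * t - 1, by omega⟩
  have he : 2 * t + (d + 1) - t = t + (d + 1) := by omega
  rw [he, Int.modEq_comm, Int.modEq_iff_dvd, Int.modEq_comm, Int.modEq_iff_dvd]
  have hpt : p ^ t ≠ 0 := pow_ne_zero _ hp.ne_zero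
  constructor
  · intro h
    have h1 : (p ^ t) ^ 2 ∣ x ^ 2 := by
      have h2 : (p ^ t) ^ 2 ∣ x ^ 2 - (p ^ t * c) ^ 2 :=
        (Dvd.intro (p ^ (d + 1)) (by ring)).trans h
      have h3 : (p ^ t) ^ 2 ∣ (p ^ t * c) ^ 2 := ⟨c ^ 2, by ring⟩
      exact (dvd_sub_left h3).1 h2
    obtain ⟨y, rfl⟩ := (Int.pow_dvd_pow_iff two_ne_zero).1 h1
    have h4 : p ^ (d + 1) ∣ (y - c) * (y + c) := by
      refine (mul_dvd_mul_iff_left (pow_ne_zero 2 hpt)).1 ?_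
      rw [show (p ^ t) ^ 2 * ((y - c) * (y + c)) = (p ^ t * y) ^ 2 - (p ^ t * c) ^ 2 by ring,
        show (p ^ t) ^ 2 * p ^ (d + 1) = p ^ (2 * t + (d + 1)) by ring]
      exact h
    by_cases h5 : p ∣ y - c
    · left
      have h6 : ¬ p ∣ y + c := fun h6 => hc (by
        rw [show 2 * c = (y + c) - (y - c) by ring]
        exact dvd_sub h6 h5)
      rw [pow_add, ← mul_sub]
      exact mul_dvd_mul_left _ (hp.pow_dvd_of_dvd_mul_right _ h6 h4)
    · right
      rw [pow_add, sub_neg_eq_add, ← mul_add]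
      exact mul_dvd_mul_left _ (hp.pow_dvd_of_dvd_mul_left _ h5 h4)
  · rintro (⟨y, hy⟩ | ⟨y, hy⟩)
    · exact ⟨y * (2 * c + p ^ (d + 1) * y), by
        rw [sub_eq_iff_eq_add.1 hy]; ring⟩
    · exact ⟨y * (p ^ (d + 1) * y - 2 * c), by
        rw [sub_eq_iff_eq_add.1 hy]; ring⟩

/-- A quadratic residue modulo an odd prime is a square modulo each of its powers. -/
theorem exists_pow_dvd_sub_sq {ℓ : ℕ} (hℓ : ℓ.Prime) (hℓodd : Odd ℓ) {M : ℤ}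
    (hM : jacobiSym M ℓ = 1) (k : ℕ) : ∃ c : ℤ, (ℓ : ℤ) ^ k ∣ M - c ^ 2 := by
  have : Fact ℓ.Prime := ⟨hℓ⟩
  obtain ⟨b, hb⟩ := ZMod.isSquare_of_jacobiSym_eq_one hM
  obtain ⟨a, rfl⟩ := ZMod.intCast_surjective b
  have h1 : (ℓ : ℤ) ∣ M - a ^ 2 := by
    rw [← ZMod.intCast_zmod_eq_zero_iff_dvd]
    push_cast
    rw [hb]
    ring
  have h2 : (ℓ : ℤ) ^ k ∣ M ^ ℓ ^ k - (a ^ 2) ^ ℓ ^ k :=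
    (pow_dvd_pow _ k.le_succ).trans (dvd_sub_pow_of_dvd_sub h1 k)
  obtain ⟨m, hm⟩ := hℓodd.pow (n := k)
  have hcop : IsCoprime ((ℓ : ℤ) ^ k) (M ^ m) := by
    refine IsCoprime.pow ?_
    rw [(Nat.prime_iff_prime_int.1 hℓ).irreducible.coprime_iff_not_dvd]
    intro h
    have h0 : jacobiSym M ℓ = 0 := by
      rw [← jacobiSym.legendreSym.to_jacobiSym, legendreSym.eq_zero_iff]
      exact (ZMod.intCast_zmod_eq_zero_iff_dvd M ℓ).2 h
    rw [h0] at hM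
    exact zero_ne_one hM
  obtain ⟨v, u, huv⟩ := hcop
  refine ⟨u * a ^ ℓ ^ k, ?_⟩
  obtain ⟨w, hw⟩ := h2
  refine ⟨M * v * (1 + u * M ^ m) + u ^ 2 * w, ?_⟩
  have h3 : M ^ ℓ ^ k = M * (M ^ m) ^ 2 := by rw [hm]; ring
  rw [h3] at hw
  have h4 : (a ^ 2) ^ ℓ ^ k = (a ^ ℓ ^ k) ^ 2 := by ring
  rw [h4] at hw
  linear_combination u ^ 2 * hw - M * (1 + u * M ^ m) * huv

/-- The solutions of `(z - A) ^ 2 ≡ K` prime to `p`, when `K ≡ (p ^ t * c) ^ 2` modulo `p ^ e`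
with `2 * t < e` and `p ∤ 2 * c`: each of the two residue classes contributes `p ^ t`, provided it
is prime to `p`. -/
theorem card_filter_sq_eq {p : ℕ} (hp : p.Prime) {c : ℤ} (hc : ¬ (p : ℤ) ∣ 2 * c) {t e : ℕ}
    (hte : 2 * t < e) {A K : ℤ} (hK : (p : ℤ) ^ e ∣ K - (p ^ t * c) ^ 2) :
    ((Finset.Ico (0 : ℤ) ((p : ℤ) ^ e)).filter
      (fun z => ¬ (p : ℤ) ∣ z ∧ (p : ℤ) ^ e ∣ (z - A) ^ 2 - K)).card =
      (if (p : ℤ) ∣ A + p ^ t * c then 0 else p ^ t) +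
      (if (p : ℤ) ∣ A - p ^ t * c then 0 else p ^ t) := by
  have hpz := Nat.prime_iff_prime_int.1 hp
  have hclass : ∀ v : ℤ, ((Finset.Ico (0 : ℤ) ((p : ℤ) ^ e)).filter
      (fun z => ¬ (p : ℤ) ∣ z ∧ z ≡ v [ZMOD (p : ℤ) ^ (e - t)])).card =
      if (p : ℤ) ∣ v then 0 else p ^ t := by
    intro v
    have hdvd : ∀ z : ℤ, z ≡ v [ZMOD (p : ℤ) ^ (e - t)] → ((p : ℤ) ∣ z ↔ (p : ℤ) ∣ v) := by
      intro z hz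
      have h1 : (p : ℤ) ∣ v - z := (dvd_pow_self _ (by omega)).trans (Int.modEq_iff_dvd.1 hz)
      exact ⟨fun h => (dvd_sub_left h).1 h1, fun h => (dvd_sub_right h).1 h1⟩
    split_ifs with hv
    · rw [Finset.card_eq_zero, Finset.filter_eq_empty_iff]
      rintro z - ⟨h1, h2⟩
      exact h1 ((hdvd z h2).2 hv)
    · have h := card_Ico_filter_modEq (p ^ (e - t)) (p ^ t) (pow_pos hp.pos _) v
      push_cast at h
      rw [← pow_add, Nat.sub_add_cancel (by omega)] at h
      rw [← h]
      congr 1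
      refine Finset.filter_congr fun z _ => ?_
      exact ⟨fun h => h.2, fun h => ⟨fun h' => hv ((hdvd z h).1 h'), h⟩⟩
  rw [← hclass, ← hclass, ← Finset.card_union_of_disjoint, ← Finset.filter_or]
  · congr 1
    refine Finset.filter_congr fun z _ => ?_
    rw [← and_or_left]
    refine and_congr_right fun _ => ?_
    have h1 : (p : ℤ) ^ e ∣ (z - A) ^ 2 - K ↔ (p : ℤ) ^ e ∣ (z - A) ^ 2 - (p ^ t * c) ^ 2 := by
      rw [show (z - A) ^ 2 - (p ^ t * c) ^ 2 = ((z - A) ^ 2 - K) + (K - (p ^ t * c) ^ 2) by ring]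
      exact (dvd_add_left hK).symm
    rw [h1, pow_dvd_sq_sub_sq_iff hpz hc hte, Int.modEq_iff_dvd, Int.modEq_iff_dvd,
      Int.modEq_iff_dvd, Int.modEq_iff_dvd]
    rw [show (p : ℤ) ^ t * c - (z - A) = A + p ^ t * c - z by ring,
      show -((p : ℤ) ^ t * c) - (z - A) = A - p ^ t * c - z by ring]
  · refine Finset.disjoint_filter.2 ?_
    rintro z - ⟨-, h1⟩ ⟨-, h2⟩
    have h3 := Int.modEq_iff_dvd.1 (h2.symm.trans h1)
    rw [show A + (p : ℤ) ^ t * c - (A - p ^ t * c) = p ^ t * (2 * c) by ring,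
      show e - t = t + (e - 2 * t) by omega, pow_add] at h3
    have h4 := (mul_dvd_mul_iff_left (pow_ne_zero t hpz.ne_zero)).1 h3
    exact hc ((dvd_pow_self _ (by omega)).trans h4)

/-- Lemma 3 (`counting solutions`), the case a = n = 1 and ℓ ∣ f. -/
theorem CNl_one_one_f (N f ℓ : ℕ) (hN : Odd N) (hN0 : 0 < N) (hf : Odd f) (hf0 : 0 < f)
    (hℓ : ℓ.Prime) (hℓodd : Odd ℓ) (hdvd : ℓ ∣ f) :
    (CNl N 1 1 f ℓ : ℤ) =
      if ¬ ℓ ∣ N then 1 + jacobiSym ((N : ℤ) * ((N : ℤ) - 1) ^ 2) ℓ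
      else if 1 ≤ N.factorization ℓ ∧ N.factorization ℓ < 2 * f.factorization ℓ ∧
          Even (N.factorization ℓ) ∧ jacobiSym ((N / ℓ ^ N.factorization ℓ : ℕ) : ℤ) ℓ = 1
        then 2 * (ℓ : ℤ) ^ (N.factorization ℓ / 2)
      else if 2 * f.factorization ℓ ≤ N.factorization ℓ then (ℓ : ℤ) ^ f.factorization ℓ
      else 0 := by
  have : Fact ℓ.Prime := ⟨hℓ⟩
  have hp := Nat.prime_iff_prime_int.1 hℓ
  have hs : 0 < f.factorization ℓ := hℓ.factorization_pos_of_dvd hf0.ne' hdvd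
  have h2 : ¬ (ℓ : ℤ) ∣ 2 := by
    intro h
    have := (Nat.prime_dvd_prime_iff_eq hℓ Nat.prime_two).1 (by exact_mod_cast h)
    subst this
    exact absurd hℓodd (by decide)
  have hJ0 : ∀ a : ℤ, jacobiSym a ℓ = 0 ↔ (ℓ : ℤ) ∣ a := by
    intro a
    rw [← jacobiSym.legendreSym.to_jacobiSym, legendreSym.eq_zero_iff,
      ZMod.intCast_zmod_eq_zero_iff_dvd]
  rw [CNl_one_one_eq_card N f ℓ hf0 hℓ hℓodd hdvd]
  set s := f.factorization ℓ with hs_def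
  rw [ite_not]
  split_ifs with hℓN hcond hge
  · obtain ⟨hν1, hν2, ⟨t, ht⟩, hJ⟩ := hcond
    have hNN : (N : ℤ) = ℓ ^ (2 * t) * (N / ℓ ^ N.factorization ℓ : ℕ) := by
      rw [show 2 * t = N.factorization ℓ by omega]
      exact_mod_cast (Nat.ordProj_mul_ordCompl_eq_self N ℓ).symm
    set n : ℕ := N / ℓ ^ N.factorization ℓ with hn
    obtain ⟨c, hc⟩ := exists_pow_dvd_sub_sq hℓ hℓodd hJ (2 * s)
    have hcn : (ℓ : ℤ) ∣ n - c ^ 2 := (dvd_pow_self _ (by omega)).trans hc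
    have hn0 : ¬ (ℓ : ℤ) ∣ n := by exact_mod_cast Nat.not_dvd_ordCompl hℓ hN0.ne'
    have hc0 : ¬ (ℓ : ℤ) ∣ c := fun h =>
      hn0 ((dvd_sub_left (dvd_pow h two_ne_zero)).1 hcn)
    rw [card_filter_sq_eq hℓ (c := 2 * c) (t := t) (fun h => by
      rcases hp.dvd_or_dvd h with h | h
      · exact h2 h
      · exact (hp.dvd_or_dvd h).elim h2 hc0) (by omega)
      (by
        rw [hNN, show (4 * ((ℓ : ℤ) ^ (2 * t) * n) - ((ℓ : ℤ) ^ t * (2 * c)) ^ 2)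
          = 4 * ℓ ^ (2 * t) * (n - c ^ 2) by ring]
        exact hc.mul_left _)]
    have hN1 : (ℓ : ℤ) ∣ N := by exact_mod_cast hℓN
    have ht' : (ℓ : ℤ) ∣ ℓ ^ t * (2 * c) := (dvd_pow_self _ (by omega)).mul_right _
    rw [if_neg, if_neg, show N.factorization ℓ / 2 = t by omega]
    · push_cast; ring
    · intro h
      rw [show (N : ℤ) + 1 - ℓ ^ t * (2 * c) = (N - ℓ ^ t * (2 * c)) + 1 by ring] at h
      exact hp.not_dvd_one ((dvd_add_right (dvd_sub hN1 ht')).1 h)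
    · intro h
      rw [show (N : ℤ) + 1 + ℓ ^ t * (2 * c) = (N + ℓ ^ t * (2 * c)) + 1 by ring] at h
      exact hp.not_dvd_one ((dvd_add_right (dvd_add hN1 ht')).1 h)
  · have hdN : (ℓ : ℤ) ^ (2 * s) ∣ N := by
      exact_mod_cast (pow_dvd_pow ℓ hge).trans (Nat.ordProj_dvd N ℓ)
    have hN1 : (ℓ : ℤ) ∣ N := by exact_mod_cast hℓN
    have h := card_Ico_filter_modEq (ℓ ^ s) (ℓ ^ s) (pow_pos hℓ.pos _) (N + 1)
    push_cast at h
    rw [← pow_add, ← two_mul] at h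
    rw [← Nat.cast_pow ℓ s, ← h]
    congr 2
    refine Finset.filter_congr fun z _ => ?_
    have hsq : (ℓ : ℤ) ^ (2 * s) ∣ (z - (N + 1)) ^ 2 - 4 * N ↔ (ℓ : ℤ) ^ s ∣ z - (N + 1) := by
      rw [dvd_sub_left (hdN.mul_left 4), mul_comm 2 s, pow_mul, Int.pow_dvd_pow_iff two_ne_zero]
    rw [hsq, Int.modEq_comm, Int.modEq_iff_dvd]
    refine ⟨fun h => h.2, fun h => ⟨fun hz => ?_, h⟩⟩
    have h3 : (ℓ : ℤ) ∣ z - (N + 1) := (dvd_pow_self _ (by omega)).trans h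
    exact hp.not_dvd_one ((dvd_add_right hN1).1 ((dvd_sub_right hz).1 h3))
  · rw [Finset.filter_eq_empty_iff.2, Finset.card_empty, Nat.cast_zero]
    rintro z - ⟨-, hz⟩
    have hν1 : 1 ≤ N.factorization ℓ := hℓ.factorization_pos_of_dvd hN0.ne' hℓN
    have hn0 : ¬ (ℓ : ℤ) ∣ (N / ℓ ^ N.factorization ℓ : ℕ) := by
      exact_mod_cast Nat.not_dvd_ordCompl hℓ hN0.ne'
    have hNN : (N : ℤ) = ℓ ^ N.factorization ℓ * (N / ℓ ^ N.factorization ℓ : ℕ) := by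
      exact_mod_cast (Nat.ordProj_mul_ordCompl_eq_self N ℓ).symm
    generalize z - ((N : ℤ) + 1) = x at hz
    set n : ℕ := N / ℓ ^ N.factorization ℓ with hn
    set ν := N.factorization ℓ with hν
    obtain ⟨d, hd⟩ : ∃ d, 2 * s = ν + (d + 1) := ⟨2 * s - ν - 1, by omega⟩
    rw [hNN, hd] at hz
    have hx : (ℓ : ℤ) ^ ν ∣ x ^ 2 :=
      (dvd_sub_left (Dvd.intro (4 * (n : ℤ)) (by ring))).1
        ((pow_dvd_pow (ℓ : ℤ) (Nat.le_add_right ν (d + 1))).trans hz)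
    have hx' : (ℓ : ℤ) ^ (ν / 2) ∣ x := by
      refine (Int.pow_dvd_pow_iff two_ne_zero).1 ?_
      rw [← pow_mul]
      exact (pow_dvd_pow _ (by omega)).trans hx
    obtain ⟨y, rfl⟩ := hx'
    rcases Nat.even_or_odd' ν with ⟨t, ht | ht⟩
    · rw [show ν / 2 = t by omega, ht, pow_add,
        show ((ℓ : ℤ) ^ t * y) ^ 2 - 4 * (ℓ ^ (2 * t) * n) = ℓ ^ (2 * t) * (y ^ 2 - n * 2 ^ 2) by
          ring] at hz
      have hz' := (dvd_pow_self _ d.succ_ne_zero).trans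
        ((mul_dvd_mul_iff_left (pow_ne_zero _ hp.ne_zero)).1 hz)
      rcases jacobiSym.trichotomy n ℓ with h | h | h
      · exact hn0 ((hJ0 _).1 h)
      · exact hcond ⟨hν1, by omega, ⟨t, by omega⟩, h⟩
      · exact h2 (jacobiSym.prime_dvd_of_eq_neg_one h hz').2
    · rw [show ν / 2 = t by omega, ht] at hx hz
      rw [show ((ℓ : ℤ) ^ t * y) ^ 2 = ℓ ^ (2 * t) * y ^ 2 by ring, pow_succ] at hx
      have hy : (ℓ : ℤ) ∣ y :=
        hp.dvd_of_dvd_pow ((mul_dvd_mul_iff_left (pow_ne_zero _ hp.ne_zero)).1 hx)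
      obtain ⟨w, rfl⟩ := hy
      rw [show ((ℓ : ℤ) ^ t * (ℓ * w)) ^ 2 - 4 * (ℓ ^ (2 * t + 1) * n)
          = ℓ ^ (2 * t + 1) * (ℓ * w ^ 2 - 2 * (2 * n)) by ring, pow_add] at hz
      have hz' := (dvd_pow_self _ d.succ_ne_zero).trans
        ((mul_dvd_mul_iff_left (pow_ne_zero _ hp.ne_zero)).1 hz)
      have h3 := (dvd_sub_right (dvd_mul_right (ℓ : ℤ) (w ^ 2))).1 hz'
      rcases hp.dvd_or_dvd h3 with h3 | h3
      · exact h2 h3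
      · exact (hp.dvd_or_dvd h3).elim h2 hn0
  · have hN' : ¬ (ℓ : ℤ) ∣ N := by exact_mod_cast hℓN
    rw [jacobiSym.mul_left, jacobiSym.pow_left]
    rcases jacobiSym.trichotomy N ℓ with h | h | h
    · exact absurd ((hJ0 _).1 h) hN'
    · obtain ⟨c, hc⟩ := exists_pow_dvd_sub_sq hℓ hℓodd h (2 * s)
      have hcN : (ℓ : ℤ) ∣ N - c ^ 2 := (dvd_pow_self _ (by omega)).trans hc
      have hc0 : ¬ (ℓ : ℤ) ∣ c := fun h =>
        hN' ((dvd_sub_left (dvd_pow h two_ne_zero)).1 hcN)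
      rw [card_filter_sq_eq hℓ (c := 2 * c) (t := 0) (fun h => by
        rcases hp.dvd_or_dvd h with h | h
        · exact h2 h
        · exact (hp.dvd_or_dvd h).elim h2 hc0) (by omega)
        (by
          rw [show (4 * N - ((ℓ : ℤ) ^ 0 * (2 * c)) ^ 2) = 4 * (N - c ^ 2) by ring]
          exact hc.mul_left 4)]
      have hplus : (ℓ : ℤ) ∣ N + 1 + ℓ ^ 0 * (2 * c) ↔ (ℓ : ℤ) ∣ c + 1 := by
        rw [show (N : ℤ) + 1 + ℓ ^ 0 * (2 * c) = (N - c ^ 2) + (c + 1) ^ 2 by ring,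
          dvd_add_right hcN, hp.dvd_pow_iff_dvd two_ne_zero]
      have hminus : (ℓ : ℤ) ∣ N + 1 - ℓ ^ 0 * (2 * c) ↔ (ℓ : ℤ) ∣ c - 1 := by
        rw [show (N : ℤ) + 1 - ℓ ^ 0 * (2 * c) = (N - c ^ 2) + (c - 1) ^ 2 by ring,
          dvd_add_right hcN, hp.dvd_pow_iff_dvd two_ne_zero]
      have hN1 : (ℓ : ℤ) ∣ N - 1 ↔ (ℓ : ℤ) ∣ c + 1 ∨ (ℓ : ℤ) ∣ c - 1 := by
        rw [show (N : ℤ) - 1 = (N - c ^ 2) + (c + 1) * (c - 1) by ring, dvd_add_right hcN,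
          hp.dvd_mul]
      have hboth : ¬ ((ℓ : ℤ) ∣ c + 1 ∧ (ℓ : ℤ) ∣ c - 1) := fun h =>
        h2 (by simpa [show c + 1 - (c - 1) = 2 by ring] using dvd_sub h.1 h.2)
      rw [h]
      simp only [hplus, hminus]
      rw [pow_zero, one_mul]
      by_cases hd : (ℓ : ℤ) ∣ N - 1
      · rw [(hJ0 _).2 hd]
        rcases hN1.1 hd with h1 | h1
        · rw [if_pos h1, if_neg fun h' => hboth ⟨h1, h'⟩]
          norm_num
        · rw [if_pos h1, if_neg fun h' => hboth ⟨h', h1⟩]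
          norm_num
      · rw [if_neg fun h' => hd (hN1.2 (Or.inl h')), if_neg fun h' => hd (hN1.2 (Or.inr h'))]
        rcases jacobiSym.trichotomy ((N : ℤ) - 1) ℓ with h' | h' | h'
        · exact absurd ((hJ0 _).1 h') hd
        · rw [h']; norm_num
        · rw [h']; norm_num
    · have hd : ¬ (ℓ : ℤ) ∣ N - 1 := by
        intro h1
        refine absurd (jacobiSym.prime_dvd_of_eq_neg_one h (x := 1) (y := 1) ?_).1 hp.not_dvd_one
        rw [show (1 : ℤ) ^ 2 - N * 1 ^ 2 = -(N - 1) by ring]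
        exact h1.neg_right
      rw [Finset.filter_eq_empty_iff.2, h]
      · rcases jacobiSym.trichotomy ((N : ℤ) - 1) ℓ with h' | h' | h'
        · exact absurd ((hJ0 _).1 h') hd
        · rw [h']; norm_num
        · rw [h']; norm_num
      · rintro z - ⟨-, hz⟩
        refine h2 (jacobiSym.prime_dvd_of_eq_neg_one h (x := z - (N + 1)) (y := 2) ?_).2
        rw [show (N : ℤ) * 2 ^ 2 = 4 * N by ring]
        exact (dvd_pow_self _ (by omega)).trans hz
end
end

section
/- Suppose N and f are odd positive integers, n is a positive integer, and a ≡ 1 (mod 4). Then #C_N^{(2)}(a,n,f) = 2 if n is odd; #C_N^{(2)}(a,n,f) = 4 if n is even and a ≡ 5 (mod 8); and #C_N^{(2)}(a,n,f) = 0 otherwise. -/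
open scoped Classical BigOperators

noncomputable section

lemma Int.exists_two_pow_dvd_sq_sub {c : ℤ} (hc : c % 8 = 1) (k : ℕ) :
    ∃ x : ℤ, 2 ^ (k + 3) ∣ x ^ 2 - c := by
  induction k with
  | zero => exact ⟨1, by norm_num; omega⟩
  | succ k ih =>
    obtain ⟨x, m, hm⟩ := ih
    have hx : Odd x := by
      have h : Odd (x ^ 2) := by
        have h8 : x ^ 2 = c + 2 * (2 ^ (k + 2) * m) := by rw [pow_succ 2 (k + 2)] at hm; linarith
        rw [h8, Int.odd_iff]
        omega
      exact (Int.odd_pow.mp h).resolve_right (by norm_num)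
    rcases Int.even_or_odd m with ⟨t, ht⟩ | hmo
    · exact ⟨x, t, by rw [hm, ht]; ring⟩
    · obtain ⟨t, ht⟩ := hmo.add_odd hx
      refine ⟨x + 2 ^ (k + 2), t + 2 ^ k, ?_⟩
      have h : (x + 2 ^ (k + 2)) ^ 2 - c = (x ^ 2 - c) + 2 ^ (k + 3) * x + 2 ^ (k + 4) * 2 ^ k := by
        ring
      rw [h, hm, ← mul_add, ht]
      ring

/-- If `x` is odd and `y ^ 2 ≡ x ^ 2` modulo `2 ^ (k + 2)`, then `y ≡ ± x` modulo `2 ^ (k + 1)`. -/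
lemma Int.two_pow_dvd_sub_or_add_of_dvd_sq_sub_sq {x y : ℤ} (hx : Odd x) (k : ℕ)
    (h : 2 ^ (k + 2) ∣ y ^ 2 - x ^ 2) : 2 ^ (k + 1) ∣ y - x ∨ 2 ^ (k + 1) ∣ y + x := by
  have hy : Odd y := by
    have h2 : (2 : ℤ) ∣ y ^ 2 - x ^ 2 := (dvd_pow_self 2 (by omega)).trans h
    have h3 : Odd (y ^ 2) := by
      have := (even_iff_two_dvd.mpr h2).add_odd (hx.pow (n := 2))
      simpa using this
    exact (Int.odd_pow.mp h3).resolve_right (by norm_num)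
  obtain ⟨s, hs⟩ := hy.sub_odd hx
  obtain ⟨t, ht⟩ := hy.add_odd hx
  have hst : (2 : ℤ) ^ k ∣ s * t := by
    have h4 : y ^ 2 - x ^ 2 = 4 * (s * t) := by
      have : y ^ 2 - x ^ 2 = (y - x) * (y + x) := by ring
      rw [this, hs, ht]; ring
    rw [h4, pow_add, mul_comm] at h
    exact (mul_dvd_mul_iff_left (by norm_num : (2 : ℤ) ^ 2 ≠ 0)).mp (by simpa using h)
  have hodd : Odd s ∨ Odd t := by
    by_contra! hcon
    obtain ⟨h1, h2⟩ := hcon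
    rw [Int.not_odd_iff_even, Int.even_iff] at h1 h2
    rw [Int.odd_iff] at hx
    omega
  have key : ∀ u v : ℤ, Odd u → (2 : ℤ) ^ k ∣ u * v → (2 : ℤ) ^ (k + 1) ∣ v + v := by
    intro u v hu huv
    have hcop : IsCoprime ((2 : ℤ) ^ k) u :=
      IsCoprime.pow_left (by obtain ⟨t, rfl⟩ := hu; exact ⟨-t, 1, by ring⟩)
    obtain ⟨r, hr⟩ := hcop.dvd_of_dvd_mul_left huv
    exact ⟨r, by rw [hr]; ring⟩
  rcases hodd with hs' | ht'
  · exact Or.inr (ht ▸ key s t hs' hst)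
  · exact Or.inl (hs ▸ key t s ht' (mul_comm s t ▸ hst))

lemma ZMod.card_sq_eq_of_mod_eight_eq_one {c : ℤ} (hc : c % 8 = 1) (k : ℕ) :
    Nat.card {w : ZMod (2 ^ (k + 3)) // w ^ 2 = (c : ZMod (2 ^ (k + 3)))} = 4 := by
  obtain ⟨x, hxc⟩ := Int.exists_two_pow_dvd_sq_sub hc k
  have cast_eq : ∀ u v : ℤ, (u : ZMod (2 ^ (k + 3))) = v ↔ (2 : ℤ) ^ (k + 3) ∣ u - v := by
    intro u v
    rw [eq_comm, ZMod.intCast_eq_intCast_iff_dvd_sub]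
    simp
  have hx : Odd x := by
    have h2 : (2 : ℤ) ∣ x ^ 2 - c := (dvd_pow_self 2 (by omega)).trans hxc
    have h3 : Odd (x ^ 2) := by rw [Int.odd_iff]; omega
    exact (Int.odd_pow.mp h3).resolve_right (by norm_num)
  have hset : {w : ZMod (2 ^ (k + 3)) | w ^ 2 = (c : ZMod (2 ^ (k + 3)))} =
      (({(x : ZMod (2 ^ (k + 3))), ((-x : ℤ) : ZMod (2 ^ (k + 3))),
        ((x + 2 ^ (k + 2) : ℤ) : ZMod (2 ^ (k + 3))),
        ((-x + 2 ^ (k + 2) : ℤ) : ZMod (2 ^ (k + 3)))} : Finset (ZMod (2 ^ (k + 3)))) :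
        Set (ZMod (2 ^ (k + 3)))) := by
    ext w
    obtain ⟨y, rfl⟩ := ZMod.intCast_surjective w
    simp only [Set.mem_ofPred_eq, Finset.coe_insert, Finset.coe_singleton, Set.mem_insert_iff,
      Set.mem_singleton_iff]
    rw [← Int.cast_pow]
    simp only [cast_eq]
    constructor
    · intro h
      have h' : (2 : ℤ) ^ (k + 1 + 2) ∣ y ^ 2 - x ^ 2 := by
        have := dvd_sub h hxc
        simpa using this
      rcases Int.two_pow_dvd_sub_or_add_of_dvd_sq_sub_sq hx _ h' with ⟨m, hm⟩ | ⟨m, hm⟩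
      · rcases Int.even_or_odd' m with ⟨t, rfl | rfl⟩
        · exact Or.inl ⟨t, by rw [hm]; ring⟩
        · refine Or.inr (Or.inr (Or.inl ⟨t, ?_⟩))
          rw [← sub_sub, hm]; ring
      · rcases Int.even_or_odd' m with ⟨t, rfl | rfl⟩
        · exact Or.inr (Or.inl ⟨t, by rw [sub_neg_eq_add, hm]; ring⟩)
        · refine Or.inr (Or.inr (Or.inr ⟨t, ?_⟩))
          rw [← sub_sub, sub_neg_eq_add, hm]; ring
    · obtain ⟨m, hm⟩ := hxc
      have hxx : c = x ^ 2 - 2 ^ (k + 3) * m := by linarith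
      rw [hxx]
      rintro (⟨t, ht⟩ | ⟨t, ht⟩ | ⟨t, ht⟩ | ⟨t, ht⟩)
      · obtain rfl : y = x + 2 ^ (k + 3) * t := by linarith
        exact ⟨2 * x * t + 2 ^ (k + 3) * t ^ 2 + m, by ring⟩
      · obtain rfl : y = -x + 2 ^ (k + 3) * t := by linarith
        exact ⟨-2 * x * t + 2 ^ (k + 3) * t ^ 2 + m, by ring⟩
      · obtain rfl : y = x + 2 ^ (k + 2) + 2 ^ (k + 3) * t := by linarith
        exact ⟨x * (1 + 2 * t) + 2 ^ (k + 1) * (1 + 2 * t) ^ 2 + m, by ring⟩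
      · obtain rfl : y = -x + 2 ^ (k + 2) + 2 ^ (k + 3) * t := by linarith
        exact ⟨-x * (1 + 2 * t) + 2 ^ (k + 1) * (1 + 2 * t) ^ 2 + m, by ring⟩
  have hcard : Nat.card {w : ZMod (2 ^ (k + 3)) // w ^ 2 = (c : ZMod (2 ^ (k + 3)))} =
      Set.ncard {w : ZMod (2 ^ (k + 3)) | w ^ 2 = (c : ZMod (2 ^ (k + 3)))} := rfl
  rw [hcard, hset, Set.ncard_coe_finset]
  have not_dvd_half : ∀ u : ℤ, Odd u → ¬ (2 : ℤ) ^ (k + 3) ∣ 2 ^ (k + 2) * u := by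
    rintro u hu hd
    rw [pow_succ, mul_dvd_mul_iff_left (by positivity)] at hd
    rw [Int.odd_iff] at hu
    omega
  have not_dvd_double : ∀ u s : ℤ, Odd u → ¬ (2 : ℤ) ^ (k + 3) ∣ 2 * u + 2 ^ (k + 2) * s := by
    rintro u s hu hd
    have h4 : (4 : ℤ) ∣ 2 * u + 2 ^ (k + 2) * s :=
      Dvd.dvd.trans ⟨2 ^ (k + 1), by ring⟩ hd
    have h4' : (4 : ℤ) ∣ 2 ^ (k + 2) * s := ⟨2 ^ k * s, by ring⟩
    rw [Int.odd_iff] at hu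
    omega
  rw [Finset.card_insert_of_notMem, Finset.card_insert_of_notMem, Finset.card_insert_of_notMem,
    Finset.card_singleton]
  · simp only [Finset.mem_singleton, cast_eq]
    convert not_dvd_double x 0 hx using 2
    ring
  · simp only [Finset.mem_insert, Finset.mem_singleton, cast_eq, not_or]
    constructor
    · convert not_dvd_double (-x) (-1) hx.neg using 2
      ring
    · convert not_dvd_half (-1) (by decide) using 2
      ring
  · simp only [Finset.mem_insert, Finset.mem_singleton, cast_eq, not_or]
    refine ⟨?_, ?_, ?_⟩
    · convert not_dvd_double x 0 hx using 2
      ring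
    · convert not_dvd_half (-1) (by decide) using 2
      ring
    · convert not_dvd_double x (-1) hx using 2
      ring

lemma ZMod.card_sq_eq_of_mod_eight_ne_one {c : ℤ} (hc : Odd c) (hc' : c % 8 ≠ 1) (k : ℕ) :
    Nat.card {w : ZMod (2 ^ (k + 3)) // w ^ 2 = (c : ZMod (2 ^ (k + 3)))} = 0 := by
  rw [Nat.card_eq_zero]
  left
  refine ⟨fun ⟨w, hw⟩ => hc' ?_⟩
  obtain ⟨y, rfl⟩ := ZMod.intCast_surjective w
  rw [← Int.cast_pow, ZMod.intCast_eq_intCast_iff_dvd_sub] at hw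
  have h8 : (8 : ℤ) ∣ c - y ^ 2 := Dvd.dvd.trans ⟨2 ^ k, by push_cast; ring⟩ hw
  have hy : Odd (y ^ 2) := by rw [Int.odd_iff] at *; omega
  have := Int.eight_dvd_sq_sub_one_of_odd ((Int.odd_pow.mp hy).resolve_right (by norm_num))
  omega

lemma ZMod.isUnit_intCast_two_pow {c : ℤ} (hc : Odd c) (k : ℕ) :
    IsUnit (c : ZMod (2 ^ k)) := by
  rw [ZMod.coe_int_isUnit_iff_isCoprime]
  push_cast
  refine IsCoprime.pow_left ?_
  obtain ⟨t, rfl⟩ := hc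
  exact ⟨-t, 1, by ring⟩

/-- Completing the square: `D_N(z) = (z - N - 1) ^ 2 - 4 N`. -/
lemma CNl_two_eq_card_sq_eq (N f n a k : ℕ) (hN : Odd N) (hf : Odd f) (ha : Odd a)
    (hk : (4 * n * f ^ 2).factorization 2 = k) :
    CNl N a n f 2 = Nat.card {w : ZMod (2 ^ k) //
      w ^ 2 = ((4 * N + a * f ^ 2 : ℤ) : ZMod (2 ^ k))} := by
  rw [CNl, CNlMod, hk]
  refine Nat.card_eq_of_bijective
    (fun z => ⟨(z.1 : ZMod (2 ^ k)) - (N : ZMod (2 ^ k)) - 1, ?_⟩) ⟨?_, ?_⟩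
  · have h := z.2
    push_cast
    linear_combination h
  · rintro ⟨z, hz⟩ ⟨z', hz'⟩ h
    simpa [Units.ext_iff] using h
  · rintro ⟨w, hw⟩
    push_cast at hw
    have hc : Odd ((a : ℤ) * f ^ 2 - (N - 1) ^ 2) := by
      have h1 : Odd ((a : ℤ) * f ^ 2) := by exact_mod_cast ha.mul hf.pow
      have h2 : Even (((N : ℤ) - 1) ^ 2) := by
        have : Odd (N : ℤ) := by exact_mod_cast hN
        exact (this.sub_odd odd_one).pow_of_ne_zero (by norm_num)
      exact h1.sub_even h2
    have hu : IsUnit (w + (N : ZMod (2 ^ k)) + 1) := by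
      have h := ZMod.isUnit_intCast_two_pow hc k
      have he : (((a : ℤ) * f ^ 2 - (N - 1) ^ 2 : ℤ) : ZMod (2 ^ k)) =
          (w + (N : ZMod (2 ^ k)) + 1) * (w - (N : ZMod (2 ^ k)) - 1) := by
        push_cast
        linear_combination -hw
      rw [he] at h
      exact isUnit_of_mul_isUnit_left h
    obtain ⟨z, hz⟩ := hu
    refine ⟨⟨z, ?_⟩, ?_⟩
    · rw [hz]
      linear_combination hw
    · simp only [Subtype.mk.injEq]
      rw [hz]
      ring

lemma factorization_two_four_mul_mul_sq {n f : ℕ} (hn : 0 < n) (hf : Odd f) :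
    (4 * n * f ^ 2).factorization 2 = n.factorization 2 + 2 := by
  have hf' : f.factorization 2 = 0 :=
    Nat.factorization_eq_zero_of_not_dvd hf.not_two_dvd_nat
  have h4 : Nat.factorization 4 2 = 2 := by
    rw [show 4 = 2 ^ 2 by norm_num, Nat.Prime.factorization_pow Nat.prime_two]
    simp
  rw [Nat.factorization_mul (by omega) (pow_ne_zero _ hf.pos.ne'),
    Nat.factorization_mul (by omega) hn.ne', Nat.factorization_pow]
  simp [hf', h4, add_comm]

/-- Lemma 3 (`counting solutions`), the prime ℓ = 2. -/
theorem CNl_two (N f n a : ℕ) (hN : Odd N) (hN0 : 0 < N) (hf : Odd f) (hf0 : 0 < f)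
    (hn : 0 < n) (ha : a % 4 = 1) :
    CNl N a n f 2 = if Odd n then 2 else if a % 8 = 5 then 4 else 0 := by
  have ha' : Odd a := by rw [Nat.odd_iff]; omega
  have hk := factorization_two_four_mul_mul_sq hn hf
  have hc : (4 * N + a * f ^ 2 : ℤ) % 8 = (4 + a) % 8 := by
    obtain ⟨s, hs⟩ := hN
    have hf2 := Int.eight_dvd_sq_sub_one_of_odd (k := f) (by exact_mod_cast hf)
    have hfa : (8 : ℤ) ∣ a * f ^ 2 - a := by
      simpa [mul_sub] using hf2.mul_left (a : ℤ)
    omega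
  split_ifs with hn' ha8
  · rw [Nat.factorization_eq_zero_of_not_dvd hn'.not_two_dvd_nat] at hk
    rw [CNl_two_eq_card_sq_eq N f n a 2 hN hf ha' hk]
    have h1 : ((4 * N + a * f ^ 2 : ℤ) : ZMod (2 ^ 2)) = 1 := by
      rw [← Int.cast_one, eq_comm, ZMod.intCast_eq_intCast_iff_dvd_sub]
      push_cast
      omega
    rw [h1]
    change Nat.card {w : ZMod 4 // w ^ 2 = 1} = 2
    have hs : {w : ZMod 4 | w ^ 2 = 1} = {1, 3} := by
      ext w
      simp only [Set.mem_ofPred_eq, Set.mem_insert_iff, Set.mem_singleton_iff]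
      revert w
      decide
    change Set.ncard {w : ZMod 4 | w ^ 2 = 1} = 2
    rw [hs, Set.ncard_pair (by decide)]
  all_goals
    have hpos : 0 < n.factorization 2 := Nat.prime_two.factorization_pos_of_dvd hn.ne'
      (Nat.not_odd_iff_even.mp hn').two_dvd
    obtain ⟨k, hk'⟩ := Nat.exists_eq_add_of_lt hpos
    rw [hk', show 0 + k + 1 + 2 = k + 3 by ring] at hk
    rw [CNl_two_eq_card_sq_eq N f n a (k + 3) hN hf ha' hk]
  · exact ZMod.card_sq_eq_of_mod_eight_eq_one (by omega) k
  · exact ZMod.card_sq_eq_of_mod_eight_ne_one (by rw [Int.odd_iff]; omega) (by omega) k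
end
end
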